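/- Let d ≥ 2 and let Ω be a homogeneous function of degree zero on ℝ^d∖{0} satisfying the cancellation condition and Ω ∈ L log L(S^{d-1}). Then the maximal truncated rough singular integral operator T_{Ω,*} is of weak type (1,1): there is a constant C depending only on d such that for every f ∈ L¹(ℝ^d) and every λ > 0, λ·|{x ∈ ℝ^d : T_{Ω,*} f(x) > λ}| ≤ C·C_Ω·‖f‖_{L¹(ℝ^d)}. -/

import Mathlib

open MeasureTheory Metric Set
open scoped ENNReal

noncomputable section

abbrev Rd (d : ℕ) : Type := EuclideanSpace ℝ (Fin d)

/-- Surface measure on the unit sphere `S^{d-1}`. -/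
def sphereMeasure (d : ℕ) : Measure (sphere (0 : Rd d) 1) :=
  (volume : Measure (Rd d)).toSphere

/-- Integral over the sphere of a function defined on `ℝ^d`. -/
def sphInt (d : ℕ) (g : Rd d → ℝ) : ℝ :=
  ∫ θ : sphere (0 : Rd d) 1, g (θ : Rd d) ∂(sphereMeasure d)

/-- `‖Ω‖₁`, the `L¹(S^{d-1})` norm of `Ω`. -/
def omegaL1 (d : ℕ) (Ω : Rd d → ℝ) : ℝ := sphInt d (fun x => |Ω x|)

/-- `‖Ω‖_{LlogL(S^{d-1})}`. -/
def omegaLlogL (d : ℕ) (Ω : Rd d → ℝ) : ℝ :=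
  sphInt d (fun x => |Ω x| * Real.log (2 + |Ω x|))

/-- The constant `C_Ω`. -/
def constCOmega (d : ℕ) (Ω : Rd d → ℝ) : ℝ :=
  omegaLlogL d Ω +
    sphInt d (fun x => |Ω x| * (1 + max (Real.log (|Ω x| / omegaL1 d Ω)) 0))

/-- `Ω` is homogeneous of degree zero on `ℝ^d ∖ {0}`. -/
def Homogeneous0 (d : ℕ) (Ω : Rd d → ℝ) : Prop :=
  ∀ x : Rd d, x ≠ 0 → ∀ r : ℝ, 0 < r → Ω (r • x) = Ω x

/-- The maximal truncated rough singular integral operator `T_{Ω,*}`. -/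
def TOmegaStar (d : ℕ) (Ω f : Rd d → ℝ) (x : Rd d) : ℝ≥0∞ :=
  ⨆ (ε : ℝ) (_ : 0 < ε),
    ENNReal.ofReal
      |∫ y in {y : Rd d | ε < ‖x - y‖}, Ω (x - y) * ‖x - y‖ ^ (-(d : ℤ)) * f y|

section ConvolutionFourier

open FourierTransform Convolution SchwartzMap

variable {d : ℕ}

/-- Bounded integrable functions. -/
structure Nice (g : Rd d → ℝ) : Prop where
  int : Integrable g
  bdd : ∃ M, ∀ x, |g x| ≤ M

namespace Nice

variable {f g : Rd d → ℝ}

theorem add (hf : Nice f) (hg : Nice g) : Nice (fun x => f x + g x) := by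
  obtain ⟨M, hM⟩ := hf.bdd
  obtain ⟨N, hN⟩ := hg.bdd
  exact ⟨hf.int.add hg.int, M + N, fun x => (abs_add_le _ _).trans (add_le_add (hM x) (hN x))⟩

theorem const_mul (hf : Nice f) (c : ℝ) : Nice (fun x => c * f x) := by
  obtain ⟨M, hM⟩ := hf.bdd
  exact ⟨hf.int.const_mul c, |c| * M, fun x => by
    rw [abs_mul]; exact mul_le_mul_of_nonneg_left (hM x) (abs_nonneg c)⟩

theorem sub (hf : Nice f) (hg : Nice g) : Nice (fun x => f x - g x) := by
  obtain ⟨M, hM⟩ := hf.bdd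
  obtain ⟨N, hN⟩ := hg.bdd
  exact ⟨hf.int.sub hg.int, M + N, fun x => (abs_sub _ _).trans (add_le_add (hM x) (hN x))⟩

theorem zero : Nice (fun _ : Rd d => (0 : ℝ)) :=
  ⟨integrable_zero _ _ _, 0, fun x => by simp⟩

theorem sum {ι : Type*} {s : Finset ι} {F : ι → Rd d → ℝ} (h : ∀ i ∈ s, Nice (F i)) :
    Nice (fun x => ∑ i ∈ s, F i x) := by
  classical
  induction s using Finset.induction_on with
  | empty => simpa using zero
  | insert a s ha ih =>
    simp only [Finset.sum_insert ha]
    exact (h a (by simp)).add (ih fun i hi => h i (by simp [hi]))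

theorem abs (hf : Nice f) : Nice (fun x => |f x|) := by
  obtain ⟨M, hM⟩ := hf.bdd
  exact ⟨hf.int.abs, M, fun x => by simpa using hM x⟩

theorem mono (hg : Nice g) (hm : AEStronglyMeasurable f) (h : ∀ x, |f x| ≤ |g x|) : Nice f := by
  obtain ⟨M, hM⟩ := hg.bdd
  exact ⟨hg.int.mono hm (.of_forall h), M, fun x => (h x).trans (hM x)⟩

theorem mul (hf : Nice f) (hg : Nice g) : Nice (fun x => f x * g x) := by
  obtain ⟨M, hM⟩ := hf.bdd
  obtain ⟨N, hN⟩ := hg.bdd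
  refine ⟨?_, M * N, fun x => ?_⟩
  · exact hf.int.mul_bdd hg.int.aestronglyMeasurable (.of_forall hN)
  · rw [abs_mul]
    exact mul_le_mul (hM x) (hN x) (abs_nonneg _) ((abs_nonneg _).trans (hM x))

theorem sq (hf : Nice f) : Nice (fun x => f x ^ 2) := by
  simpa only [pow_two] using hf.mul hf

theorem memLp_two (hf : Nice f) : MemLp f 2 := by
  rw [memLp_two_iff_integrable_sq hf.int.aestronglyMeasurable]
  exact hf.sq.int

end Nice

/-- Convolution of real functions. -/
def cv (k g : Rd d → ℝ) (x : Rd d) : ℝ := ∫ y, k (x - y) * g y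

theorem cv_eq_conv (k g : Rd d → ℝ) : cv k g = k ⋆[ContinuousLinearMap.mul ℝ ℝ] g := by
  ext x
  rw [convolution_mul_swap]
  rfl

theorem cv_comm (k g : Rd d → ℝ) : cv k g = cv g k := by
  ext x
  have h1 := congrFun (cv_eq_conv k g) x
  rw [convolution_mul] at h1
  rw [h1]
  simp only [cv, mul_comm]

variable {k k' g g' : Rd d → ℝ}

theorem cv_integrable (hk : Integrable k) (hg : Integrable g) : Integrable (cv k g) := by
  rw [cv_eq_conv]; exact hk.integrable_convolution _ hg

theorem cv_integrand (hk : Integrable k) (hg : Nice g) (x : Rd d) :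
    Integrable (fun y => k (x - y) * g y) := by
  obtain ⟨M, hM⟩ := hg.bdd
  exact (hk.comp_sub_left x).mul_bdd hg.int.aestronglyMeasurable (.of_forall hM)

theorem abs_cv_le (k g : Rd d → ℝ) (x : Rd d) :
    |cv k g x| ≤ cv (fun y => |k y|) (fun y => |g y|) x := by
  refine (abs_integral_le_integral_abs).trans (le_of_eq ?_)
  simp [cv, abs_mul]

theorem cv_mono (hk : Integrable k') (hg : Nice g') (h0 : ∀ x, 0 ≤ k x) (h0' : ∀ x, 0 ≤ g x)
    (hkk : ∀ x, k x ≤ k' x) (hgg : ∀ x, g x ≤ g' x) (x : Rd d) : cv k g x ≤ cv k' g' x :=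
  integral_mono_of_nonneg (.of_forall fun y => mul_nonneg (h0 _) (h0' _)) (cv_integrand hk hg x)
    (.of_forall fun y => mul_le_mul (hkk _) (hgg _) (h0' _) ((h0 _).trans (hkk _)))

theorem cv_nonneg (h0 : ∀ x, 0 ≤ k x) (h0' : ∀ x, 0 ≤ g x) (x : Rd d) : 0 ≤ cv k g x :=
  integral_nonneg fun y => mul_nonneg (h0 _) (h0' _)

theorem integral_cv (hk : Integrable k) (hg : Integrable g) :
    ∫ x, cv k g x = (∫ x, k x) * ∫ x, g x := by
  rw [cv_eq_conv, integral_convolution _ hk hg]; rfl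

theorem integral_abs_cv_le (hk : Integrable k) (hg : Integrable g) :
    ∫ x, |cv k g x| ≤ (∫ x, |k x|) * ∫ x, |g x| := by
  rw [← integral_cv hk.abs hg.abs]
  exact integral_mono (cv_integrable hk hg).abs (cv_integrable hk.abs hg.abs) (abs_cv_le k g)

theorem abs_cv_le_bound (hk : Integrable k) {M : ℝ} (hM : ∀ x, |g x| ≤ M) (x : Rd d) :
    |cv k g x| ≤ (∫ x, |k x|) * M := by
  have : ∫ y, |k (x - y)| = ∫ y, |k y| := integral_sub_left_eq_self (fun y => |k y|) volume x
  rw [← this, ← integral_mul_const]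
  refine (abs_integral_le_integral_abs).trans (integral_mono_of_nonneg
    (.of_forall fun y => abs_nonneg _) ((hk.abs.comp_sub_left x).mul_const M)
    (.of_forall fun y => ?_))
  simp only [abs_mul]
  exact mul_le_mul_of_nonneg_left (hM y) (abs_nonneg _)

theorem cv_nice (hk : Integrable k) (hg : Nice g) : Nice (cv k g) := by
  obtain ⟨M, hM⟩ := hg.bdd
  exact ⟨cv_integrable hk hg.int, _, abs_cv_le_bound hk hM⟩

theorem cv_add_left (hk : Integrable k) (hk' : Integrable k') (hg : Nice g) (x : Rd d) :
    cv (fun y => k y + k' y) g x = cv k g x + cv k' g x := by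
  simp only [cv, add_mul]
  exact integral_add (cv_integrand hk hg x) (cv_integrand hk' hg x)

theorem cv_sub_left (hk : Integrable k) (hk' : Integrable k') (hg : Nice g) (x : Rd d) :
    cv (fun y => k y - k' y) g x = cv k g x - cv k' g x := by
  simp only [cv, sub_mul]
  exact integral_sub (cv_integrand hk hg x) (cv_integrand hk' hg x)

theorem cv_add_right (hk : Integrable k) (hg : Nice g) (hg' : Nice g') (x : Rd d) :
    cv k (fun y => g y + g' y) x = cv k g x + cv k g' x := by
  simp only [cv, mul_add]
  exact integral_add (cv_integrand hk hg x) (cv_integrand hk hg' x)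

theorem cv_sum_left {ι : Type*} {s : Finset ι} {F : ι → Rd d → ℝ}
    (h : ∀ i ∈ s, Integrable (F i)) (hg : Nice g) (x : Rd d) :
    cv (fun y => ∑ i ∈ s, F i y) g x = ∑ i ∈ s, cv (F i) g x := by
  simp only [cv, Finset.sum_mul]
  exact integral_finsetSum s fun i hi => cv_integrand (h i hi) hg x

theorem cv_sum_right {ι : Type*} {s : Finset ι} {F : ι → Rd d → ℝ} (hk : Integrable k)
    (h : ∀ i ∈ s, Nice (F i)) (x : Rd d) :
    cv k (fun y => ∑ i ∈ s, F i y) x = ∑ i ∈ s, cv k (F i) x := by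
  simp only [cv, Finset.mul_sum]
  exact integral_finsetSum s fun i hi => cv_integrand hk (h i hi) x

theorem cv_const_mul_left (c : ℝ) (k g : Rd d → ℝ) (x : Rd d) :
    cv (fun y => c * k y) g x = c * cv k g x := by
  simp only [cv, mul_assoc]
  exact integral_const_mul _ _

theorem cv_assoc (hk : Integrable k) (hk' : Integrable k') (hg : Nice g) (x : Rd d) :
    cv (cv k k') g x = cv k (cv k' g) x := by
  have hex : ∀ {a b : Rd d → ℝ} (_ : Integrable a) (_ : Nice b) (y : Rd d),
      ConvolutionExistsAt a b y (ContinuousLinearMap.mul ℝ ℝ) volume := by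
    intro a b ha hb y
    obtain ⟨M, hM⟩ := hb.bdd
    exact ha.mul_bdd (hb.int.comp_sub_left y).aestronglyMeasurable
      (.of_forall fun z => hM _)
  simp only [cv_eq_conv]
  refine convolution_assoc _ _ _ _ (fun a b c => by simp [mul_assoc]) hk.aestronglyMeasurable
    hk'.aestronglyMeasurable hg.int.aestronglyMeasurable ?_ ?_ ?_
  · exact (hk.ae_convolution_exists (ContinuousLinearMap.mul ℝ ℝ) hk')
  · exact .of_forall fun y => hex hk'.norm (hg.abs) y
  · have := hex hk.norm (cv_nice hk'.norm hg.abs) x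
    rwa [cv_eq_conv] at this

/-- Fourier transform of a real function. -/
def ft (g : Rd d → ℝ) : Rd d → ℂ := 𝓕 (fun x => (g x : ℂ))

theorem ft_eq (g : Rd d → ℝ) (ξ : Rd d) :
    ft g ξ = ∫ x, Complex.exp ((-2 * Real.pi * inner ℝ x ξ : ℝ) * Complex.I) * (g x : ℂ) := by
  rw [ft, Real.fourier_eq']
  simp

theorem ft_cv (hk : Integrable k) (hg : Integrable g) (ξ : Rd d) :
    ft (cv k g) ξ = ft k ξ * ft g ξ := by
  refine Eq.trans ?_ (Real.fourier_mul_convolution_eq (hk.ofReal (𝕜 := ℂ))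
    (hg.ofReal (𝕜 := ℂ)) ξ)
  have : (fun x => ((cv k g x : ℝ) : ℂ)) =
      (fun x => (k x : ℂ)) ⋆[ContinuousLinearMap.mul ℂ ℂ] (fun x => (g x : ℂ)) := by
    ext x
    rw [convolution_mul_swap, cv, ← integral_complex_ofReal]
    simp
  rw [ft, this]
  rfl

theorem ft_continuous (hg : Integrable g) : Continuous (ft g) :=
  VectorFourier.fourierIntegral_continuous Real.continuous_fourierChar
    (by exact continuous_inner) hg.ofReal

theorem norm_ft_le (g : Rd d → ℝ) (ξ : Rd d) : ‖ft g ξ‖ ≤ ∫ x, |g x| := by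
  refine (VectorFourier.norm_fourierIntegral_le_integral_norm _ _ _ _ _).trans (le_of_eq ?_)
  simp

theorem ft_add (hf : Integrable g) (hg : Integrable g') (ξ : Rd d) :
    ft (fun x => g x + g' x) ξ = ft g ξ + ft g' ξ := by
  simp only [ft_eq, Complex.ofReal_add, mul_add]
  refine integral_add ?_ ?_ <;>
  · refine Integrable.bdd_mul (c := 1) (Integrable.ofReal (by assumption)) (by fun_prop)
      (.of_forall fun x => (Complex.norm_exp_ofReal_mul_I _).le)

theorem ft_const_mul (c : ℝ) (g : Rd d → ℝ) (ξ : Rd d) :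
    ft (fun x => c * g x) ξ = c * ft g ξ := by
  simp only [ft_eq, ← integral_const_mul]
  congr 1; ext x; push_cast; ring

theorem ft_sub (hf : Integrable g) (hg : Integrable g') (ξ : Rd d) :
    ft (fun x => g x - g' x) ξ = ft g ξ - ft g' ξ := by
  have := ft_add hf (hg.const_mul (-1)) ξ
  simp only [ft_const_mul] at this
  simpa [sub_eq_add_neg] using this

theorem ft_sum {ι : Type*} {s : Finset ι} {F : ι → Rd d → ℝ} (h : ∀ i ∈ s, Integrable (F i))
    (ξ : Rd d) : ft (fun x => ∑ i ∈ s, F i x) ξ = ∑ i ∈ s, ft (F i) ξ := by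
  classical
  induction s using Finset.induction_on with
  | empty => simp [ft_eq]
  | insert a s ha ih =>
    simp only [Finset.sum_insert ha]
    rw [ft_add (h a (by simp)) (integrable_finsetSum _ fun i hi => h i (by simp [hi])),
      ih fun i hi => h i (by simp [hi])]

theorem plancherel (hg : Nice g) :
    Integrable (fun ξ => ‖ft g ξ‖ ^ 2) ∧ ∫ ξ, ‖ft g ξ‖ ^ 2 = ∫ x, g x ^ 2 := by
  have hG : MemLp (fun x => (g x : ℂ)) 2 := hg.memLp_two.ofReal
  set G : Lp ℂ 2 (volume : Measure (Rd d)) := hG.toLp _ with hGdef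
  have hae : ∀ᵐ ξ, (𝓕 G : Lp ℂ 2 (volume : Measure (Rd d))) ξ = ft g ξ := by
    refine ae_eq_of_integral_contDiff_smul_eq
      ((Lp.memLp (𝓕 G)).locallyIntegrable (by norm_num))
      (ft_continuous hg.int).locallyIntegrable ?_
    intro u hu hcu
    have hu' : ContDiff ℝ (↑(⊤ : ℕ∞)) (fun x => (u x : ℂ)) := Complex.ofRealCLM.contDiff.comp hu
    have hcu' : HasCompactSupport (fun x => (u x : ℂ)) := hcu.comp_left (g := fun t : ℝ => (t : ℂ)) Complex.ofReal_zero
    set U : 𝓢(Rd d, ℂ) := hcu'.toSchwartzMap hu' with hU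
    have hUu : ∀ x, U x = (u x : ℂ) := fun x => rfl
    have h1 : (𝓕 (G : 𝓢'(Rd d, ℂ))) U = ((𝓕 G : Lp ℂ 2 (volume : Measure (Rd d))) : 𝓢'(Rd d, ℂ)) U := by
      rw [Lp.fourier_toTemperedDistribution_eq]
    rw [TemperedDistribution.fourier_apply, Lp.toTemperedDistribution_apply,
      Lp.toTemperedDistribution_apply] at h1
    have h2 := VectorFourier.integral_fourierIntegral_smul_eq_flip (L := innerₗ (Rd d))
      (μ := volume) (ν := volume)
      Real.continuous_fourierChar continuous_inner U.integrable (hg.int.ofReal (𝕜 := ℂ))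
    have h3 : ∫ x, (𝓕 U) x • G x = ∫ x, (𝓕 U) x • (g x : ℂ) := by
      refine integral_congr_ae ?_
      filter_upwards [hG.coeFn_toLp] with x hx
      rw [hGdef, hx]
    calc ∫ x, u x • (𝓕 G : Lp ℂ 2 (volume : Measure (Rd d))) x
        = ∫ x, U x • (𝓕 G : Lp ℂ 2 (volume : Measure (Rd d))) x := by
          simp [hUu]
      _ = ∫ x, U x • ft g x := by
          rw [← h1, h3]
          simpa [flip_innerₗ] using! h2
      _ = _ := by simp [hUu]
  have hn : ‖(𝓕 G : Lp ℂ 2 (volume : Measure (Rd d)))‖ = ‖G‖ := Lp.norm_fourier_eq G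
  have hI : Integrable (fun ξ => ‖ft g ξ‖ ^ 2) := by
    have := (memLp_two_iff_integrable_sq_norm (Lp.aestronglyMeasurable (𝓕 G))).1 (Lp.memLp (𝓕 G))
    refine this.congr ?_
    filter_upwards [hae] with ξ h
    rw [h]
  refine ⟨hI, ?_⟩
  have hL : ∀ F : Lp ℂ 2 (volume : Measure (Rd d)), ‖F‖ ^ 2 = ∫ x, ‖F x‖ ^ 2 := by
    intro F
    have := L2.inner_def (𝕜 := ℂ) F F
    rw [inner_self_eq_norm_sq_to_K] at this
    simp only [inner_self_eq_norm_sq_to_K] at this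
    have h := congrArg Complex.re this
    norm_cast at h
  have h4 := congrArg (· ^ 2) hn
  simp only [hL] at h4
  calc ∫ ξ, ‖ft g ξ‖ ^ 2 = ∫ x, ‖(𝓕 G : Lp ℂ 2 (volume : Measure (Rd d))) x‖ ^ 2 := by
        refine integral_congr_ae ?_
        filter_upwards [hae] with ξ h
        rw [h]
    _ = ∫ x, ‖G x‖ ^ 2 := h4
    _ = _ := by
        refine integral_congr_ae ?_
        filter_upwards [hG.coeFn_toLp] with x hx
        rw [hGdef, hx]
        simp

end ConvolutionFourier

section Polar

open Module

variable {d : ℕ}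

theorem finrank_Rd (d : ℕ) : finrank ℝ (Rd d) = d := by simp

theorem nontrivial_Rd (hd : 2 ≤ d) : Nontrivial (Rd d) :=
  Module.nontrivial_of_finrank_pos (R := ℝ) (by rw [finrank_Rd]; omega)

theorem polar_lintegral (hd : 2 ≤ d) {F : Rd d → ℝ≥0∞} (hF : Measurable F) :
    ∫⁻ x, F x = ∫⁻ θ : sphere (0 : Rd d) 1, ∫⁻ r in Ioi (0 : ℝ),
      ENNReal.ofReal (r ^ (d - 1)) * F (r • (θ : Rd d)) ∂volume ∂(sphereMeasure d) := by
  have := nontrivial_Rd hd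
  have h1 : ∫⁻ x, F x = ∫⁻ x : ({0}ᶜ : Set (Rd d)), F (x : Rd d) ∂(Measure.comap Subtype.val volume) := by
    rw [lintegral_subtype_comap (measurableSet_singleton _).compl, restrict_compl_singleton]
  have h2 := ((volume : Measure (Rd d)).measurePreserving_homeomorphUnitSphereProd)
  have hm : Measurable (fun p : sphere (0 : Rd d) 1 × Ioi (0 : ℝ) => F (p.2.1 • (p.1 : Rd d))) := by
    fun_prop
  have h3 := h2.lintegral_comp hm
  have h4 : ∀ x : ({0}ᶜ : Set (Rd d)),
      F (((homeomorphUnitSphereProd (Rd d) x).2 : ℝ) • ((homeomorphUnitSphereProd (Rd d) x).1 : Rd d))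
        = F x := by
    intro x
    congr 1
    have := (homeomorphUnitSphereProd (Rd d)).symm_apply_apply x
    exact congrArg Subtype.val this
  rw [h1, ← lintegral_congr h4, h3, lintegral_prod _ hm.aemeasurable]
  refine lintegral_congr fun θ => ?_
  rw [Measure.volumeIoiPow, lintegral_withDensity_eq_lintegral_mul _ (by fun_prop) (by fun_prop),
    ← lintegral_subtype_comap measurableSet_Ioi, finrank_Rd]
  rfl

theorem polar_integral (hd : 2 ≤ d) {F : Rd d → ℂ} (hF : Integrable F) :
    ∫ x, F x = ∫ θ : sphere (0 : Rd d) 1, ∫ r in Ioi (0 : ℝ),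
      ((r ^ (d - 1) : ℝ) : ℂ) * F (r • (θ : Rd d)) ∂volume ∂(sphereMeasure d) := by
  have := nontrivial_Rd hd
  have h1 : ∫ x, F x = ∫ x : ({0}ᶜ : Set (Rd d)), F (x : Rd d)
      ∂(Measure.comap Subtype.val volume) := by
    rw [integral_subtype_comap (measurableSet_singleton _).compl, restrict_compl_singleton]
  have h2 := ((volume : Measure (Rd d)).measurePreserving_homeomorphUnitSphereProd)
  have h3 := h2.integral_comp (Homeomorph.measurableEmbedding _)
    (fun p : sphere (0 : Rd d) 1 × Ioi (0 : ℝ) => F (p.2.1 • (p.1 : Rd d)))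
  have h4 : ∀ x : ({0}ᶜ : Set (Rd d)),
      F (((homeomorphUnitSphereProd (Rd d) x).2 : ℝ) • ((homeomorphUnitSphereProd (Rd d) x).1 : Rd d))
        = F x := by
    intro x
    congr 1
    have := (homeomorphUnitSphereProd (Rd d)).symm_apply_apply x
    exact congrArg Subtype.val this
  have h5 : Integrable (fun p : sphere (0 : Rd d) 1 × Ioi (0 : ℝ) => F (p.2.1 • (p.1 : Rd d)))
      ((volume : Measure (Rd d)).toSphere.prod (.volumeIoiPow (finrank ℝ (Rd d) - 1))) := by
    rw [← h2.integrable_comp_emb (Homeomorph.measurableEmbedding _)]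
    have : Integrable (fun x : ({0}ᶜ : Set (Rd d)) => F x) (Measure.comap Subtype.val volume) := by
      have h6 := (MeasurableEmbedding.subtype_coe
        (measurableSet_singleton (0 : Rd d)).compl).integrableOn_range_iff_comap
          (μ := volume) (f := F)
      exact h6.1 hF.integrableOn
    exact this.congr (.of_forall fun x => (h4 x).symm)
  rw [h1, ← integral_congr_ae (.of_forall h4), h3, integral_prod _ h5]
  refine integral_congr_ae (.of_forall fun θ => ?_)
  simp only [Measure.volumeIoiPow, ENNReal.ofReal]
  rw [integral_withDensity_eq_integral_smul (by fun_prop)]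
  simp only [finrank_Rd]
  rw [integral_subtype_comap measurableSet_Ioi
    fun a : ℝ => Real.toNNReal (a ^ (d - 1)) • F (a • (θ : Rd d)),
    setIntegral_congr_fun measurableSet_Ioi fun x hx => ?_]
  rw [NNReal.smul_def, Real.coe_toNNReal _ (pow_nonneg (le_of_lt hx) _), Complex.real_smul]

end Polar

section Kernel

open FourierTransform SchwartzMap

/-- A smooth cutoff, equal to `1` on `(-∞, 1]` and to `0` on `[2, ∞)`. -/
def eta (r : ℝ) : ℝ := Real.smoothTransition (2 - r)

theorem eta_of_le {r : ℝ} (h : r ≤ 1) : eta r = 1 := Real.smoothTransition.one_of_one_le (by linarith)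

theorem eta_of_ge {r : ℝ} (h : 2 ≤ r) : eta r = 0 := Real.smoothTransition.zero_of_nonpos (by linarith)

theorem eta_nonneg (r : ℝ) : 0 ≤ eta r := Real.smoothTransition.nonneg _

theorem eta_le_one (r : ℝ) : eta r ≤ 1 := Real.smoothTransition.le_one _

theorem eta_contDiff {n : ℕ∞} : ContDiff ℝ n eta :=
  Real.smoothTransition.contDiff.comp (by fun_prop)

/-- Smooth bump supported in `[1/2, 2]`. -/
def bet (r : ℝ) : ℝ := eta r - eta (2 * r)

theorem bet_nonneg (r : ℝ) : 0 ≤ bet r := by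
  rcases le_total r 1 with h | h
  · rw [bet, eta_of_le h]; linarith [eta_le_one (2 * r)]
  · rw [bet, eta_of_ge (r := 2 * r) (by linarith)]; linarith [eta_nonneg r]

theorem bet_le_one (r : ℝ) : bet r ≤ 1 := by
  have := eta_le_one r; have := eta_nonneg (2 * r); rw [bet]; linarith

theorem bet_of_le {r : ℝ} (h : r ≤ 1 / 2) : bet r = 0 := by
  rw [bet, eta_of_le (by linarith), eta_of_le (by linarith), sub_self]

theorem bet_of_ge {r : ℝ} (h : 2 ≤ r) : bet r = 0 := by
  rw [bet, eta_of_ge (by linarith), eta_of_ge (by linarith), sub_self]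

theorem bet_contDiff {n : ℕ∞} : ContDiff ℝ n bet :=
  eta_contDiff.sub (eta_contDiff.comp (by fun_prop))

theorem sum_bet (r : ℝ) {k K : ℤ} (h : k ≤ K) :
    ∑ j ∈ Finset.Ioc k K, bet (r / 2 ^ j) = eta (r / 2 ^ K) - eta (r / 2 ^ k) := by
  induction K, h using Int.leInduction with
  | base => simp
  | succ K hK ih =>
    have : Finset.Ioc k (K + 1) = insert (K + 1) (Finset.Ioc k K) := by
      ext j; simp; omega
    rw [this, Finset.sum_insert (by simp), ih, bet]
    have : 2 * (r / 2 ^ (K + 1)) = r / (2 : ℝ) ^ K := by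
      rw [zpow_add₀ (by norm_num)]; field_simp
    rw [this]; ring

/-- The radial profile `β(r)/r`. -/
def hprof (r : ℝ) : ℝ := bet r / r

theorem hprof_contDiff : ContDiff ℝ (⊤ : ℕ∞) hprof := by
  rw [contDiff_iff_contDiffAt]
  intro r
  by_cases hr : r = 0
  · have : hprof =ᶠ[nhds r] fun _ => 0 := by
      rw [hr]
      filter_upwards [Iio_mem_nhds (show (0 : ℝ) < 1 / 2 by norm_num)] with s hs
      rw [hprof, bet_of_le (le_of_lt hs), zero_div]
    exact contDiffAt_const.congr_of_eventuallyEq this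
  · exact bet_contDiff.contDiffAt.div contDiffAt_id hr

theorem hprof_hasCompactSupport : HasCompactSupport hprof := by
  refine HasCompactSupport.intro (K := Icc 0 2) isCompact_Icc fun r hr => ?_
  rw [mem_Icc, not_and_or, not_le, not_le] at hr
  rcases hr with h | h
  · rw [hprof, bet_of_le (by linarith), zero_div]
  · rw [hprof, bet_of_ge h.le, zero_div]

/-- The Fourier transform of the radial profile. -/
def hhat (u : ℝ) : ℂ := 𝓕 (fun r : ℝ => (hprof r : ℂ)) u

theorem hhat_decay (N : ℕ) : ∃ C : ℝ, 0 < C ∧ ∀ u, ‖hhat u‖ ≤ C / (1 + |u|) ^ N := by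
  have hu' : ContDiff ℝ (↑(⊤ : ℕ∞)) (fun x => (hprof x : ℂ)) :=
    Complex.ofRealCLM.contDiff.comp hprof_contDiff
  have hcu' : HasCompactSupport (fun x => (hprof x : ℂ)) :=
    hprof_hasCompactSupport.comp_left (g := fun t : ℝ => (t : ℂ)) Complex.ofReal_zero
  set U : 𝓢(ℝ, ℂ) := 𝓕 (hcu'.toSchwartzMap hu') with hU
  have hUu : ∀ x, U x = hhat x := fun x => rfl
  refine ⟨2 ^ N * ((Finset.Iic (N, 0)).sup fun m => SchwartzMap.seminorm ℝ m.1 m.2) U + 1, ?_,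
    fun u => ?_⟩
  · have := apply_nonneg ((Finset.Iic (N, 0)).sup fun m => SchwartzMap.seminorm ℝ (E := ℝ) (F := ℂ) m.1 m.2) U
    positivity
  · have := SchwartzMap.one_add_le_sup_seminorm_apply (𝕜 := ℝ) (m := (N, 0)) (k := N) (n := 0)
      le_rfl le_rfl U u
    rw [le_div_iff₀ (by positivity), mul_comm]
    simp only [norm_iteratedFDeriv_zero, hUu, Real.norm_eq_abs] at this
    linarith

theorem hhat_eq (u : ℝ) :
    hhat u = ∫ r, Complex.exp ((-2 * Real.pi * (r * u) : ℝ) * Complex.I) * (hprof r : ℂ) := by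
  rw [hhat, Real.fourier_eq']
  simp [mul_comm]

variable {d : ℕ} {Ω : Rd d → ℝ}

/-- The dyadic piece of the rough kernel at scale `2 ^ j`. -/
def KK (Ω : Rd d → ℝ) (j : ℤ) (x : Rd d) : ℝ := Ω x * (‖x‖ ^ d)⁻¹ * bet (‖x‖ / 2 ^ j)

theorem KK_measurable (hΩ : Measurable Ω) (j : ℤ) : Measurable (KK Ω j) := by
  have : Measurable bet := (bet_contDiff (n := 0)).continuous.measurable
  unfold KK
  fun_prop

theorem KK_eq_zero_of_le {j : ℤ} {x : Rd d} (h : ‖x‖ ≤ 2 ^ j / 2) : KK Ω j x = 0 := by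
  rw [KK, bet_of_le, mul_zero]
  have : (0 : ℝ) < 2 ^ j := by positivity
  rw [div_le_iff₀ this]; linarith

theorem KK_eq_zero_of_ge {j : ℤ} {x : Rd d} (h : 2 * 2 ^ j ≤ ‖x‖) : KK Ω j x = 0 := by
  rw [KK, bet_of_ge, mul_zero]
  have : (0 : ℝ) < 2 ^ j := by positivity
  rw [le_div_iff₀ this]; linarith

theorem abs_KK_le (j : ℤ) (x : Rd d) : |KK Ω j x| ≤ |Ω x| * (2 ^ d * (((2 : ℝ) ^ j) ^ d)⁻¹) := by
  have h2 : (0 : ℝ) < 2 ^ j := by positivity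
  rcases le_or_gt ‖x‖ (2 ^ j / 2) with h | h
  · rw [KK_eq_zero_of_le h, abs_zero]; positivity
  · rw [KK, abs_mul, abs_mul, mul_assoc]
    refine mul_le_mul_of_nonneg_left ?_ (abs_nonneg _)
    rw [abs_of_nonneg (bet_nonneg _), abs_of_nonneg (by positivity)]
    calc (‖x‖ ^ d)⁻¹ * bet (‖x‖ / 2 ^ j) ≤ ((2 ^ j / 2) ^ d)⁻¹ * 1 := by
          gcongr
          · exact bet_nonneg _
          · exact bet_le_one _
      _ = _ := by rw [div_pow]; field_simp

theorem KK_add {Ω' : Rd d → ℝ} (j : ℤ) (x : Rd d) :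
    KK (fun y => Ω y + Ω' y) j x = KK Ω j x + KK Ω' j x := by
  simp only [KK]; ring

theorem KK_const_mul (c : ℝ) (j : ℤ) (x : Rd d) :
    KK (fun y => c * Ω y) j x = c * KK Ω j x := by
  simp only [KK]; ring

theorem hom_sphere (hom : Homogeneous0 d Ω) (θ : sphere (0 : Rd d) 1) {r : ℝ} (hr : 0 < r) :
    Ω (r • (θ : Rd d)) = Ω θ :=
  hom _ (ne_of_mem_sphere θ.2 one_ne_zero) r hr

theorem norm_smul_sphere (θ : sphere (0 : Rd d) 1) {r : ℝ} (hr : 0 < r) :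
    ‖r • (θ : Rd d)‖ = r := by
  rw [norm_smul, norm_eq_of_mem_sphere, mul_one, Real.norm_of_nonneg hr.le]

theorem pow_mul_KK (hd : 2 ≤ d) (hom : Homogeneous0 d Ω) (j : ℤ) (θ : sphere (0 : Rd d) 1)
    {r : ℝ} (hr : 0 < r) :
    r ^ (d - 1) * KK Ω j (r • (θ : Rd d)) = Ω θ * ((2 ^ j)⁻¹ * hprof ((2 ^ j)⁻¹ * r)) := by
  rw [KK, hom_sphere hom θ hr, norm_smul_sphere θ hr, hprof]
  obtain ⟨m, rfl⟩ : ∃ m, d = m + 1 := ⟨d - 1, by omega⟩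
  have : (2 : ℝ) ^ j ≠ 0 := by positivity
  have h : (2 ^ j : ℝ)⁻¹ * r = r / 2 ^ j := by field_simp
  rw [h, Nat.add_sub_cancel]
  field_simp
  ring

theorem KK_lintegral (hd : 2 ≤ d) (hΩ : Measurable Ω) (hom : Homogeneous0 d Ω) (j : ℤ) :
    ∫⁻ x, ‖KK Ω j x‖ₑ ≤ 3 * ∫⁻ θ : sphere (0 : Rd d) 1, ‖Ω θ‖ₑ ∂(sphereMeasure d) := by
  rw [polar_lintegral hd (by have := KK_measurable hΩ j; fun_prop), ← lintegral_const_mul _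
    (by fun_prop)]
  refine lintegral_mono fun θ => ?_
  have h2 : (0 : ℝ) < 2 ^ j := by positivity
  calc ∫⁻ r in Ioi (0 : ℝ), ENNReal.ofReal (r ^ (d - 1)) * ‖KK Ω j (r • (θ : Rd d))‖ₑ
      ≤ ∫⁻ r in Ioi (0 : ℝ), (Icc (2 ^ j / 2) (2 * 2 ^ j)).indicator
          (fun _ => ENNReal.ofReal (|Ω θ| * (2 / 2 ^ j))) r := by
        refine setLIntegral_mono' measurableSet_Ioi fun r hr => ?_
        have hr : 0 < r := hr
        by_cases hI : r ∈ Icc ((2 : ℝ) ^ j / 2) (2 * 2 ^ j)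
        · rw [indicator_of_mem hI, ← ofReal_norm, ← ENNReal.ofReal_mul (by positivity)]
          apply ENNReal.ofReal_le_ofReal
          have h3 := pow_mul_KK hd hom j θ hr
          have h4 : r ^ (d - 1) * ‖KK Ω j (r • (θ : Rd d))‖ =
              |r ^ (d - 1) * KK Ω j (r • (θ : Rd d))| := by
            rw [abs_mul, abs_of_nonneg (a := r ^ (d - 1)) (by positivity), Real.norm_eq_abs]
          rw [h4, h3, abs_mul]
          refine mul_le_mul_of_nonneg_left ?_ (abs_nonneg _)
          rw [hprof, abs_of_nonneg (by have := bet_nonneg ((2 ^ j)⁻¹ * r); positivity)]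
          calc (2 ^ j : ℝ)⁻¹ * (bet ((2 ^ j)⁻¹ * r) / ((2 ^ j)⁻¹ * r))
              = bet ((2 ^ j)⁻¹ * r) / r := by field_simp
            _ ≤ 1 / (2 ^ j / 2) := by
              gcongr
              · exact bet_le_one _
              · exact hI.1
            _ = _ := by field_simp
        · rw [indicator_of_notMem hI]
          rw [mem_Icc, not_and_or, not_le, not_le] at hI
          rcases hI with h | h
          · rw [KK_eq_zero_of_le (by rw [norm_smul_sphere θ hr]; exact h.le)]; simp
          · rw [KK_eq_zero_of_ge (by rw [norm_smul_sphere θ hr]; exact h.le)]; simp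
    _ ≤ ∫⁻ r, (Icc ((2 : ℝ) ^ j / 2) (2 * 2 ^ j)).indicator
          (fun _ => ENNReal.ofReal (|Ω θ| * (2 / 2 ^ j))) r := setLIntegral_le_lintegral _ _
    _ = 3 * ‖Ω θ‖ₑ := by
        rw [lintegral_indicator_const measurableSet_Icc, Real.volume_Icc,
          ← ENNReal.ofReal_mul (by positivity), ← ofReal_norm, Real.norm_eq_abs]
        rw [show (3 : ℝ≥0∞) = ENNReal.ofReal 3 by simp, ← ENNReal.ofReal_mul (by norm_num)]
        congr 1
        field_simp; ring

theorem KK_integrable (hd : 2 ≤ d) (hΩ : Measurable Ω) (hom : Homogeneous0 d Ω)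
    (hi : Integrable (fun θ : sphere (0 : Rd d) 1 => Ω θ) (sphereMeasure d)) (j : ℤ) :
    Integrable (KK Ω j) := by
  refine ⟨(KK_measurable hΩ j).aestronglyMeasurable, ?_⟩
  refine (KK_lintegral hd hΩ hom j).trans_lt (ENNReal.mul_lt_top (by simp) hi.2)

theorem KK_integral_abs (hd : 2 ≤ d) (hΩ : Measurable Ω) (hom : Homogeneous0 d Ω)
    (hi : Integrable (fun θ : sphere (0 : Rd d) 1 => Ω θ) (sphereMeasure d)) (j : ℤ) :
    ∫ x, |KK Ω j x| ≤ 3 * sphInt d (fun x => |Ω x|) := by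
  have h1 := integral_norm_eq_lintegral_enorm (KK_integrable hd hΩ hom hi j).aestronglyMeasurable
  have h2 := integral_norm_eq_lintegral_enorm hi.aestronglyMeasurable
  simp only [Real.norm_eq_abs] at h1 h2
  rw [h1, sphInt, h2]
  have h3 := ENNReal.toReal_mono (ENNReal.mul_lt_top (by simp) hi.2).ne (KK_lintegral hd hΩ hom j)
  simpa using h3

theorem ft_KK (hd : 2 ≤ d) (hΩ : Measurable Ω) (hom : Homogeneous0 d Ω)
    (hi : Integrable (fun θ : sphere (0 : Rd d) 1 => Ω θ) (sphereMeasure d)) (j : ℤ) (ξ : Rd d) :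
    ft (KK Ω j) ξ = ∫ θ : sphere (0 : Rd d) 1, (Ω θ : ℂ) * hhat (2 ^ j * inner ℝ (θ : Rd d) ξ)
      ∂(sphereMeasure d) := by
  have h2 : (0 : ℝ) < 2 ^ j := by positivity
  rw [ft_eq, polar_integral hd]
  swap
  · refine Integrable.bdd_mul (c := 1) ((KK_integrable hd hΩ hom hi j).ofReal) (by fun_prop)
      (.of_forall fun x => (Complex.norm_exp_ofReal_mul_I _).le)
  refine integral_congr_ae (.of_forall fun θ => ?_)
  simp only
  rw [hhat_eq]
  set I := fun r : ℝ => Complex.exp ((-2 * Real.pi * (r * (2 ^ j * inner ℝ (θ : Rd d) ξ)) : ℝ) *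
    Complex.I) * (hprof r : ℂ) with hI
  have h5 := Measure.integral_comp_mul_left I ((2 ^ j : ℝ)⁻¹)
  rw [inv_inv, abs_of_pos h2] at h5
  have h6 : ∫ r, I ((2 ^ j : ℝ)⁻¹ * r) = ∫ r in Ioi (0 : ℝ), I ((2 ^ j : ℝ)⁻¹ * r) := by
    symm
    apply setIntegral_eq_integral_of_forall_compl_eq_zero
    intro r hr
    have : (2 ^ j : ℝ)⁻¹ * r ≤ 0 := mul_nonpos_of_nonneg_of_nonpos (by positivity) (not_lt.1 hr)
    simp [hI, hprof, bet_of_le (show (2 ^ j : ℝ)⁻¹ * r ≤ 1 / 2 by linarith)]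
  have h7 : ∫ r, I r = ((2 ^ j : ℝ)⁻¹ : ℂ) * ∫ r in Ioi (0 : ℝ), I ((2 ^ j : ℝ)⁻¹ * r) := by
    rw [← h6, h5, Complex.real_smul, ← mul_assoc, inv_mul_cancel₀, one_mul]
    exact_mod_cast h2.ne'
  rw [h7, ← mul_assoc, ← integral_const_mul]
  refine setIntegral_congr_fun measurableSet_Ioi fun r hr => ?_
  have h8 := pow_mul_KK hd hom j θ hr
  have h9 : r * (inner ℝ (θ : Rd d) ξ) = (2 ^ j : ℝ)⁻¹ * r * (2 ^ j * inner ℝ (θ : Rd d) ξ) := by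
    field_simp
  simp only [hI, inner_smul_left, conj_trivial]
  rw [← h9, mul_left_comm, ← Complex.ofReal_mul, h8]
  push_cast
  ring

end Kernel

section Geometry

open Module
open scoped Pointwise

variable {d : ℕ}

instance : IsFiniteMeasure (sphereMeasure d) := by
  unfold sphereMeasure; infer_instance

theorem volume_box (b : OrthonormalBasis (Fin d) ℝ (Rd d)) (w : Fin d → ℝ) :
    volume {x : Rd d | ∀ i, |inner ℝ (b i) x| ≤ w i} = ∏ i, ENNReal.ofReal (2 * w i) := by
  have h1 : {x : Rd d | ∀ i, |inner ℝ (b i) x| ≤ w i} =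
      b.repr ⁻¹' ((WithLp.ofLp : Rd d → (Fin d → ℝ)) ⁻¹' (Icc (fun i => - w i) w)) := by
    ext x
    simp only [mem_ofPred_eq, mem_preimage, mem_Icc, Pi.le_def, b.repr_apply_apply, abs_le]
    exact forall_and
  rw [h1, b.measurePreserving_repr.measure_preimage
      ((PiLp.volume_preserving_ofLp (Fin d)).measurable measurableSet_Icc).nullMeasurableSet,
    (PiLp.volume_preserving_ofLp (Fin d)).measure_preimage measurableSet_Icc.nullMeasurableSet,
    Real.volume_Icc_pi]
  congr 1 with i
  rw [sub_neg_eq_add, two_mul]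

theorem exists_basis_extend (hd : 2 ≤ d) {e : Rd d} (he : ‖e‖ = 1) :
    ∃ b : OrthonormalBasis (Fin d) ℝ (Rd d), b ⟨0, by omega⟩ = e := by
  have i0 : Fin d := ⟨0, by omega⟩
  obtain ⟨b, hb⟩ := Orthonormal.exists_orthonormalBasis_extension_of_card_eq (𝕜 := ℝ)
    (E := Rd d) (ι := Fin d) (by simp) (v := fun _ => e) (s := {⟨0, by omega⟩}) (by
      constructor
      · intro i; simpa using he
      · intro i j hij
        exact absurd (Subsingleton.elim i j) hij)
  exact ⟨b, hb _ rfl⟩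

/-- The tube around the line spanned by `e`. -/
def tube (e : Rd d) (a ρ : ℝ) : Set (Rd d) :=
  {x | |inner ℝ e x| ≤ a ∧ ‖x - (inner ℝ e x : ℝ) • e‖ ≤ ρ}

theorem tube_measurable (e : Rd d) (a ρ : ℝ) : MeasurableSet (tube e a ρ) := by
  have : tube e a ρ = {x : Rd d | |inner ℝ e x| ≤ a} ∩
      {x : Rd d | ‖x - (inner ℝ e x : ℝ) • e‖ ≤ ρ} := rfl
  rw [this]
  refine MeasurableSet.inter ?_ ?_
  · exact measurableSet_le (by fun_prop) (by fun_prop)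
  · exact measurableSet_le (by fun_prop) (by fun_prop)

theorem volume_tube_le (hd : 2 ≤ d) {e : Rd d} (he : ‖e‖ = 1) {a ρ : ℝ} (ha : 0 ≤ a)
    (hρ : 0 ≤ ρ) : volume (tube e a ρ) ≤ ENNReal.ofReal ((2 * a) * (2 * ρ) ^ (d - 1)) := by
  obtain ⟨b, hb⟩ := exists_basis_extend hd he
  obtain ⟨m, rfl⟩ : ∃ m, d = m + 1 := ⟨d - 1, by omega⟩
  have hsub : tube e a ρ ⊆ {x : Rd (m + 1) | ∀ i, |inner ℝ (b i) x| ≤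
      (Fin.cons a (fun _ => ρ) : Fin (m + 1) → ℝ) i} := by
    rintro x ⟨h1, h2⟩ i
    have hb' : b 0 = e := hb
    refine Fin.cases ?_ (fun i => ?_) i
    · simpa [hb'] using h1
    · have h3 : inner ℝ (b i.succ) x = inner ℝ (b i.succ) (x - (inner ℝ e x : ℝ) • e) := by
        rw [inner_sub_right, inner_smul_right, ← hb', b.inner_eq_zero (Fin.succ_ne_zero i)]
        ring
      rw [h3, Fin.cons_succ]
      refine (abs_real_inner_le_norm _ _).trans ?_
      rw [b.norm_eq_one, one_mul]; exact h2
  refine (measure_mono hsub).trans ?_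
  rw [volume_box, Fin.prod_univ_succ]
  simp only [Fin.cons_zero, Fin.cons_succ, Finset.prod_const, Finset.card_univ, Fintype.card_fin,
    Nat.add_sub_cancel]
  rw [← ENNReal.ofReal_pow (by positivity), ← ENNReal.ofReal_mul (by positivity)]

theorem norm_sub_inner_smul_le {e : Rd d} (he : ‖e‖ = 1) (x : Rd d) (c : ℝ) :
    ‖x - (inner ℝ e x : ℝ) • e‖ ≤ ‖x - c • e‖ := by
  refine le_of_sq_le_sq ?_ (norm_nonneg _)
  rw [norm_sub_sq_real, norm_sub_sq_real, norm_smul, norm_smul, inner_smul_right, inner_smul_right,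
    he, real_inner_comm e x, mul_one, mul_one, Real.norm_eq_abs, Real.norm_eq_abs, sq_abs, sq_abs]
  nlinarith [sq_nonneg (c - inner ℝ e x)]

theorem sphere_measure_le {s : Set (sphere (0 : Rd d) 1)} (hs : MeasurableSet s) {T : Set (Rd d)}
    (h : ∀ θ ∈ s, ∀ r : ℝ, 0 < r → r < 1 → r • (θ : Rd d) ∈ T) :
    sphereMeasure d s ≤ d * volume T := by
  rw [sphereMeasure, Measure.toSphere_apply' _ hs, finrank_Rd]
  gcongr
  rintro x hx
  obtain ⟨r, hr, y, ⟨θ, hθ, rfl⟩, rfl⟩ := Set.mem_smul.1 hx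
  exact h θ hθ r hr.1 hr.2

theorem band_measure (hd : 2 ≤ d) {e : Rd d} (he : ‖e‖ = 1) {δ : ℝ} (hδ : 0 ≤ δ) :
    sphereMeasure d {θ | |inner ℝ e (θ : Rd d)| ≤ δ} ≤ ENNReal.ofReal (d * 2 ^ d * δ) := by
  refine (sphere_measure_le (T := tube e δ 1) (measurableSet_le (by fun_prop) (by fun_prop))
    ?_).trans ?_
  · intro θ hθ r hr hr1
    have h1 : ‖r • (θ : Rd d)‖ = r := norm_smul_sphere θ hr
    refine ⟨?_, ?_⟩
    · rw [inner_smul_right, abs_mul, abs_of_pos hr]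
      have : |inner ℝ e (θ : Rd d)| ≤ δ := hθ
      nlinarith [abs_nonneg (inner ℝ e (θ : Rd d))]
    · refine (norm_sub_inner_smul_le he _ 0).trans ?_
      rw [zero_smul, sub_zero, h1]; exact hr1.le
  · refine (mul_le_mul_right (volume_tube_le hd he hδ zero_le_one) _).trans ?_
    rw [← ENNReal.ofReal_natCast, ← ENNReal.ofReal_mul (by positivity)]
    refine ENNReal.ofReal_le_ofReal (le_of_eq ?_)
    obtain ⟨m, rfl⟩ : ∃ m, d = m + 1 := ⟨d - 1, by omega⟩
    simp only [Nat.add_sub_cancel]; ring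

theorem cap_measure (hd : 2 ≤ d) {e : Rd d} (he : ‖e‖ = 1) {ρ : ℝ} (hρ : 0 ≤ ρ) :
    sphereMeasure d {θ | ‖(θ : Rd d) - e‖ ≤ ρ} ≤ ENNReal.ofReal (d * 2 ^ d * ρ ^ (d - 1)) := by
  refine (sphere_measure_le (T := tube e 1 ρ) (measurableSet_le (by fun_prop) (by fun_prop))
    ?_).trans ?_
  · intro θ hθ r hr hr1
    have h1 : ‖r • (θ : Rd d)‖ = r := norm_smul_sphere θ hr
    refine ⟨?_, ?_⟩
    · refine (abs_real_inner_le_norm _ _).trans ?_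
      rw [he, h1]; linarith
    · refine (norm_sub_inner_smul_le he _ r).trans ?_
      rw [← smul_sub, norm_smul, Real.norm_of_nonneg hr.le]
      have : ‖(θ : Rd d) - e‖ ≤ ρ := hθ
      nlinarith [norm_nonneg ((θ : Rd d) - e)]
  · refine (mul_le_mul_right (volume_tube_le hd he zero_le_one hρ) _).trans ?_
    rw [← ENNReal.ofReal_natCast, ← ENNReal.ofReal_mul (by positivity)]
    refine ENNReal.ofReal_le_ofReal (le_of_eq ?_)
    obtain ⟨m, rfl⟩ : ∃ m, d = m + 1 := ⟨d - 1, by omega⟩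
    simp only [Nat.add_sub_cancel]; ring

theorem exists_unit (hd : 2 ≤ d) : ∃ e : Rd d, ‖e‖ = 1 := by
  have := nontrivial_Rd hd
  exact exists_norm_eq (Rd d) zero_le_one

theorem sphere_measure_univ_le (hd : 2 ≤ d) :
    sphereMeasure d univ ≤ ENNReal.ofReal (d * 2 ^ d) := by
  obtain ⟨e, he⟩ := exists_unit hd
  have := band_measure hd he (δ := 1) zero_le_one
  rw [mul_one] at this
  refine (measure_mono ?_).trans this
  intro θ _
  refine (abs_real_inner_le_norm _ _).trans ?_
  rw [he, norm_eq_of_mem_sphere, one_mul]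

theorem shell_volume (hd : 2 ≤ d) {e : Rd d} (he : ‖e‖ = 1) {δ ε : ℝ} (hδ : 0 ≤ δ) (hε : 0 ≤ ε)
    (hε1 : ε ≤ 1) :
    volume {x : Rd d | |‖x‖ - 1| ≤ ε ∧ |inner ℝ e x| ≤ δ * ‖x‖} ≤
      ENNReal.ofReal (d * 4 ^ d * δ * ε) := by
  have hm : MeasurableSet ({x : Rd d | |‖x‖ - 1| ≤ ε} ∩ {x : Rd d | |inner ℝ e x| ≤ δ * ‖x‖}) :=
    (measurableSet_le (by fun_prop) (by fun_prop)).inter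
      (measurableSet_le (by fun_prop) (by fun_prop))
  change MeasurableSet {x : Rd d | |‖x‖ - 1| ≤ ε ∧ |inner ℝ e x| ≤ δ * ‖x‖} at hm
  have hb : MeasurableSet {θ : sphere (0 : Rd d) 1| |inner ℝ e (θ : Rd d)| ≤ δ} :=
    measurableSet_le (by fun_prop) (by fun_prop)
  rw [← lintegral_indicator_one hm, polar_lintegral hd (measurable_one.indicator hm)]
  have key : ∀ θ : sphere (0 : Rd d) 1, (∫⁻ r in Ioi (0 : ℝ), ENNReal.ofReal (r ^ (d - 1)) *
      indicator {x : Rd d | |‖x‖ - 1| ≤ ε ∧ |inner ℝ e x| ≤ δ * ‖x‖} 1 (r • (θ : Rd d))) ≤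
      indicator {θ : sphere (0 : Rd d) 1| |inner ℝ e (θ : Rd d)| ≤ δ}
        (fun _ => ENNReal.ofReal (2 ^ (d - 1) * (2 * ε))) θ := by
    intro θ
    by_cases hθ : |inner ℝ e (θ : Rd d)| ≤ δ
    · rw [indicator_of_mem (by exact hθ)]
      calc _ ≤ ∫⁻ r in Ioi (0 : ℝ), indicator (Icc (1 - ε) (1 + ε))
              (fun _ => ENNReal.ofReal (2 ^ (d - 1))) r := by
            refine setLIntegral_mono' measurableSet_Ioi fun r hr => ?_
            have hr : 0 < r := hr
            by_cases h : r • (θ : Rd d) ∈ {x : Rd d | |‖x‖ - 1| ≤ ε ∧ |inner ℝ e x| ≤ δ * ‖x‖}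
            · have h1 := h.1
              rw [norm_smul_sphere θ hr, abs_le] at h1
              have h2 : r ∈ Icc (1 - ε) (1 + ε) := ⟨by linarith, by linarith⟩
              rw [indicator_of_mem h, indicator_of_mem h2, Pi.one_apply, mul_one]
              refine ENNReal.ofReal_le_ofReal ?_
              gcongr; linarith
            · rw [indicator_of_notMem h, mul_zero]; exact zero_le'
        _ ≤ ∫⁻ r, indicator (Icc (1 - ε) (1 + ε)) (fun _ => ENNReal.ofReal (2 ^ (d - 1))) r :=
            setLIntegral_le_lintegral _ _
        _ = _ := by
            rw [lintegral_indicator measurableSet_Icc, setLIntegral_const, Real.volume_Icc,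
              ← ENNReal.ofReal_mul (by positivity)]
            congr 2; ring
    · rw [indicator_of_notMem (by exact hθ), nonpos_iff_eq_zero]
      rw [lintegral_eq_zero_iff' ]
      · filter_upwards [self_mem_ae_restrict measurableSet_Ioi] with r hr
        have hr : 0 < r := hr
        rw [indicator_of_notMem, mul_zero]; rfl
        rintro ⟨_, h⟩
        rw [norm_smul_sphere θ hr, inner_smul_right, abs_mul, abs_of_pos hr, mul_comm] at h
        exact hθ (le_of_mul_le_mul_right h hr)
      · refine Measurable.aemeasurable ?_
        have := measurable_one (α := ℝ≥0∞).indicator hm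
        fun_prop
  refine (lintegral_mono key).trans ?_
  rw [lintegral_indicator hb, setLIntegral_const]
  refine (mul_le_mul_right (band_measure hd he hδ) _).trans ?_
  rw [← ENNReal.ofReal_mul (by positivity)]
  refine ENNReal.ofReal_le_ofReal (le_of_eq ?_)
  obtain ⟨m, rfl⟩ : ∃ m, d = m + 1 := ⟨d - 1, by omega⟩
  simp only [Nat.add_sub_cancel]
  have : (4 : ℝ) ^ (m + 1) = 2 ^ (m + 1) * 2 ^ (m + 1) := by rw [← mul_pow]; norm_num
  rw [this, pow_succ]; ring

end Geometry

section DyadicCubes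

variable {d : ℕ}

/-- Index of the dyadic cube of side `2^n` containing `x`. -/
def idx (n : ℤ) (x : Rd d) : Fin d → ℤ := fun i => ⌊x i / 2 ^ n⌋

def dcube (n : ℤ) (z : Fin d → ℤ) : Set (Rd d) := {x | idx n x = z}

theorem idx_measurable (n : ℤ) : Measurable (idx (d := d) n) := by
  refine measurable_pi_lambda _ fun i => Int.measurable_floor.comp ?_
  fun_prop

theorem dcube_measurable (n : ℤ) (z : Fin d → ℤ) : MeasurableSet (dcube n z) :=
  idx_measurable n (measurableSet_singleton z)

theorem mem_dcube {n : ℤ} {z : Fin d → ℤ} {x : Rd d} :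
    x ∈ dcube n z ↔ ∀ i, z i * 2 ^ n ≤ x i ∧ x i < (z i + 1) * 2 ^ n := by
  have h2 : (0 : ℝ) < 2 ^ n := by positivity
  rw [dcube, mem_ofPred_eq, funext_iff]
  refine forall_congr' fun i => ?_
  rw [idx, Int.floor_eq_iff, le_div_iff₀ h2, div_lt_iff₀ h2]

theorem volume_dcube (n : ℤ) (z : Fin d → ℤ) :
    volume (dcube n z) = ENNReal.ofReal (((2 : ℝ) ^ n) ^ d) := by
  have h1 : dcube n z = (WithLp.ofLp : Rd d → (Fin d → ℝ)) ⁻¹'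
      (Set.pi univ fun i => Ico (z i * (2 : ℝ) ^ n) ((z i + 1) * 2 ^ n)) := by
    ext x
    rw [mem_dcube]; simp
  rw [h1, (PiLp.volume_preserving_ofLp (Fin d)).measure_preimage
    (MeasurableSet.univ_pi fun i => measurableSet_Ico).nullMeasurableSet, Real.volume_pi_Ico]
  have : ∀ i, ((z i : ℝ) + 1) * 2 ^ n - z i * 2 ^ n = 2 ^ n := fun i => by ring
  simp only [this]
  rw [Finset.prod_const, Finset.card_univ, Fintype.card_fin, ENNReal.ofReal_pow (by positivity)]

theorem norm_le_sum_abs (x : Rd d) : ‖x‖ ≤ ∑ i, |x i| := by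
  rw [EuclideanSpace.norm_eq]
  refine Real.sqrt_le_iff.2 ⟨Finset.sum_nonneg fun _ _ => abs_nonneg _, ?_⟩
  simp only [Real.norm_eq_abs]
  exact Finset.sum_sq_le_sq_sum_of_nonneg fun _ _ => abs_nonneg _

theorem abs_apply_le_norm (x : Rd d) (i : Fin d) : |x i| ≤ ‖x‖ := by
  simpa using PiLp.norm_apply_le x i

theorem norm_sub_le_of_idx_eq {n : ℤ} {x y : Rd d} (h : idx n x = idx n y) :
    ‖x - y‖ ≤ d * 2 ^ n := by
  refine (norm_le_sum_abs _).trans ?_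
  have hx : x ∈ dcube n (idx n y) := h
  have hy : y ∈ dcube n (idx n y) := rfl
  rw [mem_dcube] at hx hy
  calc ∑ i, |(x - y) i| ≤ ∑ _i : Fin d, (2 : ℝ) ^ n := by
        refine Finset.sum_le_sum fun i _ => ?_
        rw [PiLp.sub_apply, abs_le]
        constructor <;> nlinarith [hx i, hy i]
    _ = d * 2 ^ n := by simp

theorem idx_eq_of_le {n m : ℤ} (h : n ≤ m) {x y : Rd d} (hxy : idx n x = idx n y) :
    idx m x = idx m y := by
  induction m, h using Int.leInduction with
  | base => exact hxy
  | succ m _ ih =>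
    funext i
    have h3 : ∀ w : Rd d, idx (m + 1) w i = idx m w i / 2 := by
      intro w
      simp only [idx]
      rw [zpow_add₀ two_ne_zero, zpow_one, ← div_div]
      have := Int.floor_div_natCast (w i / 2 ^ m) 2
      rw [show ((2 : ℕ) : ℝ) = 2 by norm_num] at this
      rw [this]; rfl
    rw [h3, h3, ih]

theorem card_mul_le {n : ℤ} {N : Finset (Fin d → ℤ)} {T : Set (Rd d)} {v : ℝ} (hv : 0 ≤ v)
    (hT : volume T ≤ ENNReal.ofReal v) (h : ∀ z ∈ N, dcube n z ⊆ T) :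
    (N.card : ℝ) * ((2 : ℝ) ^ n) ^ d ≤ v := by
  have h1 : volume (⋃ z ∈ N, dcube n z) = ∑ z ∈ N, volume (dcube (d := d) n z) := by
    refine measure_biUnion_finset ?_ fun z _ => dcube_measurable n z
    intro z _ w _ hzw
    refine Set.disjoint_left.2 fun x hx hx' => hzw ?_
    exact hx.symm.trans hx'
  have h2 : volume (⋃ z ∈ N, dcube n z) ≤ volume T := measure_mono (iUnion₂_subset h)
  rw [h1] at h2
  simp only [volume_dcube, Finset.sum_const, nsmul_eq_mul] at h2
  rw [← ENNReal.ofReal_natCast, ← ENNReal.ofReal_mul (by positivity)] at h2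
  exact (ENNReal.ofReal_le_ofReal_iff hv).1 (h2.trans hT)

end DyadicCubes

section Net

variable {d : ℕ}

theorem net_finite (d u : ℕ) :
    {z : Fin d → ℤ | ∃ θ : Rd d, ‖θ‖ = 1 ∧ idx (-(u : ℤ)) θ = z}.Finite := by
  refine (Set.finite_Icc (fun _ => -2 ^ u) (fun _ => 2 ^ u)).subset ?_
  rintro z ⟨θ, hθ, rfl⟩
  have h : ∀ i, |θ i| ≤ 1 := fun i => (abs_apply_le_norm θ i).trans hθ.le
  have h2 : (0 : ℝ) < 2 ^ u := by positivity
  simp only [mem_Icc, Pi.le_def, idx, zpow_neg, zpow_natCast, div_inv_eq_mul]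
  refine ⟨fun i => ?_, fun i => ?_⟩
  · rw [Int.le_floor]; push_cast
    have := (abs_le.1 (h i)).1
    nlinarith
  · have := (abs_le.1 (h i)).2
    have h3 : (⌊θ i * 2 ^ u⌋ : ℝ) ≤ 2 ^ u := (Int.floor_le _).trans (by nlinarith)
    rw [← Int.cast_le (R := ℝ)]; push_cast; exact h3

/-- Indices of the dyadic cubes of side `2^{-u}` meeting the unit sphere. -/
def netS (d u : ℕ) : Finset (Fin d → ℤ) := (net_finite d u).toFinset

theorem mem_netS {u : ℕ} {z : Fin d → ℤ} :
    z ∈ netS d u ↔ ∃ θ : Rd d, ‖θ‖ = 1 ∧ idx (-(u : ℤ)) θ = z := by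
  simp [netS]

theorem exists_netPt (d u : ℕ) : ∃ e : (Fin d → ℤ) → Rd d, ∀ z ∈ netS d u, ‖e z‖ = 1 ∧
    idx (-(u : ℤ)) (e z) = z := by
  classical
  refine ⟨fun z => if h : z ∈ netS d u then (mem_netS.1 h).choose else 0, fun z hz => ?_⟩
  simp only [hz, dif_pos]
  exact (mem_netS.1 hz).choose_spec

def netPt (d u : ℕ) : (Fin d → ℤ) → Rd d := (exists_netPt d u).choose

theorem norm_netPt {u : ℕ} {z : Fin d → ℤ} (hz : z ∈ netS d u) : ‖netPt d u z‖ = 1 :=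
  ((exists_netPt d u).choose_spec z hz).1

theorem idx_netPt {u : ℕ} {z : Fin d → ℤ} (hz : z ∈ netS d u) :
    idx (-(u : ℤ)) (netPt d u z) = z :=
  ((exists_netPt d u).choose_spec z hz).2

theorem norm_sub_netPt {u : ℕ} {θ : Rd d} {z : Fin d → ℤ} (hz : z ∈ netS d u)
    (h : idx (-(u : ℤ)) θ = z) : ‖θ - netPt d u z‖ ≤ d * 2 ^ (-(u : ℤ)) :=
  norm_sub_le_of_idx_eq (h.trans (idx_netPt hz).symm)

theorem card_netS_crude (hd : 2 ≤ d) (u : ℕ) : ((netS d u).card : ℝ) ≤ (8 * d * 2 ^ u) ^ d := by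
  obtain ⟨e, he⟩ := exists_unit hd
  obtain ⟨b, hb⟩ := exists_basis_extend hd he
  have hd' : (2 : ℝ) ≤ d := by exact_mod_cast hd
  have h2u : (1 : ℝ) ≤ 2 ^ u := one_le_pow₀ (by norm_num)
  have h := card_mul_le (n := -(u : ℤ)) (N := netS d u) (T := {x : Rd d | ∀ i, |inner ℝ (b i) x| ≤ 2 * d})
    (v := (4 * d) ^ d) (by positivity) ?_ ?_
  · rw [zpow_neg, zpow_natCast, inv_pow, ← div_eq_mul_inv, div_le_iff₀ (by positivity)] at h
    refine h.trans ?_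
    rw [← mul_pow]
    gcongr; linarith
  · rw [volume_box, Finset.prod_const, Finset.card_univ, Fintype.card_fin,
      ← ENNReal.ofReal_pow (by positivity)]
    refine ENNReal.ofReal_le_ofReal (le_of_eq ?_); ring
  · intro z hz x hx i
    have h1 := norm_sub_netPt hz hx
    have h3 : (2 : ℝ) ^ (-(u : ℤ)) ≤ 1 := by
      rw [zpow_neg, zpow_natCast]; exact inv_le_one_of_one_le₀ h2u
    refine (abs_real_inner_le_norm _ _).trans ?_
    rw [b.norm_eq_one, one_mul]
    have h4 : ‖x‖ ≤ ‖x - netPt d u z‖ + ‖netPt d u z‖ := by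
      simpa using norm_add_le (x - netPt d u z) (netPt d u z)
    rw [norm_netPt hz] at h4
    nlinarith

theorem card_band (hd : 2 ≤ d) : ∃ C : ℝ, 0 < C ∧ ∀ (u : ℕ) (ξ : Rd d), ‖ξ‖ = 1 →
    (((netS d u).filter
      (fun z => |inner ℝ ξ (netPt d u z)| ≤ 2 * d * 2 ^ (-(u : ℤ)))).card : ℝ) ≤
      C * (2 ^ u) ^ (d - 2) := by
  obtain ⟨m, rfl⟩ : ∃ m, d = m + 2 := ⟨d - 2, by omega⟩
  set D : ℝ := ((m + 2 : ℕ) : ℝ) with hD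
  have hD2 : 2 ≤ D := by rw [hD]; exact_mod_cast hd
  refine ⟨(8 * D) ^ (m + 2) * (2 * D) ^ 2 + D * 4 ^ (m + 2) * (6 * D) * D, by positivity, ?_⟩
  intro u ξ hξ
  have h2u : (0 : ℝ) < 2 ^ u := by positivity
  have hr : (2 : ℝ) ^ (-(u : ℤ)) = (2 ^ u)⁻¹ := by rw [zpow_neg, zpow_natCast]
  simp only [hr, Nat.add_sub_cancel]
  set R : ℝ := 2 ^ u
  have hpos1 : 0 ≤ (8 * D) ^ (m + 2) * (2 * D) ^ 2 := by positivity
  have hpos2 : 0 ≤ D * 4 ^ (m + 2) * (6 * D) * D := by positivity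
  by_cases hc : R ≤ 2 * D
  · calc _ ≤ ((netS (m + 2) u).card : ℝ) := by
          exact_mod_cast Finset.card_le_card (Finset.filter_subset _ _)
      _ ≤ (8 * D * R) ^ (m + 2) := card_netS_crude hd u
      _ = (8 * D) ^ (m + 2) * R ^ 2 * R ^ m := by ring
      _ ≤ (8 * D) ^ (m + 2) * (2 * D) ^ 2 * R ^ m := by gcongr
      _ ≤ _ := by gcongr; linarith
  · have hc' : D * R⁻¹ ≤ 1 / 2 := by
      rw [← div_eq_mul_inv, div_le_iff₀ h2u]; linarith
    have hri : 0 < R⁻¹ := by positivity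
    have h := card_mul_le (n := -(u : ℤ)) (N := (netS (m + 2) u).filter
        (fun z => |inner ℝ ξ (netPt (m + 2) u z)| ≤ 2 * D * R⁻¹))
      (v := D * 4 ^ (m + 2) * (6 * D * R⁻¹) * (D * R⁻¹)) (by positivity)
      (shell_volume hd hξ (δ := 6 * D * R⁻¹) (ε := D * R⁻¹) (by positivity) (by positivity)
        (by linarith)) ?_
    · rw [hr, inv_pow, ← div_eq_mul_inv, div_le_iff₀ (by positivity)] at h
      refine h.trans ?_
      have : D * 4 ^ (m + 2) * (6 * D * R⁻¹) * (D * R⁻¹) * R ^ (m + 2) =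
          (D * 4 ^ (m + 2) * (6 * D) * D) * R ^ m := by
        field_simp
        ring
      rw [this]
      gcongr; linarith
    · intro z hz x hx
      rw [Finset.mem_filter] at hz
      have h1 := norm_sub_netPt hz.1 hx
      rw [hr] at h1
      have hn := norm_netPt hz.1
      have h3 : |‖x‖ - 1| ≤ D * R⁻¹ := by
        rw [← hn]; exact (abs_norm_sub_norm_le _ _).trans h1
      refine ⟨h3, ?_⟩
      have h4 : inner ℝ ξ x = inner ℝ ξ (netPt (m + 2) u z) +
          inner ℝ ξ (x - netPt (m + 2) u z) := by rw [← inner_add_right]; simp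
      have h5 : |inner ℝ ξ (x - netPt (m + 2) u z)| ≤ D * R⁻¹ := by
        refine (abs_real_inner_le_norm _ _).trans ?_
        rw [hξ, one_mul]; exact h1
      have h6 := abs_add_le (inner ℝ ξ (netPt (m + 2) u z)) (inner ℝ ξ (x - netPt (m + 2) u z))
      rw [← h4] at h6
      have h7 : 1 / 2 ≤ ‖x‖ := by have := (abs_le.1 h3).1; linarith
      have h8 : 0 ≤ 6 * D * R⁻¹ := by positivity
      nlinarith [hz.2]

theorem card_netS (hd : 2 ≤ d) : ∃ C : ℝ, 0 < C ∧ ∀ (u : ℕ),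
    ((netS d u).card : ℝ) ≤ C * (2 ^ u) ^ (d - 1) := by
  obtain ⟨ξ, hξ⟩ := exists_unit hd
  obtain ⟨m, rfl⟩ : ∃ m, d = m + 1 := ⟨d - 1, by omega⟩
  set D : ℝ := ((m + 1 : ℕ) : ℝ) with hD
  have hD2 : 2 ≤ D := by rw [hD]; exact_mod_cast hd
  refine ⟨(8 * D) ^ (m + 1) * (2 * D) + D * 4 ^ (m + 1) * 1 * D, by positivity, ?_⟩
  intro u
  have h2u : (0 : ℝ) < 2 ^ u := by positivity
  have hr : (2 : ℝ) ^ (-(u : ℤ)) = (2 ^ u)⁻¹ := by rw [zpow_neg, zpow_natCast]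
  simp only [Nat.add_sub_cancel]
  set R : ℝ := 2 ^ u
  have hpos1 : 0 ≤ (8 * D) ^ (m + 1) * (2 * D) := by positivity
  have hpos2 : 0 ≤ D * 4 ^ (m + 1) * 1 * D := by positivity
  by_cases hc : R ≤ 2 * D
  · calc _ ≤ (8 * D * R) ^ (m + 1) := card_netS_crude hd u
      _ = (8 * D) ^ (m + 1) * R * R ^ m := by ring
      _ ≤ (8 * D) ^ (m + 1) * (2 * D) * R ^ m := by gcongr
      _ ≤ _ := by gcongr; linarith
  · have hc' : D * R⁻¹ ≤ 1 / 2 := by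
      rw [← div_eq_mul_inv, div_le_iff₀ h2u]; linarith
    have hri : 0 < R⁻¹ := by positivity
    have h := card_mul_le (n := -(u : ℤ)) (N := netS (m + 1) u)
      (v := D * 4 ^ (m + 1) * 1 * (D * R⁻¹)) (by positivity)
      (shell_volume hd hξ (δ := 1) (ε := D * R⁻¹) (by positivity) (by positivity)
        (by linarith)) ?_
    · rw [hr, inv_pow, ← div_eq_mul_inv, div_le_iff₀ (by positivity)] at h
      refine h.trans ?_
      have : D * 4 ^ (m + 1) * 1 * (D * R⁻¹) * R ^ (m + 1) =
          (D * 4 ^ (m + 1) * 1 * D) * R ^ m := by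
        field_simp
        ring
      rw [this]
      gcongr; linarith
    · intro z hz x hx
      have h1 := norm_sub_netPt hz hx
      rw [hr] at h1
      have hn := norm_netPt hz
      have h3 : |‖x‖ - 1| ≤ D * R⁻¹ := by
        rw [← hn]; exact (abs_norm_sub_norm_le _ _).trans h1
      refine ⟨h3, ?_⟩
      rw [one_mul]
      exact (abs_real_inner_le_norm _ _).trans (by rw [hξ, one_mul])

end Net

section Pieces

variable {d : ℕ}

/-- The part of `Ω` living over the cube with index `z` at level `-u`. -/
def Onu (u : ℕ) (z : Fin d → ℤ) (Ω : Rd d → ℝ) (x : Rd d) : ℝ :=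
  if idx (-(u : ℤ)) (‖x‖⁻¹ • x) = z then Ω x else 0

theorem Onu_measurable {u : ℕ} {z : Fin d → ℤ} {Ω : Rd d → ℝ} (hΩ : Measurable Ω) :
    Measurable (Onu u z Ω) := by
  refine Measurable.ite ?_ hΩ measurable_const
  have : Measurable fun x : Rd d => idx (-(u : ℤ)) (‖x‖⁻¹ • x) :=
    (idx_measurable _).comp (by fun_prop)
  exact this (measurableSet_singleton z)

theorem Onu_hom {u : ℕ} {z : Fin d → ℤ} {Ω : Rd d → ℝ} (hom : Homogeneous0 d Ω) :
    Homogeneous0 d (Onu u z Ω) := by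
  intro x hx r hr
  have : ‖r • x‖⁻¹ • r • x = ‖x‖⁻¹ • x := by
    rw [norm_smul, Real.norm_of_nonneg hr.le, smul_smul]
    congr 1
    field_simp
  rw [Onu, Onu, this, hom x hx r hr]

theorem abs_Onu_le {u : ℕ} {z : Fin d → ℤ} {Ω : Rd d → ℝ} (x : Rd d) : |Onu u z Ω x| ≤ |Ω x| := by
  rw [Onu]; split_ifs <;> simp

theorem sum_Onu {u : ℕ} {Ω : Rd d → ℝ} {x : Rd d} (hx : x ≠ 0) :
    ∑ z ∈ netS d u, Onu u z Ω x = Ω x := by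
  have hm : idx (-(u : ℤ)) (‖x‖⁻¹ • x) ∈ netS d u :=
    mem_netS.2 ⟨_, norm_smul_inv_norm hx, rfl⟩
  simp only [Onu]
  rw [Finset.sum_ite_eq, if_pos hm]

theorem Onu_support {u : ℕ} {z : Fin d → ℤ} {Ω : Rd d → ℝ} {x : Rd d} (h : Onu u z Ω x ≠ 0) :
    idx (-(u : ℤ)) (‖x‖⁻¹ • x) = z := by
  by_contra h'
  exact h (if_neg h')

end Pieces

section Tent

variable {d : ℕ}

theorem tent_profile_integrable : Integrable (fun x : Rd d => max (1 - ‖x‖) 0) := by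
  refine Continuous.integrable_of_hasCompactSupport (by fun_prop) ?_
  refine HasCompactSupport.intro (isCompact_closedBall (0 : Rd d) 1) fun x hx => ?_
  rw [mem_closedBall_zero_iff, not_le] at hx
  exact max_eq_right (by linarith)

theorem tent_profile_pos : 0 < ∫ x : Rd d, max (1 - ‖x‖) 0 := by
  refine Continuous.integral_pos_of_hasCompactSupport_nonneg_nonzero (x := 0) (by fun_prop) ?_
    (fun x => le_max_right _ _) (by simp)
  refine HasCompactSupport.intro (isCompact_closedBall (0 : Rd d) 1) fun x hx => ?_
  rw [mem_closedBall_zero_iff, not_le] at hx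
  exact max_eq_right (by linarith)

def cTent (d : ℕ) : ℝ := (∫ x : Rd d, max (1 - ‖x‖) 0)⁻¹

theorem cTent_pos : 0 < cTent d := inv_pos.2 tent_profile_pos

/-- Normalised tent function of radius `t`. -/
def tent (t : ℝ) (x : Rd d) : ℝ := cTent d * (t ^ d)⁻¹ * max (1 - ‖x‖ / t) 0

variable {t : ℝ}

theorem tent_nonneg (ht : 0 < t) (x : Rd d) : 0 ≤ tent t x := by
  have := cTent_pos (d := d)
  have := le_max_right (1 - ‖x‖ / t) 0
  unfold tent; positivity

theorem tent_le (ht : 0 < t) (x : Rd d) : tent t x ≤ cTent d * (t ^ d)⁻¹ := by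
  have := cTent_pos (d := d)
  have h : max (1 - ‖x‖ / t) 0 ≤ 1 := max_le (by have : 0 ≤ ‖x‖ / t := by positivity
                                                 linarith) zero_le_one
  unfold tent
  exact mul_le_of_le_one_right (by positivity) h

theorem tent_continuous : Continuous (tent (d := d) t) := by unfold tent; fun_prop

theorem tent_eq_zero (ht : 0 < t) {x : Rd d} (h : t ≤ ‖x‖) : tent t x = 0 := by
  have : 1 ≤ ‖x‖ / t := (one_le_div ht).2 h
  rw [tent, max_eq_right (by linarith), mul_zero]

theorem tent_eq (x : Rd d) (ht : 0 < t) :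
    tent t x = cTent d * (t ^ d)⁻¹ * (fun x : Rd d => max (1 - ‖x‖) 0) (t⁻¹ • x) := by
  simp only [tent, norm_smul, norm_inv, Real.norm_of_nonneg ht.le]
  rw [div_eq_inv_mul]

theorem tent_integrable (ht : 0 < t) : Integrable (tent (d := d) t) := by
  have := (tent_profile_integrable (d := d)).comp_smul (R := t⁻¹) (by positivity)
  refine (this.const_mul (cTent d * (t ^ d)⁻¹)).congr (.of_forall fun x => ?_)
  rw [tent_eq x ht]

theorem integral_tent (ht : 0 < t) : ∫ x, tent (d := d) t x = 1 := by
  simp_rw [fun x => tent_eq (d := d) x ht]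
  have e := Measure.integral_comp_inv_smul volume (fun x : Rd d => max (1 - ‖x‖) 0) t
  rw [finrank_Rd, abs_of_pos (by positivity), smul_eq_mul] at e
  rw [integral_const_mul, e, cTent]
  have := tent_profile_pos (d := d)
  field_simp

theorem integral_abs_tent (ht : 0 < t) : ∫ x, |tent (d := d) t x| = 1 := by
  simp_rw [fun x => abs_of_nonneg (tent_nonneg (d := d) ht x)]
  exact integral_tent ht

theorem abs_tent_sub_le (ht : 0 < t) (x y : Rd d) :
    |tent t x - tent t y| ≤ cTent d * (t ^ d)⁻¹ * (‖x - y‖ / t) := by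
  have hc := cTent_pos (d := d)
  rw [tent, tent, ← mul_sub, abs_mul, abs_of_pos (by positivity)]
  gcongr
  refine (abs_max_sub_max_le_abs _ _ _).trans ?_
  rw [show 1 - ‖x‖ / t - (1 - ‖y‖ / t) = (‖y‖ - ‖x‖) / t by ring, abs_div, abs_of_pos ht]
  gcongr
  rw [norm_sub_rev]
  exact abs_norm_sub_norm_le y x

theorem norm_ft_tent_le (ht : 0 < t) (ξ : Rd d) : ‖ft (tent (d := d) t) ξ‖ ≤ 1 :=
  (norm_ft_le _ _).trans (integral_abs_tent ht).le

/-- A function of mean zero has a Fourier transform vanishing at the origin; here for general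
functions: comparison with the integral. -/
theorem norm_ft_sub_integral_le {g : Rd d → ℝ} {ρ : ℝ} (hg : Integrable g)
    (hs : ∀ x, ρ < ‖x‖ → g x = 0) (ξ : Rd d) :
    ‖ft g ξ - (∫ x, g x : ℝ)‖ ≤ 2 * Real.pi * ρ * ‖ξ‖ * ∫ x, |g x| := by
  have hI : Integrable (fun x => Complex.exp ((-2 * Real.pi * inner ℝ x ξ : ℝ) * Complex.I) *
      (g x : ℂ)) := by
    refine (hg.ofReal (𝕜 := ℂ)).bdd_mul (c := 1) (Continuous.aestronglyMeasurable (by fun_prop))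
      (.of_forall fun x => ?_)
    rw [Complex.norm_exp_ofReal_mul_I]
  have hg' : Integrable (fun x => (g x : ℂ)) := hg.ofReal
  rw [ft_eq, ← integral_complex_ofReal, ← integral_sub hI hg', ← integral_const_mul]
  refine norm_integral_le_of_norm_le (hg.abs.const_mul _) (.of_forall fun x => ?_)
  by_cases hx : ρ < ‖x‖
  · rw [hs x hx]; simp
  · push Not at hx
    rw [← sub_one_mul, norm_mul, Complex.norm_real, Real.norm_eq_abs]
    gcongr
    have := Real.norm_exp_I_mul_ofReal_sub_one_le (x := -2 * Real.pi * inner ℝ x ξ)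
    rw [mul_comm Complex.I] at this
    refine this.trans ?_
    rw [Real.norm_eq_abs, abs_mul, abs_mul, abs_neg, abs_of_pos Real.pi_pos, abs_two,
      mul_assoc (2 * Real.pi)]
    gcongr
    exact (abs_real_inner_le_norm _ _).trans (by gcongr)

theorem norm_one_sub_ft_tent_le (ht : 0 < t) (ξ : Rd d) :
    ‖1 - ft (tent (d := d) t) ξ‖ ≤ 2 * Real.pi * t * ‖ξ‖ := by
  have := norm_ft_sub_integral_le (tent_integrable (d := d) ht)
    (fun x hx => tent_eq_zero ht hx.le) ξ
  rw [integral_tent ht, integral_abs_tent ht, mul_one, norm_sub_rev] at this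
  simpa using this

theorem norm_one_sub_ft_tent_le_two (ht : 0 < t) (ξ : Rd d) :
    ‖1 - ft (tent (d := d) t) ξ‖ ≤ 2 := by
  refine (norm_sub_le _ _).trans ?_
  have := norm_ft_tent_le ht ξ
  rw [norm_one]; linarith

def cShift (d : ℕ) : ℝ := 2 * cTent d * volume.real (closedBall (0 : Rd d) 1)

theorem cShift_nonneg : 0 ≤ cShift d := by
  have := cTent_pos (d := d); unfold cShift; positivity

theorem lintegral_tent_sub_le (ht : 0 < t) (y c : Rd d) :
    ∫⁻ x, ‖tent t (x - y) - tent t (x - c)‖ₑ ≤ ENNReal.ofReal (cShift d * (‖y - c‖ / t)) := by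
  have hc := cTent_pos (d := d)
  set A := cTent d * (t ^ d)⁻¹ * (‖y - c‖ / t) with hA
  have hA0 : 0 ≤ A := by positivity
  have h1 : ∀ x : Rd d, ‖tent t (x - y) - tent t (x - c)‖ₑ ≤
      (closedBall y t ∪ closedBall c t).indicator (fun _ => ENNReal.ofReal A) x := by
    intro x
    by_cases hx : x ∈ closedBall y t ∪ closedBall c t
    · rw [indicator_of_mem hx, Real.enorm_eq_ofReal_abs]
      refine ENNReal.ofReal_le_ofReal ((abs_tent_sub_le ht _ _).trans (le_of_eq ?_))
      rw [hA, norm_sub_rev y c, sub_sub_sub_cancel_left]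
    · rw [indicator_of_notMem hx]
      rw [mem_union, not_or, mem_closedBall, mem_closedBall, not_le, not_le, dist_eq_norm,
        dist_eq_norm] at hx
      rw [tent_eq_zero ht hx.1.le, tent_eq_zero ht hx.2.le]; simp
  refine (lintegral_mono h1).trans ?_
  rw [lintegral_indicator (by measurability), setLIntegral_const]
  have h2 : ∀ z : Rd d, volume (closedBall z t) =
      ENNReal.ofReal (t ^ d * volume.real (closedBall (0 : Rd d) 1)) := by
    intro z
    rw [Measure.addHaar_closedBall' _ _ ht.le, finrank_Rd, ENNReal.ofReal_mul (by positivity),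
      Measure.real, ENNReal.ofReal_toReal measure_closedBall_lt_top.ne]
  calc _ ≤ ENNReal.ofReal A * (volume (closedBall y t) + volume (closedBall c t)) := by
        gcongr; exact measure_union_le _ _
    _ = _ := by
        rw [h2, h2, ← ENNReal.ofReal_add (by positivity) (by positivity),
          ← ENNReal.ofReal_mul hA0]
        congr 1
        rw [hA, cShift]; field_simp; ring

theorem integral_abs_cv_tent_le {b : Rd d → ℝ} {c : Rd d} {ρ : ℝ} (hρ : 0 ≤ ρ)
    (ht : 0 < t) (hb : Integrable b) (h0 : ∫ x, b x = 0) (hs : ∀ x, ρ < ‖x - c‖ → b x = 0) :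
    ∫ x, |cv (tent t) b x| ≤ cShift d * (ρ / t) * ∫ x, |b x| := by
  have hcs := cShift_nonneg (d := d)
  have h1 : ∀ x, cv (tent t) b x = ∫ y, (tent t (x - y) - tent t (x - c)) * b y := by
    intro x
    have hi1 : Integrable (fun y => tent t (x - y) * b y) := by
      refine hb.bdd_mul (c := cTent d * (t ^ d)⁻¹) ?_ (.of_forall fun y => ?_)
      · exact (tent_continuous.comp (by fun_prop)).aestronglyMeasurable
      · rw [Real.norm_of_nonneg (tent_nonneg ht _)]; exact tent_le ht _
    simp only [sub_mul]
    rw [integral_sub hi1 (hb.const_mul _), integral_const_mul, h0, mul_zero, sub_zero]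
    rfl
  have hcv : Integrable (cv (tent t) b) := cv_integrable (tent_integrable ht) hb
  have h2 : ENNReal.ofReal (∫ x, |cv (tent t) b x|) ≤
      ENNReal.ofReal (cShift d * (ρ / t) * ∫ x, |b x|) := by
    have e1 : ∫ x, |cv (tent t) b x| = ∫ x, ‖cv (tent t) b x‖ := rfl
    rw [e1, ofReal_integral_norm_eq_lintegral_enorm hcv]
    calc ∫⁻ x, ‖cv (tent t) b x‖ₑ
        ≤ ∫⁻ x, ∫⁻ y, ‖tent t (x - y) - tent t (x - c)‖ₑ * ‖b y‖ₑ := by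
          refine lintegral_mono fun x => ?_
          rw [h1]
          refine (enorm_integral_le_lintegral_enorm _).trans (le_of_eq ?_)
          simp only [enorm_mul]
      _ = ∫⁻ y, ∫⁻ x, ‖tent t (x - y) - tent t (x - c)‖ₑ * ‖b y‖ₑ := by
          refine lintegral_lintegral_swap ?_
          have m1 : Continuous fun p : Rd d × Rd d => tent t (p.1 - p.2) - tent t (p.1 - c) :=
            (tent_continuous.comp (by fun_prop)).sub (tent_continuous.comp (by fun_prop))
          have m2 : AEMeasurable (fun p : Rd d × Rd d => ‖b p.2‖ₑ) (volume.prod volume) :=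
            hb.aestronglyMeasurable.enorm.comp_snd
          exact m1.measurable.enorm.aemeasurable.mul m2
      _ ≤ ∫⁻ y, ENNReal.ofReal (cShift d * (ρ / t)) * ‖b y‖ₑ := by
          refine lintegral_mono fun y => ?_
          by_cases hy : ρ < ‖y - c‖
          · simp [hs y hy]
          · push Not at hy
            rw [lintegral_mul_const' _ _ (by simp)]
            gcongr
            refine (lintegral_tent_sub_le ht y c).trans (ENNReal.ofReal_le_ofReal ?_)
            gcongr
      _ = ENNReal.ofReal (cShift d * (ρ / t)) * ENNReal.ofReal (∫ x, ‖b x‖) := by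
          rw [lintegral_const_mul' _ _ (by simp), ofReal_integral_norm_eq_lintegral_enorm hb]
      _ = _ := by rw [← ENNReal.ofReal_mul (by positivity)]; rfl
  refine (ENNReal.ofReal_le_ofReal_iff ?_).1 h2
  have : 0 ≤ ∫ x, |b x| := integral_nonneg fun _ => abs_nonneg _
  positivity

end Tent

section GeometricSums

theorem sum_half_pow_le (s : Finset ℕ) : ∑ k ∈ s, (1 / 2 : ℝ) ^ k ≤ 2 :=
  (summable_geometric_two.sum_le_tsum s fun _ _ => by positivity).trans tsum_geometric_two.le

theorem sum_half_natAbs_le (s : Finset ℤ) (a : ℤ) :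
    ∑ n ∈ s, (1 / 2 : ℝ) ^ (n + a).natAbs ≤ 4 := by
  rw [← Finset.sum_filter_add_sum_filter_not s (fun n => 0 ≤ n + a)]
  have h : ∀ t : Finset ℤ, Set.InjOn (fun n : ℤ => (n + a).natAbs) t →
      ∑ n ∈ t, (1 / 2 : ℝ) ^ (n + a).natAbs ≤ 2 := by
    intro t ht
    rw [← Finset.sum_image (f := fun k => (1 / 2 : ℝ) ^ k) ht]
    exact sum_half_pow_le _
  have h1 := h (s.filter fun n => 0 ≤ n + a) (by
    intro x hx y hy hxy
    simp at hx hy hxy; omega)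
  have h2 := h (s.filter fun n => ¬ 0 ≤ n + a) (by
    intro x hx y hy hxy
    simp at hx hy hxy; omega)
  linarith

theorem geo_sum (s : Finset ℤ) {z : ℝ} (hz : 0 < z) :
    ∑ n ∈ s, min ((2 : ℝ) ^ n * z) (1 / ((2 : ℝ) ^ n * z)) ≤ 8 := by
  obtain ⟨a, ha1, ha2⟩ := exists_mem_Ico_zpow hz (one_lt_two)
  have : ∀ n ∈ s, min ((2 : ℝ) ^ n * z) (1 / ((2 : ℝ) ^ n * z)) ≤
      2 * (1 / 2 : ℝ) ^ (n + a).natAbs := by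
    intro n _
    have h2 : (0 : ℝ) < 2 ^ n := by positivity
    rcases le_total 0 (n + a) with h | h
    · refine (min_le_right _ _).trans ?_
      obtain ⟨m, hm⟩ := Int.eq_ofNat_of_zero_le h
      have e : (2 : ℝ) ^ m = 2 ^ n * 2 ^ a := by
        rw [← zpow_add₀ two_ne_zero, hm, zpow_natCast]
      rw [hm, Int.natAbs_natCast, one_div_pow]
      have : (1 : ℝ) / (2 ^ n * z) ≤ 1 / 2 ^ m := by
        rw [e]; gcongr
      have : (0 : ℝ) ≤ 1 / 2 ^ m := by positivity
      linarith
    · refine (min_le_left _ _).trans ?_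
      obtain ⟨m, hm⟩ := Int.eq_ofNat_of_zero_le (neg_nonneg.2 h)
      have hm' : n + a = -(m : ℤ) := by omega
      have e : (1 / 2 : ℝ) ^ m = 2 ^ n * 2 ^ a := by
        rw [← zpow_add₀ two_ne_zero, hm', zpow_neg, zpow_natCast, one_div_pow, one_div]
      rw [hm', Int.natAbs_neg, Int.natAbs_natCast, e]
      rw [zpow_add₀ two_ne_zero, zpow_one] at ha2
      nlinarith
  refine (Finset.sum_le_sum this).trans ?_
  rw [← Finset.mul_sum]
  linarith [sum_half_natAbs_le s a]

end GeometricSums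

section Laplace

variable {d : ℕ} {ρ : ℝ}

def lap (ρ s : ℝ) : ℝ := (2 * ρ)⁻¹ * Real.exp (-|s| / ρ)

theorem lap_pos (hρ : 0 < ρ) (s : ℝ) : 0 < lap ρ s := by unfold lap; positivity

theorem lap_le (hρ : 0 < ρ) (s : ℝ) : lap ρ s ≤ (2 * ρ)⁻¹ := by
  have : Real.exp (-|s| / ρ) ≤ 1 := Real.exp_le_one_iff.2 (by
    rw [neg_div]; have : 0 ≤ |s| / ρ := by positivity
    linarith)
  unfold lap
  exact mul_le_of_le_one_right (by positivity) this

theorem lap_le_exp (hρ : 0 < ρ) (s s' : ℝ) : lap ρ s ≤ Real.exp (|s - s'| / ρ) * lap ρ s' := by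
  rw [lap, lap, mul_left_comm, ← Real.exp_add]
  gcongr
  rw [← add_div]
  gcongr
  have := abs_sub_abs_le_abs_sub s' s
  rw [abs_sub_comm] at this
  linarith

theorem lap_fourier_aux (hρ : 0 < ρ) (ξ : ℝ) :
    Integrable (fun s : ℝ => Complex.exp ((-2 * Real.pi * (s * ξ) : ℝ) * Complex.I) * (lap ρ s : ℂ)) ∧
    ∫ s : ℝ, Complex.exp ((-2 * Real.pi * (s * ξ) : ℝ) * Complex.I) * (lap ρ s : ℂ) =
      ((1 / (1 + 4 * Real.pi ^ 2 * ρ ^ 2 * ξ ^ 2) : ℝ) : ℂ) := by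
  have hρ' : (ρ : ℂ) ≠ 0 := by exact_mod_cast hρ.ne'
  set F := fun s : ℝ => Complex.exp ((-2 * Real.pi * (s * ξ) : ℝ) * Complex.I) * (lap ρ s : ℂ)
  set a : ℂ := -(1 / ρ : ℝ) + (-2 * Real.pi * ξ : ℝ) * Complex.I with ha
  set a' : ℂ := (1 / ρ : ℝ) + (-2 * Real.pi * ξ : ℝ) * Complex.I with ha'
  have hare : a.re = -(1 / ρ) := by rw [ha]; simp
  have hare' : a'.re = 1 / ρ := by rw [ha']; simp
  have hneg : a.re < 0 := by rw [hare]; have : 0 < 1 / ρ := by positivity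
                             linarith
  have hpos : 0 < a'.re := by rw [hare']; positivity
  have ha0 : a ≠ 0 := fun h => by rw [h] at hneg; simp at hneg
  have ha0' : a' ≠ 0 := fun h => by rw [h] at hpos; simp at hpos
  have e1 : ∀ s ∈ Ioi (0 : ℝ), F s = ((2 * ρ)⁻¹ : ℝ) * Complex.exp (a * s) := by
    intro s hs
    simp only [F, lap, abs_of_pos (mem_Ioi.1 hs)]
    push_cast
    rw [mul_left_comm, ← Complex.exp_add]
    congr 2
    rw [ha]; push_cast; field_simp; ring
  have e2 : ∀ s ∈ Iic (0 : ℝ), F s = ((2 * ρ)⁻¹ : ℝ) * Complex.exp (a' * s) := by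
    intro s hs
    simp only [F, lap, abs_of_nonpos (mem_Iic.1 hs)]
    push_cast
    rw [mul_left_comm, ← Complex.exp_add]
    congr 2
    rw [ha']; push_cast; field_simp; ring
  have i1 : IntegrableOn F (Ioi 0) := by
    refine IntegrableOn.congr_fun ((integrableOn_exp_mul_complex_Ioi hneg 0).const_mul _)
      (fun s hs => (e1 s hs).symm) measurableSet_Ioi
  have i2 : IntegrableOn F (Iic 0) := by
    refine IntegrableOn.congr_fun ((integrableOn_exp_mul_complex_Iic hpos 0).const_mul _)
      (fun s hs => (e2 s hs).symm) measurableSet_Iic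
  have hF : Integrable F := by
    rw [← integrableOn_univ, ← Iic_union_Ioi (a := (0 : ℝ))]
    exact i2.union i1
  refine ⟨hF, ?_⟩
  rw [← intervalIntegral.integral_Iic_add_Ioi i2 i1, setIntegral_congr_fun measurableSet_Iic e2,
    setIntegral_congr_fun measurableSet_Ioi e1, integral_const_mul, integral_const_mul,
    integral_exp_mul_complex_Iic hpos, integral_exp_mul_complex_Ioi hneg]
  simp only [Complex.ofReal_zero, mul_zero, Complex.exp_zero]
  have hprod : a * a' = -((1 + 4 * Real.pi ^ 2 * ρ ^ 2 * ξ ^ 2) / ρ ^ 2) := by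
    rw [ha, ha']; push_cast; field_simp
    ring_nf
    rw [Complex.I_sq]; ring
  have hsub : a - a' = -2 / ρ := by rw [ha, ha']; push_cast; field_simp; ring
  have hne : (1 + 4 * (Real.pi : ℂ) ^ 2 * ρ ^ 2 * ξ ^ 2) ≠ 0 := by
    have : (0 : ℝ) < 1 + 4 * Real.pi ^ 2 * ρ ^ 2 * ξ ^ 2 := by positivity
    exact_mod_cast this.ne'
  have : (1 : ℂ) / a' + -1 / a = (a - a') / (a * a') := by field_simp; ring
  rw [← mul_add, this, hprod, hsub]
  push_cast
  field_simp

theorem lap_integrable (hρ : 0 < ρ) : Integrable (lap ρ) := by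
  have := (lap_fourier_aux hρ 0).1.norm
  refine this.congr (.of_forall fun s => ?_)
  simp [abs_of_pos (lap_pos hρ s)]

theorem integral_lap (hρ : 0 < ρ) : ∫ s, lap ρ s = 1 := by
  have := (lap_fourier_aux hρ 0).2
  simp only [mul_zero, Complex.ofReal_zero, zero_mul, Complex.exp_zero, one_mul] at this
  rw [integral_complex_ofReal] at this
  have h := Complex.ofReal_injective this
  rw [h]; simp

/-- Product Laplace kernel. -/
def lapG (ρ : ℝ) (x : Rd d) : ℝ := ∏ i, lap ρ (x i)

theorem lapG_pos (hρ : 0 < ρ) (x : Rd d) : 0 < lapG ρ x := Finset.prod_pos fun i _ => lap_pos hρ _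

theorem lapG_le (hρ : 0 < ρ) (x : Rd d) : lapG ρ x ≤ ((2 * ρ)⁻¹) ^ d := by
  refine (Finset.prod_le_prod (fun i _ => (lap_pos hρ _).le) fun i _ => lap_le hρ (x i)).trans ?_
  simp

theorem lapG_integrable (hρ : 0 < ρ) : Integrable (lapG (d := d) ρ) := by
  have h : Integrable (fun y : Fin d → ℝ => ∏ i, lap ρ (y i)) :=
    Integrable.fintype_prod (f := fun _ => lap ρ) fun _ => lap_integrable hρ
  exact ((PiLp.volume_preserving_ofLp (Fin d)).integrable_comp_of_integrable h)

theorem integral_Rd_prod {𝕜 : Type*} [RCLike 𝕜] (f : Fin d → ℝ → 𝕜) :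
    ∫ x : Rd d, ∏ i, f i (x i) = ∏ i, ∫ s, f i s := by
  rw [← integral_fintype_prod_volume_eq_prod]
  exact (EuclideanSpace.volume_preserving_symm_measurableEquiv_toLp (Fin d)).integral_comp'
    (fun y => ∏ i, f i (y i))

theorem integral_lapG (hρ : 0 < ρ) : ∫ x, lapG (d := d) ρ x = 1 := by
  have := integral_Rd_prod (d := d) (fun _ => lap ρ)
  simp only [integral_lap hρ, Finset.prod_const_one] at this
  exact this

theorem integral_abs_lapG (hρ : 0 < ρ) : ∫ x, |lapG (d := d) ρ x| = 1 := by
  simp_rw [fun x => abs_of_pos (lapG_pos (d := d) hρ x)]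
  exact integral_lapG hρ

theorem ft_lapG (hρ : 0 < ρ) (ξ : Rd d) :
    ft (lapG ρ) ξ = ((∏ i, 1 / (1 + 4 * Real.pi ^ 2 * ρ ^ 2 * (ξ i) ^ 2) : ℝ) : ℂ) := by
  rw [ft_eq]
  have h := integral_Rd_prod (d := d) (𝕜 := ℂ)
    (fun i s => Complex.exp ((-2 * Real.pi * (s * ξ i) : ℝ) * Complex.I) * (lap ρ s : ℂ))
  rw [Finset.prod_congr rfl fun i _ => (lap_fourier_aux hρ (ξ i)).2, ← Complex.ofReal_prod] at h
  rw [← h]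
  refine integral_congr_ae (.of_forall fun x => ?_)
  simp only
  rw [Finset.prod_mul_distrib, ← Complex.exp_sum, ← Finset.sum_mul, ← Complex.ofReal_sum,
    ← Finset.mul_sum, lapG, Complex.ofReal_prod]
  congr 5
  simp [PiLp.inner_apply, mul_comm]

theorem norm_ft_lapG_ge (hρ : 0 < ρ) (ξ : Rd d) :
    (4 * Real.pi ^ 2 * (1 + ρ * ‖ξ‖) ^ 2) ^ (-(d : ℤ)) ≤ ‖ft (lapG ρ) ξ‖ := by
  have hpos : ∀ i, 0 < 1 / (1 + 4 * Real.pi ^ 2 * ρ ^ 2 * (ξ i) ^ 2) := fun i => by positivity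
  rw [ft_lapG hρ, Complex.norm_real, Real.norm_of_nonneg (Finset.prod_nonneg fun i _ => (hpos i).le)]
  rw [zpow_neg, zpow_natCast, ← inv_pow]
  have : ((4 * Real.pi ^ 2 * (1 + ρ * ‖ξ‖) ^ 2)⁻¹) ^ d =
      ∏ _i : Fin d, (4 * Real.pi ^ 2 * (1 + ρ * ‖ξ‖) ^ 2)⁻¹ := by simp
  rw [this]
  refine Finset.prod_le_prod (fun i _ => by positivity) fun i _ => ?_
  rw [← one_div]
  refine one_div_le_one_div_of_le (by positivity) ?_
  have h1 : (ξ i) ^ 2 ≤ ‖ξ‖ ^ 2 := sq_le_sq.2 (by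
    rw [abs_norm]; exact abs_apply_le_norm ξ i)
  have h2 : 1 ≤ 4 * Real.pi ^ 2 := by nlinarith [Real.pi_gt_three]
  have h3 : 0 ≤ ρ * ‖ξ‖ := by positivity
  calc 1 + 4 * Real.pi ^ 2 * ρ ^ 2 * (ξ i) ^ 2 ≤ 4 * Real.pi ^ 2 + 4 * Real.pi ^ 2 * ρ ^ 2 * ‖ξ‖ ^ 2 := by
        gcongr
    _ = 4 * Real.pi ^ 2 * (1 + (ρ * ‖ξ‖) ^ 2) := by ring
    _ ≤ _ := by gcongr; nlinarith

theorem lapG_le_exp (hρ : 0 < ρ) (x y : Rd d) :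
    lapG ρ x ≤ Real.exp (d * (‖x - y‖ / ρ)) * lapG ρ y := by
  have : Real.exp (d * (‖x - y‖ / ρ)) = ∏ _i : Fin d, Real.exp (‖x - y‖ / ρ) := by
    rw [Finset.prod_const, Finset.card_univ, Fintype.card_fin, ← Real.exp_nat_mul]
  rw [this, lapG, lapG, ← Finset.prod_mul_distrib]
  refine Finset.prod_le_prod (fun i _ => (lap_pos hρ _).le) fun i _ => ?_
  refine (lap_le_exp hρ (x i) (y i)).trans ?_
  have := (lap_pos hρ (y i)).le
  gcongr
  exact abs_apply_le_norm (x - y) i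

end Laplace

section Chebyshev

variable {d : ℕ}

theorem cheb_one {F : Rd d → ℝ} (hF : Integrable F) {α : ℝ} (hα : 0 < α) :
    volume {x | α < |F x|} ≤ ENNReal.ofReal ((∫ x, |F x|) / α) := by
  have h := mul_meas_ge_le_lintegral₀ (μ := volume) hF.aestronglyMeasurable.enorm (ENNReal.ofReal α)
  rw [← ofReal_integral_norm_eq_lintegral_enorm hF] at h
  rw [ENNReal.ofReal_div_of_pos hα, ENNReal.le_div_iff_mul_le (by simp [hα]) (by simp), mul_comm]
  refine le_trans ?_ h
  gcongr with x
  intro hx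
  rw [Real.enorm_eq_ofReal_abs]
  exact ENNReal.ofReal_le_ofReal hx.le

theorem cheb_two {F : Rd d → ℝ} (hF : Integrable (fun x => F x ^ 2)) {α : ℝ} (hα : 0 < α) :
    volume {x | α < |F x|} ≤ ENNReal.ofReal ((∫ x, F x ^ 2) / α ^ 2) := by
  have h := cheb_one hF (α := α ^ 2) (by positivity)
  simp_rw [abs_of_nonneg (sq_nonneg (F _))] at h
  refine (measure_mono fun x hx => ?_).trans h
  have hx : α < |F x| := hx
  have := pow_lt_pow_left₀ hx hα.le two_ne_zero
  rwa [sq_abs] at this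

end Chebyshev

section Family

variable {d : ℕ} {ι : Type*}

/-- A finite family of atoms attached to disjoint cubes `Q i` of side `2 ^ n i`. -/
structure Fam (I : Finset ι) (n : ι → ℤ) (c : ι → Rd d) (Q : ι → Set (Rd d))
    (b : ι → Rd d → ℝ) : Prop where
  nice : ∀ i ∈ I, Nice (b i)
  mean : ∀ i ∈ I, ∫ x, b i x = 0
  lone : ∀ i ∈ I, ∫ x, |b i x| ≤ ((2 : ℝ) ^ n i) ^ d
  supp : ∀ i ∈ I, ∀ x ∉ Q i, b i x = 0
  meas : ∀ i ∈ I, MeasurableSet (Q i)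
  vol : ∀ i ∈ I, volume (Q i) = ENNReal.ofReal (((2 : ℝ) ^ n i) ^ d)
  ball : ∀ i ∈ I, ∀ x ∈ Q i, ‖x - c i‖ ≤ d * 2 ^ n i
  disj : ∀ i ∈ I, ∀ j ∈ I, i ≠ j → Disjoint (Q i) (Q j)

/-- Total volume of the cubes of a family. -/
def famV (d : ℕ) (n : ι → ℤ) (I : Finset ι) : ℝ := ∑ i ∈ I, ((2 : ℝ) ^ n i) ^ d

theorem famV_nonneg {n : ι → ℤ} {I : Finset ι} : 0 ≤ famV d n I :=
  Finset.sum_nonneg fun _ _ => by positivity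

theorem famV_mono {n : ι → ℤ} {I J : Finset ι} (h : J ⊆ I) : famV d n J ≤ famV d n I :=
  Finset.sum_le_sum_of_subset_of_nonneg h fun _ _ _ => by positivity

variable {I J : Finset ι} {n : ι → ℤ} {c : ι → Rd d} {Q : ι → Set (Rd d)} {b : ι → Rd d → ℝ}

theorem Fam.mono (h : Fam I n c Q b) (hJ : J ⊆ I) : Fam J n c Q b :=
  ⟨fun i hi => h.nice i (hJ hi), fun i hi => h.mean i (hJ hi), fun i hi => h.lone i (hJ hi),
    fun i hi => h.supp i (hJ hi), fun i hi => h.meas i (hJ hi), fun i hi => h.vol i (hJ hi),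
    fun i hi => h.ball i (hJ hi), fun i hi j hj => h.disj i (hJ hi) j (hJ hj)⟩

theorem Fam.supp' (h : Fam I n c Q b) {i : ι} (hi : i ∈ I) {x : Rd d}
    (hx : d * 2 ^ n i < ‖x - c i‖) : b i x = 0 :=
  h.supp i hi x fun hQ => not_lt.2 (h.ball i hi x hQ) hx

theorem Fam.lapG_le (h : Fam I n c Q b) {i : ι} (hi : i ∈ I) {ρ : ℝ} (hρ : 2 ^ n i ≤ ρ)
    (x : Rd d) : cv (lapG ρ) (fun y => |b i y|) x ≤
      Real.exp (2 * d ^ 2) * ∫ y in Q i, lapG ρ (x - y) := by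
  have h2 : (0 : ℝ) < 2 ^ n i := by positivity
  have hρ0 : 0 < ρ := h2.trans_le hρ
  set A := ∫ y in Q i, lapG ρ (x - y)
  have hGi : Integrable (fun y => lapG ρ (x - y)) := (lapG_integrable hρ0).comp_sub_left x
  set q := ((2 : ℝ) ^ n i) ^ d with hq
  have hq0 : 0 < q := by positivity
  have key : ∀ y ∈ Q i, lapG ρ (x - y) * q ≤ Real.exp (2 * d ^ 2) * A := by
    intro y hy
    have : ∫ _y' in Q i, lapG ρ (x - y) ≤ ∫ y' in Q i, Real.exp (2 * d ^ 2) * lapG ρ (x - y') := by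
      refine setIntegral_mono_on ?_ (hGi.const_mul _).integrableOn (h.meas i hi) fun y' hy' => ?_
      · rw [integrableOn_const_iff]; right; rw [h.vol i hi]; exact ENNReal.ofReal_lt_top
      · refine (lapG_le_exp hρ0 (x - y) (x - y')).trans ?_
        have := (lapG_pos hρ0 (x - y')).le
        rw [show (2 : ℝ) * d ^ 2 = d * (2 * d) by ring]
        gcongr
        rw [div_le_iff₀ hρ0, sub_sub_sub_cancel_left]
        calc ‖y' - y‖ = ‖(y' - c i) - (y - c i)‖ := by rw [sub_sub_sub_cancel_right]
          _ ≤ ‖y' - c i‖ + ‖y - c i‖ := norm_sub_le _ _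
          _ ≤ d * 2 ^ n i + d * 2 ^ n i := add_le_add (h.ball i hi _ hy') (h.ball i hi _ hy)
          _ = 2 * d * 2 ^ n i := by ring
          _ ≤ _ := by gcongr
    rw [integral_const_mul, setIntegral_const, Measure.real, h.vol i hi,
      ENNReal.toReal_ofReal hq0.le, smul_eq_mul, mul_comm] at this
    exact this
  have hb := (h.nice i hi).abs
  calc cv (lapG ρ) (fun y => |b i y|) x ≤ ∫ y, (Real.exp (2 * d ^ 2) * A / q) * |b i y| := by
        refine integral_mono (cv_integrand (lapG_integrable hρ0) hb x) (hb.int.const_mul _) ?_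
        intro y
        by_cases hy : y ∈ Q i
        · simp only
          gcongr
          rw [le_div_iff₀ hq0]; exact key y hy
        · simp [h.supp i hi y hy]
    _ = (Real.exp (2 * d ^ 2) * A / q) * ∫ y, |b i y| := integral_const_mul _ _
    _ ≤ (Real.exp (2 * d ^ 2) * A / q) * q := by
        have : 0 ≤ A := integral_nonneg fun y => (lapG_pos hρ0 _).le
        gcongr
        exact h.lone i hi
    _ = _ := by field_simp

theorem Fam.sum_lapG_le (h : Fam I n c Q b) {ρ : ℝ} (hρ : ∀ i ∈ I, 2 ^ n i ≤ ρ) (hρ0 : 0 < ρ)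
    (x : Rd d) : ∑ i ∈ I, cv (lapG ρ) (fun y => |b i y|) x ≤ Real.exp (2 * d ^ 2) := by
  have hGi : Integrable (fun y => lapG ρ (x - y)) := (lapG_integrable hρ0).comp_sub_left x
  calc _ ≤ ∑ i ∈ I, Real.exp (2 * d ^ 2) * ∫ y in Q i, lapG ρ (x - y) :=
        Finset.sum_le_sum fun i hi => h.lapG_le hi (hρ i hi) x
    _ = Real.exp (2 * d ^ 2) * ∫ y in ⋃ i ∈ I, Q i, lapG ρ (x - y) := by
        rw [← Finset.mul_sum, integral_biUnion_finset I (fun i hi => h.meas i hi)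
          (fun i hi j hj hij => h.disj i hi j hj hij) fun i _ => hGi.integrableOn]
    _ ≤ Real.exp (2 * d ^ 2) * 1 := by
        gcongr
        refine (setIntegral_le_integral hGi (.of_forall fun y => (lapG_pos hρ0 _).le)).trans ?_
        rw [integral_sub_left_eq_self (fun y => lapG ρ y), integral_lapG hρ0]
    _ = _ := mul_one _

theorem Fam.nice_sum (h : Fam I n c Q b) : Nice (fun x => ∑ i ∈ I, b i x) :=
  Nice.sum fun i hi => h.nice i hi

theorem Fam.integral_abs_sum_le (h : Fam I n c Q b) : ∫ x, |∑ i ∈ I, b i x| ≤ famV d n I := by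
  calc _ ≤ ∫ x, ∑ i ∈ I, |b i x| :=
        integral_mono h.nice_sum.int.abs (integrable_finsetSum _ fun i hi => (h.nice i hi).int.abs)
          fun x => Finset.abs_sum_le_sum_abs _ _
    _ = ∑ i ∈ I, ∫ x, |b i x| := integral_finsetSum _ fun i hi => (h.nice i hi).int.abs
    _ ≤ _ := Finset.sum_le_sum fun i hi => h.lone i hi

theorem lowfreq (d : ℕ) : ∃ C : ℝ, 0 < C ∧ ∀ {ι : Type*} {I : Finset ι} {n : ι → ℤ} {c : ι → Rd d}
    {Q : ι → Set (Rd d)} {b : ι → Rd d → ℝ}, Fam I n c Q b → ∀ ρ : ℝ, 0 < ρ →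
    (∀ i ∈ I, 2 ^ n i ≤ ρ) →
    Integrable (fun ξ => ‖ft (fun x => ∑ i ∈ I, b i x) ξ‖ ^ 2 / (1 + ρ * ‖ξ‖) ^ (4 * d)) ∧
    ∫ ξ, ‖ft (fun x => ∑ i ∈ I, b i x) ξ‖ ^ 2 / (1 + ρ * ‖ξ‖) ^ (4 * d) ≤ C * famV d n I := by
  refine ⟨(4 * Real.pi ^ 2) ^ (2 * d) * Real.exp (2 * d ^ 2), by positivity, ?_⟩
  intro ι I n c Q b h ρ hρ0 hρ
  set B : Rd d → ℝ := fun x => ∑ i ∈ I, b i x with hB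
  have hBn : Nice B := h.nice_sum
  have hGB : Nice (cv (lapG ρ) B) := cv_nice (lapG_integrable hρ0) hBn
  obtain ⟨p1, p2⟩ := plancherel hGB
  have hpt : ∀ ξ : Rd d, ‖ft B ξ‖ ^ 2 / (1 + ρ * ‖ξ‖) ^ (4 * d) ≤
      (4 * Real.pi ^ 2) ^ (2 * d) * ‖ft (cv (lapG ρ) B) ξ‖ ^ 2 := by
    intro ξ
    rw [ft_cv (lapG_integrable hρ0) hBn.int, norm_mul, mul_pow (‖ft (lapG ρ) ξ‖), ← mul_assoc,
      div_eq_inv_mul]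
    gcongr
    have h1 := norm_ft_lapG_ge hρ0 ξ
    have h3 : 0 < 1 + ρ * ‖ξ‖ := by positivity
    rw [zpow_neg, zpow_natCast] at h1
    calc ((1 + ρ * ‖ξ‖) ^ (4 * d))⁻¹ = (4 * Real.pi ^ 2) ^ (2 * d) *
          (((4 * Real.pi ^ 2 * (1 + ρ * ‖ξ‖) ^ 2) ^ d)⁻¹) ^ 2 := by
          have hpi : (4 * Real.pi ^ 2) ≠ 0 := by positivity
          generalize 4 * Real.pi ^ 2 = w at hpi
          have e1 : w ^ (2 * d) = (w ^ d) ^ 2 := by rw [← pow_mul, mul_comm]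
          have e2 : (1 + ρ * ‖ξ‖) ^ (4 * d) = (((1 + ρ * ‖ξ‖) ^ 2) ^ d) ^ 2 := by
            rw [← pow_mul, ← pow_mul]; congr 1; ring
          rw [e1, e2, mul_pow]
          have hw : w ^ d ≠ 0 := pow_ne_zero _ hpi
          field_simp
      _ ≤ _ := by gcongr
  have hm : Continuous (fun ξ => ‖ft B ξ‖ ^ 2 / (1 + ρ * ‖ξ‖) ^ (4 * d)) := by
    have := ft_continuous hBn.int
    refine Continuous.div (by fun_prop) (by fun_prop) fun ξ => ?_
    positivity
  have h_int : Integrable (fun ξ => ‖ft B ξ‖ ^ 2 / (1 + ρ * ‖ξ‖) ^ (4 * d)) := by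
    refine (p1.const_mul ((4 * Real.pi ^ 2) ^ (2 * d))).mono' hm.aestronglyMeasurable
      (.of_forall fun ξ => ?_)
    rw [Real.norm_of_nonneg (by positivity)]; exact hpt ξ
  refine ⟨h_int, ?_⟩
  calc _ ≤ ∫ ξ, (4 * Real.pi ^ 2) ^ (2 * d) * ‖ft (cv (lapG ρ) B) ξ‖ ^ 2 :=
        integral_mono h_int (p1.const_mul _) hpt
    _ = (4 * Real.pi ^ 2) ^ (2 * d) * ∫ x, cv (lapG ρ) B x ^ 2 := by
        rw [integral_const_mul, p2]
    _ ≤ (4 * Real.pi ^ 2) ^ (2 * d) * ∫ x, Real.exp (2 * d ^ 2) * |cv (lapG ρ) B x| := by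
        refine mul_le_mul_of_nonneg_left ?_ (by positivity)
        refine integral_mono hGB.sq.int (hGB.abs.int.const_mul _) fun x => ?_
        simp only
        rw [← sq_abs, pow_two]
        gcongr
        have hle := h.sum_lapG_le hρ hρ0 x
        refine le_trans ?_ hle
        rw [hB, cv_sum_right (lapG_integrable hρ0) fun i hi => h.nice i hi]
        refine (Finset.abs_sum_le_sum_abs _ _).trans (Finset.sum_le_sum fun i hi => ?_)
        refine (abs_cv_le _ _ x).trans (le_of_eq ?_)
        congr 1
        ext y; exact abs_of_pos (lapG_pos hρ0 y)
    _ ≤ (4 * Real.pi ^ 2) ^ (2 * d) * (Real.exp (2 * d ^ 2) * (1 * famV d n I)) := by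
        rw [integral_const_mul]
        gcongr
        refine (integral_abs_cv_le (lapG_integrable hρ0) hBn.int).trans ?_
        rw [integral_abs_lapG hρ0]
        gcongr
        exact h.integral_abs_sum_le
    _ = _ := by ring

end Family

section TubeOverlap

variable {d : ℕ} {e : Rd d}

theorem tube_add {x y : Rd d} {a ρ a' ρ' : ℝ} (hx : x ∈ tube e a ρ) (hy : y ∈ tube e a' ρ') :
    x + y ∈ tube e (a + a') (ρ + ρ') := by
  refine ⟨?_, ?_⟩
  · rw [inner_add_right]; exact (abs_add_le _ _).trans (add_le_add hx.1 hy.1)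
  · rw [inner_add_right, add_smul, add_sub_add_comm]
    exact (norm_add_le _ _).trans (add_le_add hx.2 hy.2)

theorem tube_neg {x : Rd d} {a ρ : ℝ} (hx : x ∈ tube e a ρ) : -x ∈ tube e a ρ := by
  refine ⟨?_, ?_⟩
  · rw [inner_neg_right, abs_neg]; exact hx.1
  · rw [inner_neg_right, neg_smul, neg_sub_neg, norm_sub_rev]; exact hx.2

theorem tube_mono {a ρ a' ρ' : ℝ} (ha : a ≤ a') (hρ : ρ ≤ ρ') : tube e a ρ ⊆ tube e a' ρ' :=
  fun _ hx => ⟨hx.1.trans ha, hx.2.trans hρ⟩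

theorem ball_sub_tube (he : ‖e‖ = 1) {x : Rd d} {ρ : ℝ} (hx : ‖x‖ ≤ ρ) : x ∈ tube e ρ ρ := by
  refine ⟨(abs_real_inner_le_norm _ _).trans (by rw [he, one_mul]; exact hx), ?_⟩
  have := norm_sub_inner_smul_le he x 0
  rw [zero_smul, sub_zero] at this
  exact this.trans hx

theorem volume_tube_real_le (hd : 2 ≤ d) (he : ‖e‖ = 1) {a ρ : ℝ} (ha : 0 ≤ a) (hρ : 0 ≤ ρ)
    (c : Rd d) : volume ((fun x => x - c) ⁻¹' tube e a ρ) ≤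
      ENNReal.ofReal ((2 * a) * (2 * ρ) ^ (d - 1)) := by
  simp_rw [sub_eq_add_neg]
  rw [measure_preimage_add_right]
  exact volume_tube_le hd he ha hρ

variable {ι : Type*} {I : Finset ι} {n : ι → ℤ} {c : ι → Rd d} {Q : ι → Set (Rd d)}
  {b : ι → Rd d → ℝ}

theorem tube_const_eq (hd : 2 ≤ d) (A R r : ℝ) :
    (2 * (A * R)) * (2 * (A * (r * R))) ^ (d - 1) = (2 * A) ^ d * r ^ (d - 1) * R ^ d := by
  obtain ⟨m, rfl⟩ : ∃ m, d = m + 1 := ⟨d - 1, by omega⟩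
  rw [Nat.add_sub_cancel]
  rw [show 2 * (A * (r * R)) = (2 * A) * r * R by ring, mul_pow, mul_pow _ r]
  ring

theorem Fam.tube_overlap (hd : 2 ≤ d) (h : Fam I n c Q b) (he : ‖e‖ = 1) {A : ℝ}
    (hA : d ≤ A) {r : ℝ} (hr : 0 ≤ r) (hr1 : r ≤ 1) {s : ℕ} (hs : 1 ≤ r * 2 ^ s) :
    Integrable (fun x => (∑ i ∈ I, ((fun x => x - c i) ⁻¹'
      tube e (A * 2 ^ (n i + s)) (A * (r * 2 ^ (n i + s)))).indicator (fun _ => (1 : ℝ)) x) ^ 2) ∧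
    ∫ x, (∑ i ∈ I, ((fun x => x - c i) ⁻¹'
      tube e (A * 2 ^ (n i + s)) (A * (r * 2 ^ (n i + s)))).indicator (fun _ => (1 : ℝ)) x) ^ 2 ≤
    2 * (2 * A) ^ d * (6 * A) ^ d * (r ^ (d - 1)) ^ 2 * ((2 ^ s) ^ d) ^ 2 * famV d n I := by
  have hA0 : 0 ≤ A := le_trans (by positivity) hA
  set S : ι → Set (Rd d) := fun i => (fun x => x - c i) ⁻¹'
      tube e (A * 2 ^ (n i + s)) (A * (r * 2 ^ (n i + s))) with hS
  have hSm : ∀ i, MeasurableSet (S i) := fun i => by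
    exact (measurable_id.sub_const (c i)) (tube_measurable _ _ _)
  have hz : ∀ i, (2 : ℝ) ^ (n i + s) = 2 ^ n i * 2 ^ s := fun i => by
    rw [zpow_add₀ two_ne_zero, zpow_natCast]
  set K : ℝ := (2 * A) ^ d * r ^ (d - 1) * (2 ^ s) ^ d with hK
  have hK0 : 0 ≤ K := by positivity
  have hSv : ∀ i, volume (S i) ≤ ENNReal.ofReal (K * (2 ^ n i) ^ d) := fun i => by
    refine (volume_tube_real_le hd he (by positivity) (by positivity) (c i)).trans
      (ENNReal.ofReal_le_ofReal (le_of_eq ?_))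
    rw [tube_const_eq hd, hz, mul_pow, hK]; ring
  have hSf : ∀ i, volume (S i) ≠ ∞ := fun i => ((hSv i).trans_lt ENNReal.ofReal_lt_top).ne
  have hSr : ∀ i, volume.real (S i) ≤ K * (2 ^ n i) ^ d := fun i =>
    ENNReal.toReal_le_of_le_ofReal (by positivity) (hSv i)
  have hQf : ∀ i ∈ I, volume.real (Q i) = (2 ^ n i) ^ d := fun i hi => by
    rw [Measure.real, h.vol i hi, ENNReal.toReal_ofReal (by positivity)]
  have h_int : ∀ i i', Integrable (fun x => (S i ∩ S i').indicator (fun _ => (1 : ℝ)) x) := by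
    intro i i'
    refine (integrable_indicator_iff ((hSm i).inter (hSm i'))).2 ?_
    refine integrableOn_const (ne_top_of_le_ne_top (hSf i) (measure_mono inter_subset_left))
  have hexp : (fun x => (∑ i ∈ I, (S i).indicator (fun _ => (1 : ℝ)) x) ^ 2) =
      fun x => ∑ i ∈ I, ∑ i' ∈ I, (S i ∩ S i').indicator (fun _ => (1 : ℝ)) x := by
    ext x
    rw [pow_two, Finset.sum_mul_sum]
    refine Finset.sum_congr rfl fun i _ => Finset.sum_congr rfl fun i' _ => ?_
    by_cases h1 : x ∈ S i <;> by_cases h2 : x ∈ S i' <;> simp [h1, h2]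
  have hexpI : Integrable (fun x => (∑ i ∈ I, (S i).indicator (fun _ => (1 : ℝ)) x) ^ 2) := by
    rw [hexp]
    exact integrable_finsetSum _ fun i _ => integrable_finsetSum _ fun i' _ => h_int i i'
  refine ⟨hexpI, ?_⟩
  rw [hexp, integral_finsetSum _ fun i _ => integrable_finsetSum _ fun i' _ => h_int i i']
  have e1 : ∀ i ∈ I, ∫ x, ∑ i' ∈ I, (S i ∩ S i').indicator (fun _ => (1 : ℝ)) x =
      ∑ i' ∈ I, volume.real (S i ∩ S i') := fun i _ => by
    rw [integral_finsetSum _ fun i' _ => h_int i i']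
    refine Finset.sum_congr rfl fun i' _ => ?_
    rw [integral_indicator ((hSm i).inter (hSm i')), setIntegral_const, smul_eq_mul, mul_one]
  rw [Finset.sum_congr rfl e1]
  have inner_le : ∀ i ∈ I, ∑ i' ∈ I with n i' ≤ n i, volume.real (S i ∩ S i') ≤
      K * ((6 * A) ^ d * r ^ (d - 1) * (2 ^ s) ^ d * (2 ^ n i) ^ d) := by
    intro i hi
    set T := (fun x => x - c i) ⁻¹' tube e (3 * A * 2 ^ (n i + s)) (3 * A * (r * 2 ^ (n i + s)))
      with hT
    have hTv : volume T ≤ ENNReal.ofReal ((6 * A) ^ d * r ^ (d - 1) * (2 ^ s) ^ d * (2 ^ n i) ^ d) := by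
      refine (volume_tube_real_le hd he (by positivity) (by positivity) (c i)).trans
        (ENNReal.ofReal_le_ofReal (le_of_eq ?_))
      rw [tube_const_eq hd, hz, show 2 * (3 * A) = 6 * A by ring, mul_pow (2 ^ n i)]; ring
    classical
    set J := I.filter (fun i' => n i' ≤ n i ∧ (S i ∩ S i').Nonempty) with hJ
    have hJI : ∀ i' ∈ J, i' ∈ I := fun i' hi' => (Finset.mem_filter.1 hi').1
    have hsub : ∀ i' ∈ J, Q i' ⊆ T := by
      intro i' hi' y hy
      obtain ⟨hI', hn, x, hx1, hx2⟩ := Finset.mem_filter.1 hi'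
      have hp : (2 : ℝ) ^ (n i' + s) ≤ 2 ^ (n i + s) :=
        zpow_le_zpow_right₀ one_le_two (by omega)
      have hp0 : (0 : ℝ) < 2 ^ (n i + s) := by positivity
      have hpn : (2 : ℝ) ^ n i' ≤ r * 2 ^ (n i + s) := by
        calc (2 : ℝ) ^ n i' = 2 ^ n i' * 1 := (mul_one _).symm
          _ ≤ 2 ^ n i * (r * 2 ^ s) := by
              gcongr; exact one_le_two
          _ = _ := by rw [hz]; ring
      have hb := h.ball i' hI' y hy
      have hb' : ‖y - c i'‖ ≤ A * (r * 2 ^ (n i + s)) := hb.trans (by gcongr)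
      have h3 : y - c i' ∈ tube e (A * 2 ^ (n i + s)) (A * (r * 2 ^ (n i + s))) := by
        refine tube_mono ?_ le_rfl (ball_sub_tube he hb')
        gcongr
        exact mul_le_of_le_one_left hp0.le hr1
      have h2 : x - c i' ∈ tube e (A * 2 ^ (n i + s)) (A * (r * 2 ^ (n i + s))) :=
        tube_mono (by gcongr) (by gcongr) hx2
      have := tube_add (tube_add hx1 (tube_neg h2)) h3
      have e2 : x - c i + -(x - c i') + (y - c i') = y - c i := by abel
      rw [e2] at this
      show y - c i ∈ tube e (3 * A * 2 ^ (n i + s)) (3 * A * (r * 2 ^ (n i + s)))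
      exact tube_mono (by linarith) (by linarith) this
    calc ∑ i' ∈ I with n i' ≤ n i, volume.real (S i ∩ S i')
        = ∑ i' ∈ J, volume.real (S i ∩ S i') := by
          symm
          refine Finset.sum_subset ?_ ?_
          · intro i' hi'
            have := Finset.mem_filter.1 hi'
            exact Finset.mem_filter.2 ⟨this.1, this.2.1⟩
          · intro i' hi' hn
            have := Finset.mem_filter.1 hi'
            have : ¬ (S i ∩ S i').Nonempty := fun hne =>
              hn (Finset.mem_filter.2 ⟨this.1, this.2, hne⟩)
            rw [not_nonempty_iff_eq_empty.1 this]; simp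
      _ ≤ ∑ i' ∈ J, K * volume.real (Q i') := by
          refine Finset.sum_le_sum fun i' hi' => ?_
          rw [hQf i' (hJI i' hi')]
          exact (measureReal_mono inter_subset_right (hSf i')).trans (hSr i')
      _ = K * volume.real (⋃ i' ∈ J, Q i') := by
          rw [← Finset.mul_sum, measureReal_biUnion_finset
            (fun i hi j hj hij => h.disj i (hJI i hi) j (hJI j hj) hij)
            (fun i hi => h.meas i (hJI i hi))
            (fun i hi => by rw [h.vol i (hJI i hi)]; exact ENNReal.ofReal_ne_top)]
      _ ≤ _ := by
          gcongr
          refine ENNReal.toReal_le_of_le_ofReal (by positivity) (le_trans ?_ hTv)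
          exact measure_mono (iUnion₂_subset hsub)
  calc ∑ i ∈ I, ∑ i' ∈ I, volume.real (S i ∩ S i')
      ≤ ∑ i ∈ I, ∑ i' ∈ I, ((if n i' ≤ n i then volume.real (S i ∩ S i') else 0) +
          (if n i ≤ n i' then volume.real (S i ∩ S i') else 0)) := by
        refine Finset.sum_le_sum fun i _ => Finset.sum_le_sum fun i' _ => ?_
        have : 0 ≤ volume.real (S i ∩ S i') := measureReal_nonneg
        rcases le_total (n i) (n i') with h1 | h1
        · simp only [h1, if_true]; split_ifs <;> linarith
        · simp only [h1, if_true]; split_ifs <;> linarith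
    _ = (∑ i ∈ I, ∑ i' ∈ I, (if n i' ≤ n i then volume.real (S i ∩ S i') else 0)) +
        ∑ i ∈ I, ∑ i' ∈ I, (if n i' ≤ n i then volume.real (S i ∩ S i') else 0) := by
        simp_rw [Finset.sum_add_distrib]
        congr 1
        rw [Finset.sum_comm]
        simp_rw [inter_comm]
    _ ≤ (∑ i ∈ I, K * ((6 * A) ^ d * r ^ (d - 1) * (2 ^ s) ^ d * (2 ^ n i) ^ d)) +
        ∑ i ∈ I, K * ((6 * A) ^ d * r ^ (d - 1) * (2 ^ s) ^ d * (2 ^ n i) ^ d) := by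
        have := Finset.sum_le_sum inner_le
        simp_rw [Finset.sum_filter] at this
        exact add_le_add this this
    _ = _ := by
        rw [famV, ← Finset.mul_sum, ← Finset.mul_sum, hK]; ring

end TubeOverlap

section AngularPieces

variable {d : ℕ} {ι : Type*} {I : Finset ι} {n : ι → ℤ} {c : ι → Rd d} {Q : ι → Set (Rd d)}
  {b : ι → Rd d → ℝ} {Ω : Rd d → ℝ}

theorem sphere_integrable_of_bdd (hΩ : Measurable Ω) {M : ℝ} (h1 : ∀ x, |Ω x| ≤ M) :
    Integrable (fun θ : sphere (0 : Rd d) 1 => Ω θ) (sphereMeasure d) :=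
  Integrable.of_bound (C := M) (hΩ.comp measurable_subtype_coe).aestronglyMeasurable
    (.of_forall fun θ => h1 θ)

theorem KK_Onu_tube {u : ℕ} {z : Fin d → ℤ} (hz : z ∈ netS d u) {j : ℤ} {x : Rd d}
    (hx : KK (Onu u z Ω) j x ≠ 0) :
    x ∈ tube (netPt d u z) (2 * 2 ^ j) (2 * d * (2 ^ (-(u : ℤ)) * 2 ^ j)) := by
  have hx0 : x ≠ 0 := by
    rintro rfl
    exact hx (KK_eq_zero_of_le (by rw [norm_zero]; positivity))
  have hn : 0 < ‖x‖ := norm_pos_iff.2 hx0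
  have h2 : ‖x‖ ≤ 2 * 2 ^ j := by
    by_contra hc
    exact hx (KK_eq_zero_of_ge (not_le.1 hc).le)
  have hO : Onu u z Ω x ≠ 0 := fun h0 => hx (by rw [KK, h0]; ring)
  have h3 := norm_sub_netPt hz (Onu_support hO)
  have he := norm_netPt hz
  refine ⟨(abs_real_inner_le_norm _ _).trans (by rw [he, one_mul]; exact h2), ?_⟩
  refine (norm_sub_inner_smul_le he x ‖x‖).trans ?_
  have e1 : x - ‖x‖ • netPt d u z = ‖x‖ • (‖x‖⁻¹ • x - netPt d u z) := by
    rw [smul_sub, smul_inv_smul₀ hn.ne']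
  rw [e1, norm_smul, norm_norm]
  calc ‖x‖ * ‖‖x‖⁻¹ • x - netPt d u z‖ ≤ (2 * 2 ^ j) * (d * 2 ^ (-(u : ℤ))) := by gcongr
    _ = _ := by ring

/-- An atom with its low frequencies (relative to scale `2 ^ m`) removed. -/
def hiAtom (m : ℤ) (b : Rd d → ℝ) (x : Rd d) : ℝ := b x - cv (tent (2 ^ m)) b x

theorem hiAtom_nice {m : ℤ} {b : Rd d → ℝ} (hb : Nice b) : Nice (hiAtom m b) :=
  hb.sub (cv_nice (tent_integrable (by positivity)) hb)

theorem hiAtom_integral_abs {m : ℤ} {b : Rd d → ℝ} (hb : Nice b) :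
    ∫ x, |hiAtom m b x| ≤ 2 * ∫ x, |b x| := by
  have ht := tent_integrable (d := d) (t := 2 ^ m) (by positivity)
  have h1 := integral_abs_cv_le ht hb.int
  rw [integral_abs_tent (by positivity), one_mul] at h1
  calc ∫ x, |hiAtom m b x| ≤ ∫ x, (|b x| + |cv (tent (2 ^ m)) b x|) :=
        integral_mono (hiAtom_nice hb).int.abs (hb.int.abs.add (cv_integrable ht hb.int).abs)
          fun x => abs_sub _ _
    _ = (∫ x, |b x|) + ∫ x, |cv (tent (2 ^ m)) b x| :=
        integral_add hb.int.abs (cv_integrable ht hb.int).abs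
    _ ≤ _ := by linarith

theorem ft_hiAtom {m : ℤ} {b : Rd d → ℝ} (hb : Nice b) (ξ : Rd d) :
    ft (hiAtom m b) ξ = (1 - ft (tent (2 ^ m)) ξ) * ft b ξ := by
  have ht := tent_integrable (d := d) (t := 2 ^ m) (by positivity)
  have := ft_sub hb.int (cv_integrable ht hb.int) ξ
  rw [ft_cv ht hb.int] at this
  rw [show hiAtom m b = fun x => b x - cv (tent (2 ^ m)) b x from rfl, this]; ring

theorem hiAtom_supp {m : ℤ} {b : Rd d → ℝ} {c : Rd d} {ρ : ℝ}
    (hs : ∀ x, ρ < ‖x - c‖ → b x = 0) {x : Rd d} (hx : ρ + 2 ^ m < ‖x - c‖) :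
    hiAtom m b x = 0 := by
  have h2 : (0 : ℝ) < 2 ^ m := by positivity
  rw [hiAtom, hs x (by linarith), cv, integral_eq_zero_of_ae, sub_zero]
  refine .of_forall fun y => ?_
  by_cases hy : ρ < ‖y - c‖
  · simp [hs y hy]
  · have : tent (2 ^ m) (x - y) = 0 := by
      refine tent_eq_zero h2 ?_
      have : ‖x - c‖ ≤ ‖x - y‖ + ‖y - c‖ := by
        rw [← sub_add_sub_cancel x y c]; exact norm_add_le _ _
      linarith
    simp [this]

theorem abs_cv_piece_le (hd : 2 ≤ d) (h : Fam I n c Q b) (hΩ : Measurable Ω)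
    (hom : Homogeneous0 d Ω) (h1 : ∀ x, |Ω x| ≤ 1) {s u : ℕ} (hus : 4 * u ≤ s)
    {z : Fin d → ℤ} (hz : z ∈ netS d u) {i : ι} (hi : i ∈ I) (x : Rd d) :
    |cv (KK (Onu u z Ω) (n i + s)) (hiAtom (n i + s - 2 * u) (b i)) x| ≤
      2 ^ (d + 1) * ((2 ^ s) ^ d)⁻¹ * ((fun x => x - c i) ⁻¹' tube (netPt d u z)
        (4 * d * 2 ^ (n i + s)) (4 * d * (2 ^ (-(u : ℤ)) * 2 ^ (n i + s)))).indicator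
          (fun _ => (1 : ℝ)) x := by
  have hd' : (2 : ℝ) ≤ d := by exact_mod_cast hd
  set S := (fun x => x - c i) ⁻¹' tube (netPt d u z)
        (4 * d * 2 ^ (n i + s)) (4 * d * (2 ^ (-(u : ℤ)) * 2 ^ (n i + s)))
  set R : ℝ := 2 ^ (n i + s) with hR
  set r : ℝ := 2 ^ (-(u : ℤ)) with hr
  have hR0 : 0 < R := by positivity
  have hr0 : 0 < r := by positivity
  have hr1 : r ≤ 1 := zpow_le_one_of_nonpos₀ one_le_two (by omega)
  set f := hiAtom (n i + s - 2 * u) (b i) with hf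
  have hfn : Nice f := hiAtom_nice (h.nice i hi)
  have h2n : (2 : ℝ) ^ n i ≤ r * R := by
    rw [hr, hR, ← zpow_add₀ two_ne_zero]
    exact zpow_le_zpow_right₀ one_le_two (by omega)
  have h2m : (2 : ℝ) ^ (n i + s - 2 * u) ≤ r * R := by
    rw [hr, hR, ← zpow_add₀ two_ne_zero]
    exact zpow_le_zpow_right₀ one_le_two (by omega)
  have hfs : ∀ y, f y ≠ 0 → ‖y - c i‖ ≤ (d + 1) * (r * R) := by
    intro y hy
    by_contra hc
    refine hy (hiAtom_supp (fun x hx => h.supp' hi hx) (lt_of_le_of_lt ?_ (not_le.1 hc)))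
    have : (d : ℝ) * 2 ^ n i ≤ d * (r * R) := by gcongr
    linarith
  by_cases hx : x ∈ S
  · rw [indicator_of_mem hx, mul_one]
    have e1 := abs_cv_le (KK (Onu u z Ω) (n i + s)) f x
    refine e1.trans ?_
    have hi' := sphere_integrable_of_bdd (Onu_measurable (u := u) (z := z) hΩ)
      (fun x => (abs_Onu_le x).trans (h1 x))
    have hKi := KK_integrable hd (Onu_measurable (u := u) (z := z) hΩ) (Onu_hom hom) hi' (n i + s)
    calc cv (fun y => |KK (Onu u z Ω) (n i + s) y|) (fun y => |f y|) x
        ≤ ∫ y, (2 ^ d * (R ^ d)⁻¹) * |f y| := by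
          refine integral_mono (cv_integrand hKi.abs hfn.abs x) (hfn.int.abs.const_mul _) ?_
          intro y
          simp only
          gcongr
          refine (abs_KK_le _ _).trans ?_
          refine mul_le_of_le_one_left (by positivity) ((abs_Onu_le _).trans (h1 _))
      _ = (2 ^ d * (R ^ d)⁻¹) * ∫ y, |f y| := integral_const_mul _ _
      _ ≤ (2 ^ d * (R ^ d)⁻¹) * (2 * (2 ^ n i) ^ d) := by
          gcongr
          exact (hiAtom_integral_abs (h.nice i hi)).trans (by
            have := h.lone i hi; linarith)
      _ = _ := by
          rw [hR, zpow_add₀ two_ne_zero, mul_pow, zpow_natCast]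
          field_simp
          ring
  · rw [indicator_of_notMem hx, mul_zero, cv, integral_eq_zero_of_ae, abs_zero]
    refine .of_forall fun y => ?_
    show KK (Onu u z Ω) (n i + s) (x - y) * f y = 0
    by_contra hne
    have hk := KK_Onu_tube hz (left_ne_zero_of_mul hne)
    have hy := hfs y (right_ne_zero_of_mul hne)
    have ht := tube_add hk (ball_sub_tube (norm_netPt hz) hy)
    rw [sub_add_sub_cancel] at ht
    refine hx (tube_mono ?_ ?_ ht)
    · have : (d + 1) * (r * R) ≤ (d + 1) * R := by
        gcongr; exact mul_le_of_le_one_left hR0.le hr1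
      have : 2 * R + (d + 1) * R ≤ 4 * d * R := by nlinarith
      linarith
    · have : 0 < r * R := by positivity
      nlinarith

theorem piece_sq_le (hd : 2 ≤ d) (h : Fam I n c Q b) (hΩ : Measurable Ω)
    (hom : Homogeneous0 d Ω) (h1 : ∀ x, |Ω x| ≤ 1) {s u : ℕ} (hus : 4 * u ≤ s)
    {z : Fin d → ℤ} (hz : z ∈ netS d u) :
    ∫ x, (∑ i ∈ I, cv (KK (Onu u z Ω) (n i + s)) (hiAtom (n i + s - 2 * u) (b i)) x) ^ 2 ≤
      (2 ^ (d + 1)) ^ 2 * (2 * (8 * d) ^ d * (24 * d) ^ d) * ((2 ^ (-(u : ℤ))) ^ (d - 1)) ^ 2 *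
        famV d n I := by
  have hd' : (2 : ℝ) ≤ d := by exact_mod_cast hd
  have hr1 : (2 : ℝ) ^ (-(u : ℤ)) ≤ 1 := zpow_le_one_of_nonpos₀ one_le_two (by omega)
  obtain ⟨t1, t2⟩ := h.tube_overlap hd (norm_netPt hz) (A := 4 * d) (by linarith)
    (r := 2 ^ (-(u : ℤ))) (by positivity) hr1 (s := s) (by
      rw [← zpow_natCast, ← zpow_add₀ two_ne_zero]; exact one_le_zpow₀ one_le_two (by omega))
  have h0 : ∀ x, (∑ i ∈ I, cv (KK (Onu u z Ω) (n i + s)) (hiAtom (n i + s - 2 * u) (b i)) x) ^ 2 ≤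
      (2 ^ (d + 1) * ((2 ^ s) ^ d)⁻¹) ^ 2 * (∑ i ∈ I, ((fun x => x - c i) ⁻¹' tube (netPt d u z)
        (4 * d * 2 ^ (n i + s)) (4 * d * (2 ^ (-(u : ℤ)) * 2 ^ (n i + s)))).indicator
          (fun _ => (1 : ℝ)) x) ^ 2 := by
    intro x
    rw [← mul_pow, ← sq_abs]
    refine pow_le_pow_left₀ (abs_nonneg _) ?_ 2
    rw [Finset.mul_sum]
    exact (Finset.abs_sum_le_sum_abs _ _).trans
      (Finset.sum_le_sum fun i hi => abs_cv_piece_le hd h hΩ hom h1 hus hz hi x)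
  have hi' := sphere_integrable_of_bdd (Onu_measurable (u := u) (z := z) hΩ)
      (fun x => (abs_Onu_le x).trans (h1 x))
  refine (integral_mono_of_nonneg (.of_forall fun x => sq_nonneg _) (t1.const_mul _)
    (.of_forall h0)).trans ?_
  rw [integral_const_mul]
  refine (mul_le_mul_of_nonneg_left t2 (by positivity)).trans (le_of_eq ?_)
  have : ((2 : ℝ) ^ s) ^ d ≠ 0 := by positivity
  generalize ((2 : ℝ) ^ s) ^ d = w at *
  rw [show (2 : ℝ) * (4 * d) = 8 * d by ring, show (6 : ℝ) * (4 * d) = 24 * d by ring]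
  field_simp

end AngularPieces

section OffBand

variable {d : ℕ} {ι : Type*} {I : Finset ι} {n : ι → ℤ} {c : ι → Rd d} {Q : ι → Set (Rd d)}
  {b : ι → Rd d → ℝ} {Ω : Rd d → ℝ}

theorem norm_ft_KK_Onu_le (hd : 2 ≤ d) : ∃ C : ℝ, 0 < C ∧ ∀ {Ω : Rd d → ℝ}, Measurable Ω →
    Homogeneous0 d Ω → (∀ x, |Ω x| ≤ 1) → ∀ (u : ℕ) (z : Fin d → ℤ), z ∈ netS d u → ∀ (j : ℤ)
    (ξ : Rd d), 2 * d * 2 ^ (-(u : ℤ)) * ‖ξ‖ < |inner ℝ ξ (netPt d u z)| →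
    ‖ft (KK (Onu u z Ω) j) ξ‖ ≤
      C * (2 ^ (-(u : ℤ))) ^ (d - 1) / (1 + 2 ^ j * (2 ^ (-(u : ℤ)) * ‖ξ‖)) ^ (2 * d + 2) := by
  obtain ⟨C, hC, hh⟩ := hhat_decay (2 * d + 2)
  have hd' : (2 : ℝ) ≤ d := by exact_mod_cast hd
  refine ⟨C * (d * 2 ^ d * d ^ (d - 1)), by positivity, ?_⟩
  intro Ω hΩ hom h1 u z hz j ξ hξ
  set r : ℝ := 2 ^ (-(u : ℤ)) with hr
  have hr0 : 0 < r := by positivity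
  have hi' := sphere_integrable_of_bdd (Onu_measurable (u := u) (z := z) hΩ)
      (fun x => (abs_Onu_le x).trans (h1 x))
  rw [ft_KK hd (Onu_measurable hΩ) (Onu_hom hom) hi']
  set T : Set (sphere (0 : Rd d) 1) := {θ | ‖(θ : Rd d) - netPt d u z‖ ≤ d * r} with hT
  have hTm : MeasurableSet T := measurableSet_le (by fun_prop) (by fun_prop)
  set D := C / (1 + 2 ^ j * (r * ‖ξ‖)) ^ (2 * d + 2) with hD
  have hD0 : 0 ≤ D := by positivity
  have hpt : ∀ θ : sphere (0 : Rd d) 1,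
      ‖(Onu u z Ω θ : ℂ) * hhat (2 ^ j * inner ℝ (θ : Rd d) ξ)‖ ≤ T.indicator (fun _ => D) θ := by
    intro θ
    by_cases h0 : Onu u z Ω θ = 0
    · rw [h0]; simp only [Complex.ofReal_zero, zero_mul, norm_zero]
      exact indicator_nonneg (fun _ _ => hD0) _
    have hs := Onu_support h0
    rw [norm_eq_of_mem_sphere, inv_one, one_smul] at hs
    have h3 := norm_sub_netPt hz hs
    rw [indicator_of_mem (show θ ∈ T from h3), norm_mul, Complex.norm_real, Real.norm_eq_abs]
    refine (mul_le_of_le_one_left (norm_nonneg _) ((abs_Onu_le _).trans (h1 _))).trans ?_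
    refine (hh _).trans ?_
    rw [hD]
    gcongr
    rw [abs_mul, abs_of_pos (by positivity : (0 : ℝ) < 2 ^ j)]
    gcongr
    have e1 : inner ℝ ξ (netPt d u z) = inner ℝ (θ : Rd d) ξ -
        inner ℝ ((θ : Rd d) - netPt d u z) ξ := by
      rw [inner_sub_left, real_inner_comm]; ring
    have e2 : |inner ℝ ((θ : Rd d) - netPt d u z) ξ| ≤ d * r * ‖ξ‖ :=
      (abs_real_inner_le_norm _ _).trans (by gcongr)
    rw [e1] at hξ
    have e3 := abs_sub (inner ℝ (θ : Rd d) ξ) (inner ℝ ((θ : Rd d) - netPt d u z) ξ)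
    have : 0 ≤ r * ‖ξ‖ := by positivity
    nlinarith
  refine (norm_integral_le_of_norm_le ((integrable_const D).indicator hTm)
    (.of_forall hpt)).trans ?_
  rw [integral_indicator hTm, setIntegral_const, smul_eq_mul]
  have hcap := cap_measure hd (norm_netPt hz) (ρ := d * r) (by positivity)
  have : (sphereMeasure d).real T ≤ d * 2 ^ d * (d * r) ^ (d - 1) :=
    ENNReal.toReal_le_of_le_ofReal (by positivity) hcap
  calc _ ≤ d * 2 ^ d * (d * r) ^ (d - 1) * D := by gcongr
    _ = _ := by rw [hD, mul_pow (d : ℝ) r]; ring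

theorem sq_div_le_min {z : ℝ} (hz : 0 < z) : (z / (1 + z) ^ 2) ^ 2 ≤ min z (1 / z) := by
  have h1 : 1 ≤ (1 + z) := by linarith
  rw [div_pow, ← pow_mul]
  have h4 : (1 + z) ^ 4 = 1 + 4 * z + 6 * z ^ 2 + 4 * z ^ 3 + z ^ 4 := by ring
  have p3 : 0 < z ^ 3 := by positivity
  have p4 : 0 < z ^ 4 := by positivity
  have p2 : 0 < z ^ 2 := by positivity
  refine le_min ?_ ?_
  · rw [div_le_iff₀ (by positivity), h4]
    nlinarith [mul_pos hz p2, mul_pos hz p3, mul_pos hz p4]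
  · rw [div_le_div_iff₀ (by positivity) hz, h4]
    nlinarith

theorem ft_sum_image (f : ι → Rd d → ℝ) (hf : ∀ i ∈ I, Integrable (f i)) (w : ℤ → ℂ) (ξ : Rd d) :
    ∑ i ∈ I, w (n i) * ft (f i) ξ =
      ∑ m ∈ I.image n, w m * ft (fun x => ∑ i ∈ I with n i = m, f i x) ξ := by
  rw [← Finset.sum_fiberwise_of_maps_to (fun i hi => Finset.mem_image_of_mem n hi)]
  refine Finset.sum_congr rfl fun m _ => ?_
  rw [ft_sum fun i hi => hf i (Finset.mem_filter.1 hi).1, Finset.mul_sum]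
  refine Finset.sum_congr rfl fun i hi => ?_
  rw [(Finset.mem_filter.1 hi).2]

theorem off_band_sq_le (hd : 2 ≤ d) : ∃ C : ℝ, 0 < C ∧ ∀ {Ω : Rd d → ℝ}, Measurable Ω →
    Homogeneous0 d Ω → (∀ x, |Ω x| ≤ 1) → ∀ {ι : Type*} {I : Finset ι} {n : ι → ℤ} {c : ι → Rd d}
    {Q : ι → Set (Rd d)} {b : ι → Rd d → ℝ}, Fam I n c Q b →
    ∀ (s u : ℕ) (z : Fin d → ℤ), z ∈ netS d u → ∀ ξ : Rd d,
      2 * d * 2 ^ (-(u : ℤ)) * ‖ξ‖ < |inner ℝ ξ (netPt d u z)| →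
    ‖ft (fun x => ∑ i ∈ I, cv (KK (Onu u z Ω) (n i + s)) (hiAtom (n i + s - 2 * u) (b i)) x) ξ‖ ^ 2
      ≤ C * ((2 ^ (-(u : ℤ))) ^ d) ^ 2 * ∑ m ∈ I.image n,
        ‖ft (fun x => ∑ i ∈ I with n i = m, b i x) ξ‖ ^ 2 /
          (1 + 2 ^ (m + s - u) * ‖ξ‖) ^ (4 * d) := by
  obtain ⟨C, hC, hK⟩ := norm_ft_KK_Onu_le hd
  refine ⟨8 * (C * (2 * Real.pi)) ^ 2, by positivity, ?_⟩
  intro Ω hΩ hom h1 ι I n c Q b h s u z hz ξ hξ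
  have hξ0 : 0 < ‖ξ‖ := by
    rcases (norm_nonneg ξ).eq_or_lt with h0 | h0
    · rw [norm_eq_zero.1 h0.symm] at hξ; simp at hξ
    · exact h0
  set r : ℝ := 2 ^ (-(u : ℤ)) with hr
  have hr0 : 0 < r := by positivity
  have hi' := sphere_integrable_of_bdd (Onu_measurable (u := u) (z := z) hΩ)
      (fun x => (abs_Onu_le x).trans (h1 x))
  have hKi := KK_integrable hd (Onu_measurable (u := u) (z := z) hΩ) (Onu_hom hom) hi'
  have hfn : ∀ i ∈ I, Nice (hiAtom (n i + s - 2 * u) (b i)) := fun i hi => hiAtom_nice (h.nice i hi)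
  rw [ft_sum fun i hi => cv_integrable (hKi _) (hfn i hi).int]
  set w : ℤ → ℂ := fun m => ft (KK (Onu u z Ω) (m + s)) ξ * (1 - ft (tent (2 ^ (m + s - 2 * u))) ξ)
    with hw
  have e1 : ∑ i ∈ I, ft (cv (KK (Onu u z Ω) (n i + s)) (hiAtom (n i + s - 2 * u) (b i))) ξ =
      ∑ i ∈ I, w (n i) * ft (b i) ξ := Finset.sum_congr rfl fun i hi => by
    rw [ft_cv (hKi _) (hfn i hi).int, ft_hiAtom (h.nice i hi), hw]; ring
  rw [e1, ft_sum_image b (fun i hi => (h.nice i hi).int)]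
  set Z : ℤ → ℝ := fun m => 2 ^ m * (2 ^ s * (r * ‖ξ‖)) with hZ
  have hZ0 : ∀ m, 0 < Z m := fun m => by positivity
  have hZe : ∀ m : ℤ, (2 : ℝ) ^ (m + s - u) * ‖ξ‖ = Z m := fun m => by
    rw [hZ, sub_eq_add_neg, zpow_add₀ two_ne_zero, zpow_add₀ two_ne_zero, zpow_natCast]; ring
  have hwb : ∀ m, ‖w m‖ ≤ C * (2 * Real.pi) * r ^ d * (Z m / (1 + Z m) ^ 2) *
      (1 / (1 + Z m) ^ (2 * d)) := by
    intro m
    have a1 := hK hΩ hom h1 u z hz (m + s) ξ hξ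
    have a2 := norm_one_sub_ft_tent_le (d := d) (t := 2 ^ (m + s - 2 * u)) (by positivity) ξ
    have b1 : (2 : ℝ) ^ (m + s) * (2 ^ (-(u : ℤ)) * ‖ξ‖) = Z m := by
      rw [hZ, zpow_add₀ two_ne_zero, zpow_natCast]; ring
    have b2 : 2 * Real.pi * 2 ^ (m + s - 2 * u) * ‖ξ‖ = 2 * Real.pi * r * Z m := by
      rw [← b1, hr, show m + s - 2 * u = (-(u : ℤ)) + (-(u : ℤ)) + (m + s) by ring,
        zpow_add₀ two_ne_zero, zpow_add₀ two_ne_zero]; ring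
    rw [b1] at a1
    rw [b2] at a2
    rw [hw, norm_mul]
    refine (mul_le_mul a1 a2 (norm_nonneg _) ?_).trans (le_of_eq ?_)
    · have := hZ0 m; positivity
    · have := hZ0 m
      have e : r ^ d = r ^ (d - 1) * r := by rw [← pow_succ]; congr 1; omega
      rw [e, pow_add (1 + Z m)]
      field_simp
      rw [hr]
  set β : ℤ → ℝ := fun m => ‖ft (fun x => ∑ i ∈ I with n i = m, b i x) ξ‖ with hβ
  calc _ ≤ (∑ m ∈ I.image n, (C * (2 * Real.pi) * r ^ d) *
          ((Z m / (1 + Z m) ^ 2) * (β m / (1 + Z m) ^ (2 * d)))) ^ 2 := by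
        refine pow_le_pow_left₀ (norm_nonneg _) ((norm_sum_le _ _).trans ?_) 2
        refine Finset.sum_le_sum fun m _ => ?_
        rw [norm_mul]
        refine (mul_le_mul_of_nonneg_right (hwb m) (norm_nonneg _)).trans (le_of_eq ?_)
        rw [hβ]; ring
    _ = (C * (2 * Real.pi) * r ^ d) ^ 2 *
          (∑ m ∈ I.image n, (Z m / (1 + Z m) ^ 2) * (β m / (1 + Z m) ^ (2 * d))) ^ 2 := by
        rw [← Finset.mul_sum, mul_pow]
    _ ≤ (C * (2 * Real.pi) * r ^ d) ^ 2 * ((∑ m ∈ I.image n, (Z m / (1 + Z m) ^ 2) ^ 2) *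
          ∑ m ∈ I.image n, (β m / (1 + Z m) ^ (2 * d)) ^ 2) := by
        gcongr
        exact Finset.sum_mul_sq_le_sq_mul_sq _ _ _
    _ ≤ (C * (2 * Real.pi) * r ^ d) ^ 2 * (8 *
          ∑ m ∈ I.image n, (β m / (1 + Z m) ^ (2 * d)) ^ 2) := by
        have hp : 0 ≤ ∑ m ∈ I.image n, (β m / (1 + Z m) ^ (2 * d)) ^ 2 :=
          Finset.sum_nonneg fun _ _ => sq_nonneg _
        gcongr
        exact (Finset.sum_le_sum fun m _ => sq_div_le_min (hZ0 m)).trans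
          (geo_sum _ (by positivity))
    _ = _ := by
        simp_rw [hZe, div_pow, ← pow_mul]
        rw [show 2 * d * 2 = 4 * d by ring]
        simp only [hβ]
        ring

end OffBand

section SmoothedSum

variable {d : ℕ} {ι : Type*} {I : Finset ι} {n : ι → ℤ} {c : ι → Rd d} {Q : ι → Set (Rd d)}
  {b : ι → Rd d → ℝ} {Ω : Rd d → ℝ}

theorem norm_sum_sq_le {κ : Type*} (N : Finset κ) (P : κ → Prop) [DecidablePred P] (a : κ → ℂ)
    {M D : ℝ} (hM : ((N.filter P).card : ℝ) ≤ M) (hD : ∀ z ∈ N, ¬ P z → ‖a z‖ ^ 2 ≤ D)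
    (hD0 : 0 ≤ D) :
    ‖∑ z ∈ N, a z‖ ^ 2 ≤ 2 * M * ∑ z ∈ N, ‖a z‖ ^ 2 + 2 * (N.card : ℝ) ^ 2 * D := by
  have cs : ∀ S : Finset κ, ‖∑ z ∈ S, a z‖ ^ 2 ≤ S.card * ∑ z ∈ S, ‖a z‖ ^ 2 := fun S =>
    (pow_le_pow_left₀ (norm_nonneg _) (norm_sum_le _ _) 2).trans sq_sum_le_card_mul_sum_sq
  rw [← Finset.sum_filter_add_sum_filter_not N P a]
  have h1 := cs (N.filter P)
  have h2 := cs (N.filter (fun z => ¬ P z))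
  have h3 : ∑ z ∈ N.filter P, ‖a z‖ ^ 2 ≤ ∑ z ∈ N, ‖a z‖ ^ 2 :=
    Finset.sum_le_sum_of_subset_of_nonneg (Finset.filter_subset _ _) fun _ _ _ => sq_nonneg _
  have h4 : ∑ z ∈ N.filter (fun z => ¬ P z), ‖a z‖ ^ 2 ≤ N.card * D := by
    calc _ ≤ ∑ z ∈ N.filter (fun z => ¬ P z), D := Finset.sum_le_sum fun z hz => by
            obtain ⟨p, q⟩ := Finset.mem_filter.1 hz; exact hD z p q
      _ = ((N.filter (fun z => ¬ P z)).card : ℝ) * D := by rw [Finset.sum_const, nsmul_eq_mul]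
      _ ≤ _ := by gcongr; exact Finset.filter_subset _ _
  have h5 : ((N.filter (fun z => ¬ P z)).card : ℝ) ≤ N.card := by
    gcongr; exact Finset.filter_subset _ _
  have hs : 0 ≤ ∑ z ∈ N, ‖a z‖ ^ 2 := Finset.sum_nonneg fun _ _ => sq_nonneg _
  have hs' : 0 ≤ ∑ z ∈ N.filter (fun z => ¬ P z), ‖a z‖ ^ 2 := Finset.sum_nonneg fun _ _ => sq_nonneg _
  have h6 : ‖∑ z ∈ N.filter P, a z‖ ^ 2 ≤ M * ∑ z ∈ N, ‖a z‖ ^ 2 :=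
    h1.trans (mul_le_mul hM h3 (Finset.sum_nonneg fun _ _ => sq_nonneg _)
      (le_trans (by positivity) hM))
  have h7 : ‖∑ z ∈ N.filter (fun z => ¬ P z), a z‖ ^ 2 ≤ (N.card : ℝ) * (N.card * D) :=
    h2.trans (mul_le_mul h5 h4 hs' (by positivity))
  have h8 : ‖(∑ z ∈ N.filter P, a z) + ∑ z ∈ N.filter (fun z => ¬ P z), a z‖ ^ 2 ≤
      2 * ‖∑ z ∈ N.filter P, a z‖ ^ 2 + 2 * ‖∑ z ∈ N.filter (fun z => ¬ P z), a z‖ ^ 2 := by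
    have := norm_add_le (∑ z ∈ N.filter P, a z) (∑ z ∈ N.filter (fun z => ¬ P z), a z)
    have h9 := pow_le_pow_left₀ (norm_nonneg _) this 2
    nlinarith [sq_nonneg (‖∑ z ∈ N.filter P, a z‖ - ‖∑ z ∈ N.filter (fun z => ¬ P z), a z‖)]
  nlinarith

theorem KK_sum_Onu (u : ℕ) (j : ℤ) (x : Rd d) :
    ∑ z ∈ netS d u, KK (Onu u z Ω) j x = KK Ω j x := by
  rcases eq_or_ne x 0 with rfl | hx
  · have : ∀ Ω' : Rd d → ℝ, KK Ω' j (0 : Rd d) = 0 := fun Ω' =>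
      KK_eq_zero_of_le (by rw [norm_zero]; positivity)
    simp [this]
  · simp only [KK, ← Finset.sum_mul]
    rw [sum_Onu hx]

theorem hiAtom_sum_sq_le (hd : 2 ≤ d) : ∃ C : ℝ, 0 < C ∧ ∀ {Ω : Rd d → ℝ}, Measurable Ω →
    Homogeneous0 d Ω → (∀ x, |Ω x| ≤ 1) → ∀ {ι : Type*} {I : Finset ι} {n : ι → ℤ} {c : ι → Rd d}
    {Q : ι → Set (Rd d)} {b : ι → Rd d → ℝ}, Fam I n c Q b → ∀ (s u : ℕ), 4 * u ≤ s →
    ∫ x, (∑ i ∈ I, cv (KK Ω (n i + s)) (hiAtom (n i + s - 2 * u) (b i)) x) ^ 2 ≤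
      C * (2 ^ u)⁻¹ * famV d n I := by
  obtain ⟨Cb, hCb, hband⟩ := card_band hd
  obtain ⟨Cn, hCn, hcard⟩ := card_netS hd
  obtain ⟨Co, hCo, hoff⟩ := off_band_sq_le hd
  obtain ⟨Cl, hCl, hlow⟩ := lowfreq d
  set Cp : ℝ := (2 ^ (d + 1)) ^ 2 * (2 * (8 * d) ^ d * (24 * d) ^ d) with hCp
  have hCp0 : 0 ≤ Cp := by positivity
  refine ⟨2 * Cb * Cn * Cp + 2 * Cn ^ 2 * Co * Cl, by positivity, ?_⟩
  intro Ω hΩ hom h1 ι I n c Q b h s u hus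
  set U : ℝ := 2 ^ u with hU
  have hU0 : 0 < U := by positivity
  have hU1 : 1 ≤ U := one_le_pow₀ one_le_two
  have hr : (2 : ℝ) ^ (-(u : ℤ)) = U⁻¹ := by rw [zpow_neg, zpow_natCast]
  have hV := famV_nonneg (d := d) (n := n) (I := I)
  set V := famV d n I
  have hi := sphere_integrable_of_bdd hΩ h1
  have hi' := fun z => sphere_integrable_of_bdd (Onu_measurable (u := u) (z := z) hΩ)
      (fun x => (abs_Onu_le x).trans (h1 x))
  have hKi := fun z => KK_integrable hd (Onu_measurable (u := u) (z := z) hΩ) (Onu_hom hom) (hi' z)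
  have hfn : ∀ i ∈ I, Nice (hiAtom (n i + s - 2 * u) (b i)) := fun i hi => hiAtom_nice (h.nice i hi)
  set G : (Fin d → ℤ) → Rd d → ℝ := fun z x =>
    ∑ i ∈ I, cv (KK (Onu u z Ω) (n i + s)) (hiAtom (n i + s - 2 * u) (b i)) x with hG
  have hGn : ∀ z, Nice (G z) := fun z => Nice.sum fun i hi => cv_nice (hKi z _) (hfn i hi)
  have hGs : (fun x => ∑ i ∈ I, cv (KK Ω (n i + s)) (hiAtom (n i + s - 2 * u) (b i)) x) =
      fun x => ∑ z ∈ netS d u, G z x := by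
    ext x
    rw [hG, Finset.sum_comm]
    refine Finset.sum_congr rfl fun i hi => ?_
    rw [← cv_sum_left (fun z _ => hKi z _) (hfn i hi)]
    simp_rw [KK_sum_Onu]
  simp_rw [fun x => congrFun hGs x]
  obtain ⟨q1, q2⟩ := plancherel (Nice.sum (s := netS d u) fun z _ => hGn z)
  rw [← q2]
  set L : ℤ → Rd d → ℝ := fun m ξ => ‖ft (fun x => ∑ i ∈ I with n i = m, b i x) ξ‖ ^ 2 /
          (1 + 2 ^ (m + s - u) * ‖ξ‖) ^ (4 * d) with hL
  have hLow : ∀ m, Integrable (L m) ∧ ∫ ξ, L m ξ ≤ Cl * famV d n (I.filter (n · = m)) := by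
    intro m
    refine hlow (h.mono (Finset.filter_subset _ _)) _ (by positivity) fun i hi => ?_
    rw [(Finset.mem_filter.1 hi).2]
    exact zpow_le_zpow_right₀ one_le_two (by omega)
  set N : ℝ := ((netS d u).card : ℝ) with hN
  have hpt : ∀ ξ : Rd d, ξ ≠ 0 → ‖ft (fun x => ∑ z ∈ netS d u, G z x) ξ‖ ^ 2 ≤
      2 * (Cb * U ^ (d - 2)) * ∑ z ∈ netS d u, ‖ft (G z) ξ‖ ^ 2 +
        2 * N ^ 2 * (Co * (U⁻¹ ^ d) ^ 2 * ∑ m ∈ I.image n, L m ξ) := by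
    intro ξ hξ
    have hξ0 : 0 < ‖ξ‖ := norm_pos_iff.2 hξ
    rw [ft_sum fun z _ => (hGn z).int]
    refine norm_sum_sq_le (netS d u)
      (fun z => |inner ℝ (‖ξ‖⁻¹ • ξ) (netPt d u z)| ≤ 2 * d * 2 ^ (-(u : ℤ))) _
      (hband u _ (norm_smul_inv_norm hξ)) ?_ ?_
    · intro z hz hP
      rw [not_le, inner_smul_left, abs_mul] at hP
      simp only [map_inv₀, conj_trivial, abs_inv, abs_norm] at hP
      rw [← div_eq_inv_mul, lt_div_iff₀ hξ0] at hP
      have := hoff hΩ hom h1 h s u z hz ξ hP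
      rw [hr] at this
      exact this
    · have : 0 ≤ ∑ m ∈ I.image n, L m ξ := Finset.sum_nonneg fun m _ => by
        rw [hL]; positivity
      positivity
  have hd0 : (fun ξ => ‖ft (fun x => ∑ z ∈ netS d u, G z x) ξ‖ ^ 2) ≤ᵐ[volume] fun ξ =>
      2 * (Cb * U ^ (d - 2)) * ∑ z ∈ netS d u, ‖ft (G z) ξ‖ ^ 2 +
        2 * N ^ 2 * (Co * (U⁻¹ ^ d) ^ 2 * ∑ m ∈ I.image n, L m ξ) := by
    have := nontrivial_Rd hd
    filter_upwards [Measure.ae_ne volume (0 : Rd d)] with ξ hξ using hpt ξ hξ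
  have i1 : Integrable (fun ξ => ∑ z ∈ netS d u, ‖ft (G z) ξ‖ ^ 2) :=
    integrable_finsetSum _ fun z _ => (plancherel (hGn z)).1
  have i2 : Integrable (fun ξ => ∑ m ∈ I.image n, L m ξ) :=
    integrable_finsetSum _ fun m _ => (hLow m).1
  refine (integral_mono_ae q1 ((i1.const_mul _).add ((i2.const_mul _).const_mul _)) hd0).trans ?_
  have e1 : ∫ ξ, ∑ z ∈ netS d u, ‖ft (G z) ξ‖ ^ 2 ≤ N * (Cp * (U⁻¹ ^ (d - 1)) ^ 2 * V) := by
    rw [integral_finsetSum _ fun z _ => (plancherel (hGn z)).1, hN, ← nsmul_eq_mul]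
    refine Finset.sum_le_card_nsmul _ _ _ fun z hz => ?_
    rw [(plancherel (hGn z)).2, ← hr]
    exact piece_sq_le hd h hΩ hom h1 hus hz
  have e2 : ∫ ξ, ∑ m ∈ I.image n, L m ξ ≤ Cl * V := by
    rw [integral_finsetSum _ fun m _ => (hLow m).1]
    calc _ ≤ ∑ m ∈ I.image n, Cl * famV d n (I.filter (n · = m)) :=
          Finset.sum_le_sum fun m _ => (hLow m).2
      _ = Cl * V := by
          rw [← Finset.mul_sum]
          congr 1
          exact Finset.sum_fiberwise_of_maps_to (fun i hi => Finset.mem_image_of_mem n hi) _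
  have e3 : ∫ ξ, (2 * (Cb * U ^ (d - 2)) * ∑ z ∈ netS d u, ‖ft (G z) ξ‖ ^ 2 +
        2 * N ^ 2 * (Co * (U⁻¹ ^ d) ^ 2 * ∑ m ∈ I.image n, L m ξ)) =
      2 * (Cb * U ^ (d - 2)) * (∫ ξ, ∑ z ∈ netS d u, ‖ft (G z) ξ‖ ^ 2) +
        2 * N ^ 2 * (Co * (U⁻¹ ^ d) ^ 2 * ∫ ξ, ∑ m ∈ I.image n, L m ξ) := by
    rw [integral_add (i1.const_mul _) ((i2.const_mul _).const_mul _), integral_const_mul,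
      integral_const_mul, integral_const_mul]
  refine e3.le.trans ?_
  have hNc : N ≤ Cn * U ^ (d - 1) := hcard u
  have hN0 : 0 ≤ N := by positivity
  calc _ ≤ 2 * (Cb * U ^ (d - 2)) * (Cn * U ^ (d - 1) * (Cp * (U⁻¹ ^ (d - 1)) ^ 2 * V)) +
        2 * (Cn * U ^ (d - 1)) ^ 2 * (Co * (U⁻¹ ^ d) ^ 2 * (Cl * V)) := by
        gcongr
        exact e1.trans (by gcongr)
    _ = (2 * Cb * Cn * Cp) * U⁻¹ * V + (2 * Cn ^ 2 * Co * Cl) * (U⁻¹ ^ 2) * V := by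
        obtain ⟨m, rfl⟩ : ∃ m, d = m + 2 := ⟨d - 2, by omega⟩
        simp only [Nat.add_sub_cancel, show m + 2 - 1 = m + 1 by omega, inv_pow]
        have : U ^ m ≠ 0 := by positivity
        rw [pow_add, pow_add]
        field_simp
    _ ≤ (2 * Cb * Cn * Cp) * U⁻¹ * V + (2 * Cn ^ 2 * Co * Cl) * U⁻¹ * V := by
        have : U⁻¹ ^ 2 ≤ U⁻¹ := pow_le_of_le_one (by positivity) (inv_le_one_of_one_le₀ hU1)
          two_ne_zero
        gcongr
    _ = _ := by ring

theorem smoothed_sum_integral_le (hd : 2 ≤ d) (h : Fam I n c Q b) (hΩ : Measurable Ω)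
    (hom : Homogeneous0 d Ω) (h1 : ∀ x, |Ω x| ≤ 1) {s u : ℕ} (hus : 4 * u ≤ s) :
    ∫ x, |∑ i ∈ I, cv (KK Ω (n i + s)) (cv (tent (2 ^ (n i + s - 2 * u))) (b i)) x| ≤
      3 * (d * 2 ^ d) * (cShift d * d) * (2 ^ u)⁻¹ * famV d n I := by
  have hi := sphere_integrable_of_bdd hΩ h1
  have hKi := KK_integrable hd hΩ hom hi
  have hcs := cShift_nonneg (d := d)
  have hKb : ∀ j, ∫ x, |KK Ω j x| ≤ 3 * (d * 2 ^ d) := fun j => by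
    refine (KK_integral_abs hd hΩ hom hi j).trans ?_
    gcongr
    calc sphInt d (fun x => |Ω x|) ≤ ∫ _θ : sphere (0 : Rd d) 1, (1 : ℝ) ∂(sphereMeasure d) :=
          integral_mono hi.abs (integrable_const _) fun θ => h1 _
      _ = (sphereMeasure d).real univ := by rw [integral_const, smul_eq_mul, mul_one]
      _ ≤ _ := ENNReal.toReal_le_of_le_ofReal (by positivity) (sphere_measure_univ_le hd)
  have hti : ∀ m : ℤ, Integrable (tent (d := d) (2 ^ m)) := fun m => tent_integrable (by positivity)
  have h_int : ∀ i ∈ I, Integrable (cv (KK Ω (n i + s)) (cv (tent (2 ^ (n i + s - 2 * u))) (b i))) :=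
    fun i hi => cv_integrable (hKi _) (cv_integrable (hti _) (h.nice i hi).int)
  calc _ ≤ ∫ x, ∑ i ∈ I, |cv (KK Ω (n i + s)) (cv (tent (2 ^ (n i + s - 2 * u))) (b i)) x| :=
        integral_mono (integrable_finsetSum _ fun i hi => h_int i hi).abs
          (integrable_finsetSum _ fun i hi => (h_int i hi).abs) fun x =>
            Finset.abs_sum_le_sum_abs _ _
    _ = ∑ i ∈ I, ∫ x, |cv (KK Ω (n i + s)) (cv (tent (2 ^ (n i + s - 2 * u))) (b i)) x| :=
        integral_finsetSum _ fun i hi => (h_int i hi).abs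
    _ ≤ ∑ i ∈ I, 3 * (d * 2 ^ d) * ((cShift d * (d * (2 ^ u)⁻¹)) * (2 ^ n i) ^ d) := by
        refine Finset.sum_le_sum fun i hi => ?_
        refine (integral_abs_cv_le (hKi _) (cv_integrable (hti _) (h.nice i hi).int)).trans ?_
        refine mul_le_mul (hKb _) ?_ (integral_nonneg fun _ => abs_nonneg _) (by positivity)
        refine (integral_abs_cv_tent_le (ρ := d * 2 ^ n i) (c := c i) (by positivity) (by positivity)
          (h.nice i hi).int (h.mean i hi) (fun x hx => h.supp' hi hx)).trans ?_
        have e : (d * 2 ^ n i) / 2 ^ (n i + s - 2 * u) ≤ (d : ℝ) * (2 ^ u)⁻¹ := by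
          rw [div_le_iff₀ (by positivity), mul_assoc]
          gcongr
          rw [← zpow_natCast, ← zpow_neg, ← zpow_add₀ two_ne_zero]
          exact zpow_le_zpow_right₀ one_le_two (by omega)
        have := h.lone i hi
        gcongr
    _ = _ := by rw [famV, Finset.mul_sum]; refine Finset.sum_congr rfl fun i _ => ?_; ring

/-- The basic weak-type estimate for one family and one distance parameter `s`. -/
theorem fam_weak (hd : 2 ≤ d) : ∃ C : ℝ, 0 < C ∧ ∀ {Ω : Rd d → ℝ}, Measurable Ω →
    Homogeneous0 d Ω → (∀ x, |Ω x| ≤ 1) → ∀ {ι : Type*} {I : Finset ι} {n : ι → ℤ} {c : ι → Rd d}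
    {Q : ι → Set (Rd d)} {b : ι → Rd d → ℝ}, Fam I n c Q b → ∀ (s u : ℕ), 4 * u ≤ s →
    ∀ α : ℝ, 0 < α → α ≤ 1 →
    volume {x | α < |∑ i ∈ I, cv (KK Ω (n i + s)) (b i) x|} ≤
      ENNReal.ofReal (C * (2 ^ u)⁻¹ * (α ^ 2)⁻¹ * famV d n I) := by
  obtain ⟨C2, hC2, hF2⟩ := hiAtom_sum_sq_le hd
  have hcs := cShift_nonneg (d := d)
  set C1 : ℝ := 3 * (d * 2 ^ d) * (cShift d * d) with hC1
  have hC10 : 0 ≤ C1 := by positivity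
  refine ⟨2 * C1 + 4 * C2, by positivity, ?_⟩
  intro Ω hΩ hom h1 ι I n c Q b h s u hus α hα hα1
  have hi := sphere_integrable_of_bdd hΩ h1
  have hKi := KK_integrable hd hΩ hom hi
  have hti : ∀ m : ℤ, Integrable (tent (d := d) (2 ^ m)) := fun m => tent_integrable (by positivity)
  have hV := famV_nonneg (d := d) (n := n) (I := I)
  set F1 : Rd d → ℝ := fun x =>
    ∑ i ∈ I, cv (KK Ω (n i + s)) (cv (tent (2 ^ (n i + s - 2 * u))) (b i)) x with hF1d
  set F2 : Rd d → ℝ := fun x =>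
    ∑ i ∈ I, cv (KK Ω (n i + s)) (hiAtom (n i + s - 2 * u) (b i)) x with hF2d
  have hF1n : Nice F1 := Nice.sum fun i hi => cv_nice (hKi _) (cv_nice (hti _) (h.nice i hi))
  have hF2n : Nice F2 := Nice.sum fun i hi => cv_nice (hKi _) (hiAtom_nice (h.nice i hi))
  have hs : ∀ x, ∑ i ∈ I, cv (KK Ω (n i + s)) (b i) x = F1 x + F2 x := by
    intro x
    rw [hF1d, hF2d, ← Finset.sum_add_distrib]
    refine Finset.sum_congr rfl fun i hi => ?_
    rw [← cv_add_right (hKi _) (cv_nice (hti _) (h.nice i hi)) (hiAtom_nice (h.nice i hi))]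
    congr 1; ext y; rw [hiAtom]; ring
  have hsub : {x | α < |∑ i ∈ I, cv (KK Ω (n i + s)) (b i) x|} ⊆
      {x | α / 2 < |F1 x|} ∪ {x | α / 2 < |F2 x|} := by
    intro x hx
    rw [mem_ofPred_eq, hs x] at hx
    by_contra hc
    simp only [mem_union, mem_ofPred_eq, not_or, not_lt] at hc
    have := abs_add_le (F1 x) (F2 x)
    linarith [hc.1, hc.2]
  have b1 := cheb_one hF1n.int (half_pos hα)
  have b2 := cheb_two hF2n.sq.int (half_pos hα)
  have c1 : (∫ x, |F1 x|) / (α / 2) ≤ 2 * C1 * (2 ^ u)⁻¹ * (α ^ 2)⁻¹ * famV d n I := by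
    rw [div_le_iff₀ (by positivity)]
    refine (smoothed_sum_integral_le hd h hΩ hom h1 hus).trans ?_
    have : 1 ≤ (α ^ 2)⁻¹ * α := by
      rw [pow_two, mul_inv, mul_assoc, inv_mul_cancel₀ hα.ne', mul_one]
      exact one_le_inv_iff₀.2 ⟨hα, hα1⟩
    calc C1 * (2 ^ u)⁻¹ * famV d n I = C1 * (2 ^ u)⁻¹ * famV d n I * 1 := (mul_one _).symm
      _ ≤ C1 * (2 ^ u)⁻¹ * famV d n I * ((α ^ 2)⁻¹ * α) := by gcongr
      _ = _ := by ring
  have c2 : (∫ x, F2 x ^ 2) / (α / 2) ^ 2 ≤ 4 * C2 * (2 ^ u)⁻¹ * (α ^ 2)⁻¹ * famV d n I := by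
    rw [div_le_iff₀ (by positivity)]
    refine (hF2 hΩ hom h1 h s u hus).trans (le_of_eq ?_)
    field_simp
    ring
  calc _ ≤ _ := measure_mono hsub
    _ ≤ _ := measure_union_le _ _
    _ ≤ _ := add_le_add b1 b2
    _ ≤ _ := add_le_add (ENNReal.ofReal_le_ofReal c1) (ENNReal.ofReal_le_ofReal c2)
    _ = _ := by rw [← ENNReal.ofReal_add (by positivity) (by positivity)]; congr 1; ring

end SmoothedSum

section Stopping

variable {ι : Type*} {I : Finset ι} {m : ι → ℤ} {τ γ val : ι → ℝ}

/-- Deterministic stopping-time argument: truncations of a sum are controlled by sums over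
sublevel sets of `val`. -/
theorem abs_truncated_sum_le {t : ℕ} (ht : 1 ≤ t) {δ ε C : ℝ} (hδ : 0 < δ) (hC : 0 ≤ C)
    (hγ : ∀ i, 0 ≤ γ i) (hτ : ∀ i ∈ I, |τ i| ≤ C * γ i)
    (hval : ∀ i ∈ I, τ i ≠ 0 → |val i - ∑ i' ∈ I with m i + t ≤ m i', γ i'| ≤ δ)
    {N : ℕ} (hN : ∑ i ∈ I, γ i ≤ N * δ)
    (hH : ∀ L ≤ N + 1, |∑ i ∈ I with val i ≤ L * δ, τ i| ≤ ε)
    (hHj : ∀ L ≤ N + 1, ∀ j : ℤ, |∑ i ∈ I with val i ≤ L * δ ∧ m i = j, τ i| ≤ ε / t) (k : ℤ) :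
    |∑ i ∈ I with k < m i, τ i| ≤ 2 * ε + 3 * C * δ := by
  set A : ℤ → ℝ := fun j => ∑ i ∈ I with j ≤ m i, γ i with hA
  have hAanti : ∀ j j', j ≤ j' → A j' ≤ A j := fun j j' hj => by
    refine Finset.sum_le_sum_of_subset_of_nonneg ?_ fun i _ _ => hγ i
    intro i hi
    obtain ⟨p, q⟩ := Finset.mem_filter.1 hi
    exact Finset.mem_filter.2 ⟨p, hj.trans q⟩
  have hA0 : ∀ j, 0 ≤ A j := fun j => Finset.sum_nonneg fun i _ => hγ i
  set a := A (k + t) with ha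
  have haN : a ≤ N * δ := (Finset.sum_le_sum_of_subset_of_nonneg (Finset.filter_subset _ _)
    fun i _ _ => hγ i).trans hN
  set L : ℕ := ⌈a / δ⌉₊ + 1 with hL
  have hLN : L ≤ N + 1 := by
    have : ⌈a / δ⌉₊ ≤ N := Nat.ceil_le.2 ((div_le_iff₀ hδ).2 haN)
    omega
  have hL1 : a + δ ≤ L * δ := by
    have := Nat.le_ceil (a / δ)
    rw [div_le_iff₀ hδ] at this
    rw [hL]; push_cast; linarith
  have hL2 : L * δ ≤ a + 2 * δ := by
    have := (Nat.ceil_lt_add_one (div_nonneg (hA0 _) hδ.le : 0 ≤ a / δ)).le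
    have h2 := mul_le_mul_of_nonneg_right this hδ.le
    rw [add_mul, div_mul_cancel₀ _ hδ.ne'] at h2
    rw [hL]; push_cast; linarith
  have claim1 : ∑ i ∈ I with k < m i, τ i = ∑ i ∈ I with val i ≤ L * δ ∧ k < m i, τ i := by
    symm
    refine Finset.sum_subset (fun i hi => ?_) fun i hi hn => ?_
    · obtain ⟨p, q⟩ := Finset.mem_filter.1 hi
      exact Finset.mem_filter.2 ⟨p, q.2⟩
    · obtain ⟨p, q⟩ := Finset.mem_filter.1 hi
      by_contra hne
      refine hn (Finset.mem_filter.2 ⟨p, ?_, q⟩)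
      have h1 := (abs_le.1 (hval i p hne)).2
      have h2 := hAanti (k + t) (m i + t) (by omega)
      simp only [hA] at h2
      simp only [ha, hA] at hL1
      linarith
  have claim2 : ∑ i ∈ I with val i ≤ L * δ, τ i = ∑ i ∈ I with val i ≤ L * δ ∧ k < m i, τ i +
      ∑ i ∈ I with val i ≤ L * δ ∧ ¬ k < m i, τ i := by
    rw [← Finset.sum_filter_add_sum_filter_not (I.filter (fun i => val i ≤ L * δ))
      (fun i => k < m i), Finset.filter_filter, Finset.filter_filter]
  obtain ⟨j0, hj0, hj0'⟩ : ∃ j0 : ℤ, (∀ i ∈ I, val i ≤ L * δ → ¬ k < m i → τ i ≠ 0 → j0 ≤ m i) ∧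
      A (j0 + t) ≤ a + 3 * δ := by
    classical
    set J := I.filter (fun i => val i ≤ L * δ ∧ ¬ k < m i ∧ τ i ≠ 0) with hJ
    rcases J.eq_empty_or_nonempty with he | hne
    · refine ⟨k, fun i hi h1 h2 h3 => ?_, by linarith⟩
      have : i ∈ J := Finset.mem_filter.2 ⟨hi, h1, h2, h3⟩
      rw [he] at this; exact absurd this (Finset.notMem_empty i)
    · obtain ⟨i0, hi0, hmin⟩ := J.exists_min_image m hne
      obtain ⟨p, q1, q2, q3⟩ := Finset.mem_filter.1 hi0
      refine ⟨m i0, fun i hi h1 h2 h3 => hmin i (Finset.mem_filter.2 ⟨hi, h1, h2, h3⟩), ?_⟩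
      have h1 := (abs_le.1 (hval i0 p q3)).1
      simp only [hA] at *
      linarith
  have claim3 : |∑ i ∈ I with val i ≤ L * δ ∧ ¬ k < m i, τ i| ≤ ε + 3 * C * δ := by
    have e1 : ∑ i ∈ I with val i ≤ L * δ ∧ ¬ k < m i, τ i =
        ∑ i ∈ I with val i ≤ L * δ ∧ ¬ k < m i ∧ j0 ≤ m i, τ i := by
      symm
      refine Finset.sum_subset (fun i hi => ?_) fun i hi hn => ?_
      · obtain ⟨p, q⟩ := Finset.mem_filter.1 hi
        exact Finset.mem_filter.2 ⟨p, q.1, q.2.1⟩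
      · obtain ⟨p, q1, q2⟩ := Finset.mem_filter.1 hi
        by_contra hne
        exact hn (Finset.mem_filter.2 ⟨p, q1, q2, hj0 i p q1 q2 hne⟩)
    rw [e1, ← Finset.sum_filter_add_sum_filter_not _ (fun i => m i < j0 + t), Finset.filter_filter,
      Finset.filter_filter]
    refine (abs_add_le _ _).trans (add_le_add ?_ ?_)
    · have hmaps : ∀ i ∈ I.filter (fun i => (val i ≤ L * δ ∧ ¬ k < m i ∧ j0 ≤ m i) ∧ m i < j0 + t),
          m i ∈ (Finset.Ico j0 (j0 + t)).filter (fun j => ¬ k < j) := by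
        intro i hi
        obtain ⟨_, ⟨_, q2, q3⟩, q4⟩ := Finset.mem_filter.1 hi
        exact Finset.mem_filter.2 ⟨Finset.mem_Ico.2 ⟨q3, q4⟩, q2⟩
      rw [← Finset.sum_fiberwise_of_maps_to hmaps]
      refine (Finset.abs_sum_le_sum_abs _ _).trans ?_
      have hε0 : 0 ≤ ε / t := (abs_nonneg _).trans (hHj L hLN 0)
      have ht0 : (t : ℝ) ≠ 0 := by positivity
      calc _ ≤ ∑ j ∈ (Finset.Ico j0 (j0 + t)).filter (fun j => ¬ k < j), ε / t := by
            refine Finset.sum_le_sum fun j hj => ?_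
            obtain ⟨p, q⟩ := Finset.mem_filter.1 hj
            rw [Finset.mem_Ico] at p
            rw [Finset.filter_filter]
            refine le_trans (le_of_eq ?_) (hHj L hLN j)
            congr 2
            refine Finset.filter_congr fun i _ => ?_
            constructor
            · rintro ⟨⟨⟨h1, _⟩, _⟩, h2⟩; exact ⟨h1, h2⟩
            · rintro ⟨h1, h2⟩; subst h2; exact ⟨⟨⟨h1, q, p.1⟩, p.2⟩, rfl⟩
        _ ≤ ∑ j ∈ Finset.Ico j0 (j0 + t), ε / t :=
            Finset.sum_le_sum_of_subset_of_nonneg (Finset.filter_subset _ _) fun _ _ _ => hε0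
        _ = ε := by
            rw [Finset.sum_const, Int.card_Ico, nsmul_eq_mul]
            simp only [add_sub_cancel_left, Int.toNat_natCast]
            field_simp
    · calc _ ≤ ∑ i ∈ I with (val i ≤ L * δ ∧ ¬ k < m i ∧ j0 ≤ m i) ∧ ¬ m i < j0 + t, C * γ i :=
            (Finset.abs_sum_le_sum_abs _ _).trans (Finset.sum_le_sum fun i hi => hτ i (Finset.mem_filter.1 hi).1)
        _ ≤ ∑ i ∈ I with ¬ k < m i ∧ j0 + t ≤ m i, C * γ i := by
            refine Finset.sum_le_sum_of_subset_of_nonneg ?_ fun i _ _ => mul_nonneg hC (hγ i)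
            intro i hi
            obtain ⟨p, q1, q2⟩ := Finset.mem_filter.1 hi
            exact Finset.mem_filter.2 ⟨p, q1.2.1, not_lt.1 q2⟩
        _ = C * ∑ i ∈ I with ¬ k < m i ∧ j0 + t ≤ m i, γ i := by rw [Finset.mul_sum]
        _ ≤ C * (3 * δ) := by
            gcongr
            have h1 : ∑ i ∈ I with ¬ k < m i ∧ j0 + t ≤ m i, γ i + ∑ i ∈ I with k + t ≤ m i ∧ j0 + t ≤ m i, γ i
                ≤ A (j0 + t) := by
              classical
              rw [← Finset.sum_union]
              · refine Finset.sum_le_sum_of_subset_of_nonneg ?_ fun i _ _ => hγ i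
                intro i hi
                rcases Finset.mem_union.1 hi with h | h
                · exact Finset.mem_filter.2 ⟨(Finset.mem_filter.1 h).1, (Finset.mem_filter.1 h).2.2⟩
                · exact Finset.mem_filter.2 ⟨(Finset.mem_filter.1 h).1, (Finset.mem_filter.1 h).2.2⟩
              · refine Finset.disjoint_filter.2 fun i _ h1 h2 => ?_
                omega
            by_cases hjk : j0 ≤ k
            · have h2 : ∑ i ∈ I with k + t ≤ m i ∧ j0 + t ≤ m i, γ i = a := by
                rw [ha, hA]
                refine Finset.sum_congr (Finset.filter_congr fun i _ => ?_) fun _ _ => rfl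
                constructor
                · exact fun h => h.1
                · exact fun h => ⟨h, by omega⟩
              linarith
            · have h2 : ∑ i ∈ I with ¬ k < m i ∧ j0 + t ≤ m i, γ i = 0 := by
                rw [Finset.filter_false_of_mem, Finset.sum_empty]
                intro i _ h; omega
              rw [h2]; positivity
        _ = 3 * C * δ := by ring
  rw [claim1]
  have h1 := hH L hLN
  rw [claim2] at h1
  set X := ∑ i ∈ I with val i ≤ L * δ ∧ k < m i, τ i
  set Y := ∑ i ∈ I with val i ≤ L * δ ∧ ¬ k < m i, τ i
  have h2 : X = (X + Y) - Y := by ring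
  rw [h2]
  refine (abs_sub _ _).trans ?_
  linarith

end Stopping

section TruncatedFamily

variable {d : ℕ} {ι : Type*} {I : Finset ι} {n : ι → ℤ} {c : ι → Rd d} {Q : ι → Set (Rd d)}
  {b : ι → Rd d → ℝ} {Ω : Rd d → ℝ}

theorem abs_KK_le_lapG (h1 : ∀ x, |Ω x| ≤ 1) (j : ℤ) (y : Rd d) :
    |KK Ω j y| ≤ 4 ^ d * Real.exp (2 * d) * lapG (2 ^ j) y := by
  have h2 : (0 : ℝ) < 2 ^ j := by positivity
  have hl := (lapG_pos h2 y).le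
  rcases le_or_gt (2 * 2 ^ j) ‖y‖ with h | h
  · rw [KK_eq_zero_of_ge h, abs_zero]; positivity
  · have e0 : lapG ((2 : ℝ) ^ j) (0 : Rd d) = (2 ^ d)⁻¹ * (((2 : ℝ) ^ j) ^ d)⁻¹ := by
      simp [lapG, lap, mul_pow, inv_pow, mul_comm]
    have e1 := lapG_le_exp h2 (0 : Rd d) y
    have e2 : d * (‖(0 : Rd d) - y‖ / 2 ^ j) ≤ 2 * d := by
      rw [zero_sub, norm_neg, mul_comm (2 : ℝ)]
      gcongr
      rw [div_le_iff₀ h2]; exact h.le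
    calc |KK Ω j y| ≤ |Ω y| * (2 ^ d * (((2 : ℝ) ^ j) ^ d)⁻¹) := abs_KK_le j y
      _ ≤ 1 * (2 ^ d * (((2 : ℝ) ^ j) ^ d)⁻¹) := by gcongr; exact h1 y
      _ = 4 ^ d * lapG ((2 : ℝ) ^ j) (0 : Rd d) := by
          rw [e0, show (4 : ℝ) = 2 * 2 by norm_num, mul_pow]
          field_simp
      _ ≤ 4 ^ d * (Real.exp (d * (‖(0 : Rd d) - y‖ / 2 ^ j)) * lapG (2 ^ j) y) := by gcongr
      _ ≤ 4 ^ d * (Real.exp (2 * d) * lapG (2 ^ j) y) := by gcongr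
      _ = _ := by ring

theorem Fam.abs_cv_KK_le (h : Fam I n c Q b) (h1 : ∀ x, |Ω x| ≤ 1) {i : ι} (hi : i ∈ I) (j : ℤ)
    (x : Rd d) : |cv (KK Ω j) (b i) x| ≤
      4 ^ d * Real.exp (2 * d) * cv (lapG (2 ^ j)) (fun y => |b i y|) x := by
  refine (abs_cv_le _ _ x).trans ?_
  rw [← cv_const_mul_left]
  exact cv_mono ((lapG_integrable (by positivity)).const_mul _) (h.nice i hi).abs
    (fun _ => abs_nonneg _) (fun _ => abs_nonneg _) (abs_KK_le_lapG h1 j) (fun _ => le_rfl) x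

theorem Fam.norm_sub_le_of_cv_ne (h : Fam I n c Q b) {i : ι} (hi : i ∈ I) {j : ℤ} {x : Rd d}
    (hx : cv (KK Ω j) (b i) x ≠ 0) : ‖x - c i‖ ≤ 2 * 2 ^ j + d * 2 ^ n i := by
  by_contra hc
  refine hx (integral_eq_zero_of_ae (.of_forall fun y => ?_))
  simp only [Pi.zero_apply]
  by_cases hy : d * 2 ^ n i < ‖y - c i‖
  · rw [h.supp' hi hy, mul_zero]
  · rw [KK_eq_zero_of_ge, zero_mul]
    have := norm_sub_le_norm_sub_add_norm_sub x y (c i)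
    push Not at hc hy
    linarith

theorem cv_lapG_le {g : Rd d → ℝ} (hg : Nice g) (h0 : ∀ y, 0 ≤ g y) {ρ : ℝ} (hρ : 0 < ρ)
    (x z : Rd d) : cv (lapG ρ) g x ≤ Real.exp (d * (‖x - z‖ / ρ)) * cv (lapG ρ) g z := by
  rw [cv, cv, ← integral_const_mul]
  refine integral_mono (cv_integrand (lapG_integrable hρ) hg x)
    ((cv_integrand (lapG_integrable hρ) hg z).const_mul _) fun y => ?_
  simp only
  rw [← mul_assoc]
  refine mul_le_mul_of_nonneg_right ?_ (h0 y)
  have := lapG_le_exp hρ (x - y) (z - y)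
  rwa [sub_sub_sub_cancel_right] at this

theorem abs_sub_le_of_exp {η A B M : ℝ} (h0 : 0 ≤ η) (h1 : η ≤ 1) (hB : 0 ≤ B) (hM : B ≤ M)
    (hAB : A ≤ Real.exp η * B) (hBA : B ≤ Real.exp η * A) : |A - B| ≤ 2 * η * M := by
  have e1 : Real.exp η ≤ 1 + 2 * η := by
    have := Real.abs_exp_sub_one_le (x := η) (by rwa [abs_of_nonneg h0])
    rw [abs_of_nonneg h0] at this
    linarith [le_abs_self (Real.exp η - 1)]
  have e2 := Real.exp_pos η
  have e3 : 1 ≤ Real.exp η := Real.one_le_exp h0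
  have hA : 0 ≤ A := by by_contra hA; nlinarith
  have e4 : η * B ≤ η * M := by gcongr
  rw [abs_le]
  constructor
  · rcases le_total A B with h | h
    · nlinarith
    · nlinarith [mul_nonneg h0 hB]
  · nlinarith

theorem famV_fiber_le {m : ι → ℤ} : ∑ j ∈ I.image m, famV d n (I.filter fun i => m i = j) =
    famV d n I := by
  classical
  exact Finset.sum_fiberwise_of_maps_to (fun i hi => Finset.mem_image_of_mem m hi) _

theorem Fam.integral_sum_lapG_le (h : Fam I n c Q b) {ρ : ι → ℝ} (hρ : ∀ i, 0 < ρ i) :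
    ∫ x, |∑ i ∈ I, cv (lapG (ρ i)) (fun y => |b i y|) x| ≤ famV d n I := by
  have hn : ∀ i ∈ I, Nice (cv (lapG (ρ i)) (fun y => |b i y|)) := fun i hi =>
    cv_nice (lapG_integrable (hρ i)) (h.nice i hi).abs
  calc _ ≤ ∫ x, ∑ i ∈ I, |cv (lapG (ρ i)) (fun y => |b i y|) x| :=
        integral_mono (Nice.sum hn).int.abs (integrable_finsetSum _ fun i hi => (hn i hi).int.abs)
          fun x => Finset.abs_sum_le_sum_abs _ _
    _ = ∑ i ∈ I, ∫ x, |cv (lapG (ρ i)) (fun y => |b i y|) x| :=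
        integral_finsetSum _ fun i hi => (hn i hi).int.abs
    _ ≤ _ := Finset.sum_le_sum fun i hi => by
        refine (integral_abs_cv_le (lapG_integrable (hρ i)) (h.nice i hi).abs.int).trans ?_
        rw [integral_abs_lapG (hρ i), one_mul]
        simpa using h.lone i hi

/-- Weak type bound for the maximal truncations of the `s`-th part of the bad function. -/
theorem fam_truncated_weak (hd : 2 ≤ d) : ∃ C : ℝ, 0 < C ∧ ∀ {Ω : Rd d → ℝ}, Measurable Ω →
    Homogeneous0 d Ω → (∀ x, |Ω x| ≤ 1) → ∀ {ι : Type*} {I : Finset ι} {n : ι → ℤ} {c : ι → Rd d}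
    {Q : ι → Set (Rd d)} {b : ι → Rd d → ℝ}, Fam I n c Q b → ∀ (s v : ℕ), 80 * v ≤ s →
    volume {x | ∃ k : ℤ, C * ((2 : ℝ) ^ (2 * v))⁻¹ <
      |∑ i ∈ I with k < n i + s, cv (KK Ω (n i + s)) (b i) x|} ≤
      ENNReal.ofReal (C * (2 ^ v)⁻¹ * famV d n I) := by
  obtain ⟨C0, hC0, hw⟩ := fam_weak hd
  set CK : ℝ := 4 ^ d * Real.exp (2 * d) with hCK
  have hCK0 : 0 ≤ CK := by positivity
  set t0 : ℕ := 2 * (d * (d + 2)) with ht0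
  set D : ℝ := 1 + 3 * C0 + 3 * C0 * (3 + t0) ^ 2 with hD
  refine ⟨2 + 3 * CK + D, by positivity, ?_⟩
  intro Ω hΩ hom h1 ι I n c Q b h s v hsv
  set δ : ℝ := ((2 : ℝ) ^ (2 * v))⁻¹ with hδ
  have hδ0 : 0 < δ := by positivity
  have hδ1 : δ ≤ 1 := inv_le_one_of_one_le₀ (one_le_pow₀ one_le_two)
  set t : ℕ := 3 * v + t0 with ht
  have ht1 : 1 ≤ t := by
    have : 1 ≤ d * (d + 2) := Nat.mul_pos (by omega) (by omega)
    omega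
  set m : ι → ℤ := fun i => n i + s with hm
  set γ : ι → Rd d → ℝ := fun i => cv (lapG (2 ^ m i)) (fun y => |b i y|) with hγ
  set val : ι → ℝ := fun i => ∑ i' ∈ I with m i + t ≤ m i', γ i' (c i) with hval
  set N : ℕ := 2 ^ (3 * v) with hN
  set G : ℕ → Finset ι := fun L => I.filter (fun i => val i ≤ L * δ) with hG
  set E1 : Set (Rd d) := {x | 2 ^ v < |∑ i ∈ I, γ i x|} with hE1
  set E2 : ℕ → Set (Rd d) := fun L => {x | δ < |∑ i ∈ G L, cv (KK Ω (n i + s)) (b i) x|} with hE2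
  set E3 : ℕ → ℤ → Set (Rd d) := fun L j =>
    {x | δ / t < |∑ i ∈ (G L).filter (fun i => m i = j), cv (KK Ω (n i + s)) (b i) x|} with hE3
  have hγ0 : ∀ i x, 0 ≤ γ i x := fun i x =>
    cv_nonneg (fun y => (lapG_pos (by positivity) y).le) (fun y => abs_nonneg _) x
  have hsub : {x | ∃ k : ℤ, (2 + 3 * CK + D) * δ <
      |∑ i ∈ I with k < n i + s, cv (KK Ω (n i + s)) (b i) x|} ⊆
      E1 ∪ ((⋃ L ∈ Finset.range (N + 2), E2 L) ∪
        ⋃ L ∈ Finset.range (N + 2), ⋃ j ∈ (G L).image m, E3 L j) := by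
    rintro x ⟨k, hk⟩
    by_contra hx
    simp only [mem_union, mem_iUnion, not_or, not_exists] at hx
    obtain ⟨hx1, hx2, hx3⟩ := hx
    simp only [hE1, hE2, hE3, mem_ofPred_eq, not_lt] at hx1 hx2 hx3
    rw [abs_of_nonneg (Finset.sum_nonneg fun i _ => hγ0 i x)] at hx1
    refine absurd hk (not_lt.2 ?_)
    refine (abs_truncated_sum_le (τ := fun i => cv (KK Ω (n i + s)) (b i) x) (γ := fun i => γ i x)
      (m := m) (val := val) (ε := δ) ht1 hδ0 hCK0 (fun i => hγ0 i x)
      (fun i hi => h.abs_cv_KK_le h1 hi _ x) ?_ (N := N) ?_ ?_ ?_ k).trans ?_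
    · intro i hi hne
      have hdist := h.norm_sub_le_of_cv_ne hi hne
      have hdist' : ‖x - c i‖ ≤ (d + 2) * 2 ^ m i := by
        have : (2 : ℝ) ^ n i ≤ 2 ^ m i := zpow_le_zpow_right₀ one_le_two (by simp [hm])
        have hd0 : (0 : ℝ) ≤ d := by positivity
        have : d * (2 : ℝ) ^ n i ≤ d * 2 ^ m i := by gcongr
        simp only [hm] at *
        linarith
      set η : ℝ := d * (d + 2) * ((2 : ℝ) ^ t)⁻¹ with hη
      have hη0 : 0 ≤ η := by positivity
      have h2t0 : 2 * (d * (d + 2) : ℝ) ≤ 2 ^ t0 := by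
        have := (Nat.lt_two_pow_self (n := t0)).le
        have h' : ((2 * (d * (d + 2)) : ℕ) : ℝ) ≤ ((2 ^ t0 : ℕ) : ℝ) := by
          exact_mod_cast this
        push_cast at h'; exact h'
      have hη2 : 2 * η * 2 ^ v ≤ δ := by
        rw [hη, hδ, ht, pow_add, mul_inv]
        have e : (2 : ℝ) ^ (3 * v) = 2 ^ v * 2 ^ (2 * v) := by rw [← pow_add]; congr 1; ring
        rw [e, mul_inv]
        calc 2 * (d * (d + 2) * (((2 : ℝ) ^ v)⁻¹ * (2 ^ (2 * v))⁻¹ * (2 ^ t0)⁻¹)) * 2 ^ v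
            = (2 * (d * (d + 2)) * (2 ^ t0)⁻¹) * ((2 : ℝ) ^ (2 * v))⁻¹ := by field_simp
          _ ≤ 1 * ((2 : ℝ) ^ (2 * v))⁻¹ := by
              gcongr
              rw [← div_eq_mul_inv, div_le_one (by positivity)]; exact h2t0
          _ = _ := one_mul _
      have hη1 : η ≤ 1 := by
        have : (1 : ℝ) ≤ 2 ^ v := one_le_pow₀ one_le_two
        nlinarith
      have hexp : ∀ i' ∈ I.filter (fun i' => m i + t ≤ m i'), d * (‖x - c i‖ / 2 ^ m i') ≤ η := by
        intro i' hi'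
        have hle : m i + t ≤ m i' := (Finset.mem_filter.1 hi').2
        have e1 : (2 : ℝ) ^ m i * 2 ^ t ≤ 2 ^ m i' := by
          rw [← zpow_natCast, ← zpow_add₀ two_ne_zero]
          exact zpow_le_zpow_right₀ one_le_two hle
        rw [hη, mul_assoc]
        gcongr
        rw [div_le_iff₀ (by positivity)]
        calc ‖x - c i‖ ≤ (d + 2) * 2 ^ m i := hdist'
          _ = (d + 2) * (2 ^ t)⁻¹ * (2 ^ m i * 2 ^ t) := by field_simp
          _ ≤ _ := by gcongr
      refine (abs_sub_le_of_exp hη0 hη1 (Finset.sum_nonneg fun i _ => hγ0 i x)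
        (M := 2 ^ v) ?_ ?_ ?_).trans hη2
      · exact (Finset.sum_le_sum_of_subset_of_nonneg (Finset.filter_subset _ _)
          fun i _ _ => hγ0 i x).trans hx1
      · rw [hval, Finset.mul_sum]
        refine Finset.sum_le_sum fun i' hi' => ?_
        refine (cv_lapG_le (h.nice i' (Finset.mem_filter.1 hi').1).abs (fun _ => abs_nonneg _)
          (by positivity) (c i) x).trans ?_
        rw [norm_sub_rev]
        have := hγ0 i' x
        gcongr
        exact hexp i' hi'
      · rw [hval, Finset.mul_sum]
        refine Finset.sum_le_sum fun i' hi' => ?_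
        refine (cv_lapG_le (h.nice i' (Finset.mem_filter.1 hi').1).abs (fun _ => abs_nonneg _)
          (by positivity) x (c i)).trans ?_
        have := hγ0 i' (c i)
        gcongr
        exact hexp i' hi'
    · refine hx1.trans (le_of_eq ?_)
      rw [hN, hδ]; push_cast
      have e : (2 : ℝ) ^ (3 * v) = 2 ^ v * 2 ^ (2 * v) := by rw [← pow_add]; congr 1; ring
      rw [e]; field_simp
    · intro L hL
      exact hx2 L (Finset.mem_range.2 (by omega))
    · intro L hL j
      rw [← Finset.filter_filter]
      by_cases hj : j ∈ (G L).image m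
      · exact hx3 L (Finset.mem_range.2 (by omega)) j hj
      · rw [Finset.filter_false_of_mem, Finset.sum_empty, abs_zero]
        · positivity
        · intro i hi hij
          exact hj (Finset.mem_image.2 ⟨i, hi, hij⟩)
    · have : 0 ≤ D * δ := by positivity
      nlinarith
  set V := famV d n I with hV
  have hV0 : 0 ≤ V := famV_nonneg
  have hGI : ∀ L, G L ⊆ I := fun L => Finset.filter_subset _ _
  have m1 : volume E1 ≤ ENNReal.ofReal ((2 ^ v)⁻¹ * V) := by
    refine (cheb_one (Nice.sum fun i hi => cv_nice (lapG_integrable (by positivity))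
      (h.nice i hi).abs).int (by positivity)).trans (ENNReal.ofReal_le_ofReal ?_)
    rw [div_eq_inv_mul]
    gcongr
    exact h.integral_sum_lapG_le fun i => by positivity
  set q : ℝ := C0 * (2 ^ (20 * v))⁻¹ * (δ ^ 2)⁻¹ with hq
  have hq0 : 0 ≤ q := by positivity
  have m2 : ∀ L, volume (E2 L) ≤ ENNReal.ofReal (q * V) := fun L => by
    refine (hw hΩ hom h1 (h.mono (hGI L)) s (20 * v) (by omega) δ hδ0 hδ1).trans
      (ENNReal.ofReal_le_ofReal ?_)
    have := famV_mono (d := d) (n := n) (hGI L)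
    gcongr
  have ht1' : (1 : ℝ) ≤ t := by exact_mod_cast ht1
  have m3 : ∀ L, volume (⋃ j ∈ (G L).image m, E3 L j) ≤ ENNReal.ofReal (q * t ^ 2 * V) := fun L => by
    refine (measure_biUnion_finset_le _ _).trans ?_
    calc _ ≤ ∑ j ∈ (G L).image m, ENNReal.ofReal (q * t ^ 2 *
            famV d n ((G L).filter fun i => m i = j)) := by
          refine Finset.sum_le_sum fun j _ => ?_
          refine (hw hΩ hom h1 (h.mono ((Finset.filter_subset _ _).trans (hGI L))) s (20 * v)
            (by omega) (δ / t) (by positivity) ((div_le_one (by positivity)).2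
              (hδ1.trans ht1'))).trans (le_of_eq ?_)
          congr 1
          rw [hq, div_pow, inv_div]; ring
      _ = ENNReal.ofReal (q * t ^ 2 * famV d n (G L)) := by
          rw [← ENNReal.ofReal_sum_of_nonneg fun j _ =>
            mul_nonneg (by positivity) famV_nonneg, ← Finset.mul_sum, famV_fiber_le]
      _ ≤ _ := by
          refine ENNReal.ofReal_le_ofReal ?_
          have := famV_mono (d := d) (n := n) (hGI L)
          gcongr
  have htot : (2 ^ v)⁻¹ * V + ((N + 2 : ℕ) * (q * V) + (N + 2 : ℕ) * (q * t ^ 2 * V)) ≤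
      (2 + 3 * CK + D) * (2 ^ v)⁻¹ * V := by
    set X : ℝ := 2 ^ v with hX
    have hX1 : 1 ≤ X := one_le_pow₀ one_le_two
    have hX0 : 0 < X := by positivity
    have hNX : ((N + 2 : ℕ) : ℝ) ≤ 3 * X ^ 3 := by
      have : (1 : ℝ) ≤ X ^ 3 := one_le_pow₀ hX1
      rw [hN]; push_cast
      rw [mul_comm 3 v, pow_mul]; linarith
    have hqX : q = C0 * (X ^ 16)⁻¹ := by
      rw [hq, hδ, mul_comm 20 v, mul_comm 2 v, pow_mul, pow_mul, ← hX]
      field_simp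
    have htX : (t : ℝ) ≤ (3 + t0) * X := by
      have : (v : ℝ) ≤ X := by
        rw [hX]; exact_mod_cast (Nat.lt_two_pow_self (n := v)).le
      have h0 : (0 : ℝ) ≤ t0 := by positivity
      rw [ht]; push_cast; nlinarith
    have hY : X ^ 3 * (X ^ 16)⁻¹ * X ^ 2 ≤ X⁻¹ := by
      rw [show X ^ 3 * (X ^ 16)⁻¹ * X ^ 2 = (X ^ 11)⁻¹ by field_simp]
      exact inv_anti₀ hX0 (le_self_pow₀ hX1 (by norm_num))
    have hY' : X ^ 3 * (X ^ 16)⁻¹ ≤ X⁻¹ := by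
      refine le_trans (le_mul_of_one_le_right (by positivity) (one_le_pow₀ hX1)) hY
    calc _ ≤ X⁻¹ * V + (3 * X ^ 3 * (C0 * (X ^ 16)⁻¹ * V) +
          3 * X ^ 3 * (C0 * (X ^ 16)⁻¹ * ((3 + t0) * X) ^ 2 * V)) := by
          rw [hqX]; gcongr
      _ = X⁻¹ * V + (3 * C0 * (X ^ 3 * (X ^ 16)⁻¹) * V +
          3 * C0 * (3 + t0) ^ 2 * (X ^ 3 * (X ^ 16)⁻¹ * X ^ 2) * V) := by ring
      _ ≤ X⁻¹ * V + (3 * C0 * X⁻¹ * V + 3 * C0 * (3 + t0) ^ 2 * X⁻¹ * V) := by gcongr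
      _ = D * X⁻¹ * V := by rw [hD]; ring
      _ ≤ _ := by gcongr; linarith
  refine (measure_mono hsub).trans ?_
  refine (measure_union_le _ _).trans ?_
  refine (add_le_add m1 ((measure_union_le _ _).trans (add_le_add
    ((measure_biUnion_finset_le _ _).trans (Finset.sum_le_sum fun L _ => m2 L))
    ((measure_biUnion_finset_le _ _).trans (Finset.sum_le_sum fun L _ => m3 L))))).trans ?_
  rw [Finset.sum_const, Finset.sum_const, Finset.card_range, nsmul_eq_mul, nsmul_eq_mul,
    ← ENNReal.ofReal_natCast, ← ENNReal.ofReal_mul (by positivity),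
    ← ENNReal.ofReal_mul (by positivity), ← ENNReal.ofReal_add (by positivity) (by positivity),
    ← ENNReal.ofReal_add (by positivity) (by positivity)]
  exact ENNReal.ofReal_le_ofReal htot

end TruncatedFamily

section KernelSplitting

variable {d : ℕ} {Ω : Rd d → ℝ}

/-- The part of `Ω` of size at most `2 ^ v`. -/
def lowPart (Ω : Rd d → ℝ) (v : ℕ) (x : Rd d) : ℝ := if |Ω x| ≤ 2 ^ v then Ω x else 0

/-- The part of `Ω` of size larger than `2 ^ v`. -/
def highPart (Ω : Rd d → ℝ) (v : ℕ) (x : Rd d) : ℝ := if |Ω x| ≤ 2 ^ v then 0 else Ω x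

/-- The `L¹(S^{d-1})` norm of the part of `Ω` larger than `2 ^ v`. -/
def tailL1 (d : ℕ) (Ω : Rd d → ℝ) (v : ℕ) : ℝ := sphInt d fun x => |highPart Ω v x|

/-- The normalisation of `Ω` under which all core estimates have constants depending on `d`. -/
structure Normalized (d : ℕ) (Ω : Rd d → ℝ) : Prop where
  meas : Measurable Ω
  hom : Homogeneous0 d Ω
  int : Integrable (fun θ : sphere (0 : Rd d) 1 => Ω θ) (sphereMeasure d)
  l1 : sphInt d (fun x => |Ω x|) ≤ 1
  tail : ∀ S : ℕ, ∑ s ∈ Finset.range S, tailL1 d Ω (s / 80) ≤ 1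

theorem lowPart_add_highPart (Ω : Rd d → ℝ) (v : ℕ) (x : Rd d) :
    lowPart Ω v x + highPart Ω v x = Ω x := by
  unfold lowPart highPart; split_ifs <;> simp

theorem abs_lowPart_le (Ω : Rd d → ℝ) (v : ℕ) (x : Rd d) : |lowPart Ω v x| ≤ 2 ^ v := by
  unfold lowPart; split_ifs with h
  · exact h
  · rw [abs_zero]; positivity

theorem abs_lowPart_le_self (Ω : Rd d → ℝ) (v : ℕ) (x : Rd d) : |lowPart Ω v x| ≤ |Ω x| := by
  unfold lowPart; split_ifs with h
  · exact le_rfl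
  · rw [abs_zero]; positivity

theorem abs_highPart_le_self (Ω : Rd d → ℝ) (v : ℕ) (x : Rd d) : |highPart Ω v x| ≤ |Ω x| := by
  unfold highPart; split_ifs with h
  · rw [abs_zero]; positivity
  · exact le_rfl

theorem lowPart_measurable (hΩ : Measurable Ω) (v : ℕ) : Measurable (lowPart Ω v) :=
  Measurable.ite (measurableSet_le hΩ.abs measurable_const) hΩ measurable_const

theorem highPart_measurable (hΩ : Measurable Ω) (v : ℕ) : Measurable (highPart Ω v) :=
  Measurable.ite (measurableSet_le hΩ.abs measurable_const) measurable_const hΩ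

theorem lowPart_hom (hom : Homogeneous0 d Ω) (v : ℕ) : Homogeneous0 d (lowPart Ω v) :=
  fun x hx r hr => by simp only [lowPart, hom x hx r hr]

theorem highPart_hom (hom : Homogeneous0 d Ω) (v : ℕ) : Homogeneous0 d (highPart Ω v) :=
  fun x hx r hr => by simp only [highPart, hom x hx r hr]

theorem sphere_integrable_mono {Ω' : Rd d → ℝ}
    (hi : Integrable (fun θ : sphere (0 : Rd d) 1 => Ω θ) (sphereMeasure d))
    (hm : Measurable Ω') (h : ∀ x, |Ω' x| ≤ |Ω x|) :
    Integrable (fun θ : sphere (0 : Rd d) 1 => Ω' θ) (sphereMeasure d) :=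
  hi.mono (hm.comp measurable_subtype_coe).aestronglyMeasurable (.of_forall fun θ => h θ)

namespace Normalized

theorem int_low (h : Normalized d Ω) (v : ℕ) :
    Integrable (fun θ : sphere (0 : Rd d) 1 => lowPart Ω v θ) (sphereMeasure d) :=
  sphere_integrable_mono h.int (lowPart_measurable h.meas v) (abs_lowPart_le_self Ω v)

theorem int_high (h : Normalized d Ω) (v : ℕ) :
    Integrable (fun θ : sphere (0 : Rd d) 1 => highPart Ω v θ) (sphereMeasure d) :=
  sphere_integrable_mono h.int (highPart_measurable h.meas v) (abs_highPart_le_self Ω v)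

theorem KK_int (hd : 2 ≤ d) (h : Normalized d Ω) (j : ℤ) : Integrable (KK Ω j) :=
  KK_integrable hd h.meas h.hom h.int j

theorem KK_int_low (hd : 2 ≤ d) (h : Normalized d Ω) (v : ℕ) (j : ℤ) :
    Integrable (KK (lowPart Ω v) j) :=
  KK_integrable hd (lowPart_measurable h.meas v) (lowPart_hom h.hom v) (h.int_low v) j

theorem KK_int_high (hd : 2 ≤ d) (h : Normalized d Ω) (v : ℕ) (j : ℤ) :
    Integrable (KK (highPart Ω v) j) :=
  KK_integrable hd (highPart_measurable h.meas v) (highPart_hom h.hom v) (h.int_high v) j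

theorem integral_KK_high (hd : 2 ≤ d) (h : Normalized d Ω) (v : ℕ) (j : ℤ) :
    ∫ x, |KK (highPart Ω v) j x| ≤ 3 * tailL1 d Ω v :=
  KK_integral_abs hd (highPart_measurable h.meas v) (highPart_hom h.hom v) (h.int_high v) j

theorem integral_KK (hd : 2 ≤ d) (h : Normalized d Ω) (j : ℤ) : ∫ x, |KK Ω j x| ≤ 3 :=
  (KK_integral_abs hd h.meas h.hom h.int j).trans (by linarith [h.l1])

theorem cv_low_add_high (hd : 2 ≤ d) (h : Normalized d Ω) (v : ℕ) (j : ℤ) {g : Rd d → ℝ}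
    (hg : Nice g) (x : Rd d) :
    cv (KK Ω j) g x = cv (KK (lowPart Ω v) j) g x + cv (KK (highPart Ω v) j) g x := by
  rw [← cv_add_left (h.KK_int_low hd v j) (h.KK_int_high hd v j) hg]
  congr 1
  ext y
  rw [← KK_add]
  simp only [KK, lowPart_add_highPart]

protected theorem abs (h : Normalized d Ω) : Normalized d (fun x => |Ω x|) := by
  refine ⟨h.meas.abs, fun x hx r hr => by simp only [h.hom x hx r hr], h.int.abs, ?_, fun S => ?_⟩
  · simpa using h.l1
  · refine le_trans (le_of_eq ?_) (h.tail S)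
    refine Finset.sum_congr rfl fun s _ => ?_
    simp only [tailL1, highPart, abs_abs]
    congr 1
    ext x
    split_ifs <;> simp

end Normalized

theorem tailL1_nonneg (v : ℕ) : 0 ≤ tailL1 d Ω v := integral_nonneg fun _ => abs_nonneg _

theorem sum_half_pow_div_le {p : ℕ} (hp : 0 < p) (S : ℕ) :
    ∑ s ∈ Finset.range S, ((2 : ℝ) ^ (s / p))⁻¹ ≤ 2 * p := by
  have h : ∀ M : ℕ, ∑ s ∈ Finset.range (p * M), ((2 : ℝ) ^ (s / p))⁻¹ ≤ 2 * p - 2 * p * (2 ^ M)⁻¹ := by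
    intro M
    induction M with
    | zero => simp
    | succ M ih =>
      rw [Nat.mul_succ, Finset.sum_range_add]
      have e : ∑ x ∈ Finset.range p, ((2 : ℝ) ^ ((p * M + x) / p))⁻¹ = p * (2 ^ M)⁻¹ := by
        rw [Finset.sum_congr rfl (g := fun _ => ((2 : ℝ) ^ M)⁻¹)]
        · simp
        · intro x hx
          rw [Nat.mul_add_div hp, Nat.div_eq_of_lt (Finset.mem_range.1 hx), add_zero]
      rw [e, pow_succ, mul_inv]
      linarith
  calc _ ≤ ∑ s ∈ Finset.range (p * S), ((2 : ℝ) ^ (s / p))⁻¹ :=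
        Finset.sum_le_sum_of_subset_of_nonneg
          (Finset.range_subset_range.2 (Nat.le_mul_of_pos_left S hp)) fun _ _ _ => by positivity
    _ ≤ _ := (h S).trans (by have : (0 : ℝ) ≤ 2 * p * (2 ^ S)⁻¹ := by positivity
                             linarith)

end KernelSplitting

section BadPart

variable {d : ℕ} {Ω : Rd d → ℝ} {ι : Type*} {I : Finset ι} {n : ι → ℤ} {c : ι → Rd d}
  {Q : ι → Set (Rd d)} {b : ι → Rd d → ℝ}

theorem Fam.sum_cv_eq (hd : 2 ≤ d) (hΩ : Normalized d Ω) (h : Fam I n c Q b) {K : ℤ} {S : ℕ}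
    (hS : ∀ i ∈ I, K < n i + S) {x : Rd d} (hx : ∀ i ∈ I, (d + 2) * 2 ^ n i < ‖x - c i‖) (k : ℤ) :
    ∑ j ∈ Finset.Ioc k K, cv (KK Ω j) (fun y => ∑ i ∈ I, b i y) x =
      ∑ s ∈ Finset.range S, ∑ i ∈ I with k < n i + s ∧ n i + s ≤ K,
        cv (KK Ω (n i + s)) (b i) x := by
  simp_rw [cv_sum_right (hΩ.KK_int hd _) h.nice, Finset.sum_filter]
  rw [Finset.sum_comm, Finset.sum_comm (s := Finset.range S)]
  refine Finset.sum_congr rfl fun i hi => ?_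
  rw [← Finset.sum_filter]
  have e : ∑ j ∈ Finset.Ioc k K, cv (KK Ω j) (b i) x =
      ∑ j ∈ (Finset.Ioc k K).filter (fun j => n i ≤ j), cv (KK Ω j) (b i) x := by
    symm
    refine Finset.sum_subset (Finset.filter_subset _ _) fun j hj hn => ?_
    by_contra hne
    have h1 := h.norm_sub_le_of_cv_ne hi hne
    have h2 : j ≤ n i := by
      by_contra hc
      exact hn (Finset.mem_filter.2 ⟨hj, by omega⟩)
    have h3 : (2 : ℝ) ^ j ≤ 2 ^ n i := zpow_le_zpow_right₀ one_le_two h2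
    linarith [hx i hi]
  rw [e]
  symm
  refine Finset.sum_bij (fun s _ => n i + (s : ℤ)) ?_ ?_ ?_ ?_
  · intro s hs
    obtain ⟨h1, h2, h3⟩ := Finset.mem_filter.1 hs
    exact Finset.mem_filter.2 ⟨Finset.mem_Ioc.2 ⟨h2, h3⟩, by omega⟩
  · intro s _ s' _ hss; omega
  · intro j hj
    obtain ⟨h1, h2⟩ := Finset.mem_filter.1 hj
    rw [Finset.mem_Ioc] at h1
    have := hS i hi
    exact ⟨(j - n i).toNat, Finset.mem_filter.2 ⟨Finset.mem_range.2 (by omega), by omega, by omega⟩,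
      by omega⟩
  · intro s _; rfl

theorem bad_part_weak (hd : 2 ≤ d) : ∃ C : ℝ, 0 < C ∧ ∀ {Ω : Rd d → ℝ}, Normalized d Ω →
    ∀ {ι : Type*} {I : Finset ι} {n : ι → ℤ} {c : ι → Rd d}
    {Q : ι → Set (Rd d)} {b : ι → Rd d → ℝ}, Fam I n c Q b → ∀ K : ℤ,
    volume {x | (∀ i ∈ I, (d + 2) * 2 ^ n i < ‖x - c i‖) ∧ ∃ k : ℤ, C <
      |∑ j ∈ Finset.Ioc k K, cv (KK Ω j) (fun y => ∑ i ∈ I, b i y) x|} ≤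
      ENNReal.ofReal (C * famV d n I) := by
  obtain ⟨C0, hC0, hw⟩ := fam_truncated_weak hd
  refine ⟨1 + 320 * C0 + (3 + 160 * C0), by positivity, ?_⟩
  intro Ω hΩ ι I n c Q b h K
  obtain ⟨S, hS⟩ : ∃ S : ℕ, ∀ i ∈ I, K < n i + S := by
    refine ⟨∑ i ∈ I, ((K - n i).toNat + 1), fun i hi => ?_⟩
    have := Finset.single_le_sum (f := fun i => (K - n i).toNat + 1) (fun _ _ => Nat.zero_le _) hi
    omega
  set E1 : Set (Rd d) := {x | 1 < |∑ s ∈ Finset.range S, ∑ i ∈ I,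
    cv (fun y => |KK (highPart Ω (s / 80)) (n i + s) y|) (fun y => |b i y|) x|} with hE1
  set w : ℕ → Rd d → ℝ := fun v x => (2 ^ v)⁻¹ * lowPart Ω v x with hw'
  set E2 : ℕ → Set (Rd d) := fun s => {x | ∃ k : ℤ, C0 * ((2 : ℝ) ^ (2 * (s / 80)))⁻¹ <
      |∑ i ∈ I with k < n i + s, cv (KK (w (s / 80)) (n i + s)) (b i) x|} with hE2
  have hKh : ∀ i ∈ I, ∀ v j, Nice (cv (fun y => |KK (highPart Ω v) j y|) (fun y => |b i y|)) :=
    fun i hi v j => cv_nice (hΩ.KK_int_high hd v j).abs (h.nice i hi).abs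
  have hsub : {x | (∀ i ∈ I, (d + 2) * 2 ^ n i < ‖x - c i‖) ∧ ∃ k : ℤ,
      1 + 320 * C0 + (3 + 160 * C0) <
      |∑ j ∈ Finset.Ioc k K, cv (KK Ω j) (fun y => ∑ i ∈ I, b i y) x|} ⊆
      E1 ∪ ⋃ s ∈ Finset.range S, E2 s := by
    rintro x ⟨hx, k, hk⟩
    by_contra hc
    simp only [mem_union, mem_iUnion, not_or, not_exists] at hc
    obtain ⟨hc1, hc2⟩ := hc
    simp only [hE1, hE2, mem_ofPred_eq, not_lt, not_exists] at hc1 hc2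
    refine absurd hk (not_lt.2 ?_)
    rw [h.sum_cv_eq hd hΩ hS hx k]
    have hnn : ∀ s i, 0 ≤ cv (fun y => |KK (highPart Ω (s / 80)) (n i + s) y|)
        (fun y => |b i y|) x := fun s i =>
      cv_nonneg (fun _ => abs_nonneg _) (fun _ => abs_nonneg _) x
    rw [abs_of_nonneg (Finset.sum_nonneg fun s _ => Finset.sum_nonneg fun i _ => hnn s i)] at hc1
    have hs : ∀ s ∈ Finset.range S, |∑ i ∈ I with k < n i + s ∧ n i + s ≤ K,
        cv (KK Ω (n i + s)) (b i) x| ≤ 2 * C0 * (2 ^ (s / 80))⁻¹ + ∑ i ∈ I,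
        cv (fun y => |KK (highPart Ω (s / 80)) (n i + s) y|) (fun y => |b i y|) x := by
      intro s hs
      set v := s / 80 with hv
      have e1 : ∑ i ∈ I with k < n i + s ∧ n i + s ≤ K, cv (KK Ω (n i + s)) (b i) x =
          2 ^ v * (∑ i ∈ I with k < n i + s ∧ n i + s ≤ K, cv (KK (w v) (n i + s)) (b i) x) +
          ∑ i ∈ I with k < n i + s ∧ n i + s ≤ K, cv (KK (highPart Ω v) (n i + s)) (b i) x := by
        rw [Finset.mul_sum, ← Finset.sum_add_distrib]
        refine Finset.sum_congr rfl fun i hi => ?_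
        rw [hΩ.cv_low_add_high hd v _ (h.nice i (Finset.mem_filter.1 hi).1), ← cv_const_mul_left]
        congr 2
        ext y
        rw [← KK_const_mul]
        simp only [KK, hw']
        field_simp
      rw [e1]
      refine (abs_add_le _ _).trans (add_le_add ?_ ?_)
      · have e2 : ∑ i ∈ I with k < n i + s ∧ n i + s ≤ K, cv (KK (w v) (n i + s)) (b i) x =
            ∑ i ∈ I with min k K < n i + s, cv (KK (w v) (n i + s)) (b i) x -
            ∑ i ∈ I with K < n i + s, cv (KK (w v) (n i + s)) (b i) x := by
          rw [eq_sub_iff_add_eq, ← Finset.sum_filter_add_sum_filter_not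
            (I.filter (fun i => min k K < n i + s)) (fun i => n i + s ≤ K), Finset.filter_filter,
            Finset.filter_filter]
          congr 1
          · refine Finset.sum_congr (Finset.filter_congr fun i _ => ?_) fun _ _ => rfl
            omega
          · refine Finset.sum_congr (Finset.filter_congr fun i _ => ?_) fun _ _ => rfl
            omega
        have hb := fun k' => hc2 s hs k'
        rw [e2, abs_mul, abs_of_nonneg (by positivity)]
        calc _ ≤ (2 : ℝ) ^ v * (C0 * (2 ^ (2 * v))⁻¹ + C0 * (2 ^ (2 * v))⁻¹) := by
              gcongr
              exact (abs_sub _ _).trans (add_le_add (hb _) (hb _))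
          _ = _ := by
              rw [mul_comm 2 v, pow_mul]
              field_simp; ring
      · refine (Finset.abs_sum_le_sum_abs _ _).trans ?_
        refine (Finset.sum_le_sum fun i _ => abs_cv_le _ _ _).trans ?_
        exact Finset.sum_le_sum_of_subset_of_nonneg (Finset.filter_subset _ _)
          fun i _ _ => hnn s i
    refine (Finset.abs_sum_le_sum_abs _ _).trans ((Finset.sum_le_sum hs).trans ?_)
    rw [Finset.sum_add_distrib, ← Finset.mul_sum]
    have := sum_half_pow_div_le (p := 80) (by norm_num) S
    push_cast at this
    nlinarith
  have hV : 0 ≤ famV d n I := famV_nonneg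
  have m1 : volume E1 ≤ ENNReal.ofReal (3 * famV d n I) := by
    refine (cheb_one (Nice.sum fun s _ => Nice.sum fun i hi => hKh i hi _ _).int one_pos).trans
      (ENNReal.ofReal_le_ofReal ?_)
    rw [div_one]
    calc _ ≤ ∫ x, ∑ s ∈ Finset.range S, ∑ i ∈ I,
          |cv (fun y => |KK (highPart Ω (s / 80)) (n i + s) y|) (fun y => |b i y|) x| := by
          refine integral_mono (Nice.sum fun s _ => Nice.sum fun i hi => hKh i hi _ _).int.abs
            (integrable_finsetSum _ fun s _ => integrable_finsetSum _ fun i hi =>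
              (hKh i hi _ _).int.abs) fun x => ?_
          exact (Finset.abs_sum_le_sum_abs _ _).trans (Finset.sum_le_sum fun s _ =>
            Finset.abs_sum_le_sum_abs _ _)
      _ = ∑ s ∈ Finset.range S, ∑ i ∈ I, ∫ x,
          |cv (fun y => |KK (highPart Ω (s / 80)) (n i + s) y|) (fun y => |b i y|) x| := by
          rw [integral_finsetSum _ fun s _ => integrable_finsetSum _ fun i hi =>
              (hKh i hi _ _).int.abs]
          exact Finset.sum_congr rfl fun s _ => integral_finsetSum _ fun i hi =>
            (hKh i hi _ _).int.abs
      _ ≤ ∑ s ∈ Finset.range S, ∑ i ∈ I, 3 * tailL1 d Ω (s / 80) * ((2 : ℝ) ^ n i) ^ d := by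
          refine Finset.sum_le_sum fun s _ => Finset.sum_le_sum fun i hi => ?_
          refine (integral_abs_cv_le (hΩ.KK_int_high hd _ _).abs (h.nice i hi).abs.int).trans ?_
          simp only [abs_abs]
          have := tailL1_nonneg (d := d) (Ω := Ω) (s / 80)
          gcongr
          · exact hΩ.integral_KK_high hd _ _
          · exact h.lone i hi
      _ = 3 * (∑ s ∈ Finset.range S, tailL1 d Ω (s / 80)) * famV d n I := by
          simp only [famV, Finset.mul_sum, Finset.sum_mul]
          exact Finset.sum_comm
      _ ≤ 3 * 1 * famV d n I := by
          gcongr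
          exact hΩ.tail S
      _ = _ := by ring
  have m2 : ∀ s, volume (E2 s) ≤ ENNReal.ofReal (C0 * (2 ^ (s / 80))⁻¹ * famV d n I) := fun s => by
    refine hw (Ω := w (s / 80)) ((lowPart_measurable hΩ.meas _).const_mul _)
      (fun x hx r hr => ?_) (fun x => ?_) h s (s / 80) (by omega)
    · simp only [hw', lowPart_hom hΩ.hom _ x hx r hr]
    · simp only [hw']
      rw [abs_mul, abs_of_nonneg (by positivity), inv_mul_le_iff₀ (by positivity), mul_one]
      exact abs_lowPart_le _ _ _
  refine (measure_mono hsub).trans ((measure_union_le _ _).trans ((add_le_add m1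
    ((measure_biUnion_finset_le _ _).trans (Finset.sum_le_sum fun s _ => m2 s))).trans ?_))
  rw [← ENNReal.ofReal_sum_of_nonneg fun s _ => by positivity,
    ← ENNReal.ofReal_add (by positivity) (Finset.sum_nonneg fun s _ => by positivity)]
  refine ENNReal.ofReal_le_ofReal ?_
  rw [← Finset.sum_mul, ← Finset.mul_sum]
  have := sum_half_pow_div_le (p := 80) (by norm_num) S
  push_cast at this
  have h3 : C0 * (∑ i ∈ Finset.range S, ((2 : ℝ) ^ (i / 80))⁻¹) * famV d n I ≤
      C0 * (2 * 80) * famV d n I := by gcongr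
  nlinarith [mul_nonneg hC0.le hV]

end BadPart

section SquareFunctions

variable {d : ℕ}

theorem sum_integral_cv_sq_le {κ : Type*} {s : Finset κ} {k : κ → Rd d → ℝ} {g : Rd d → ℝ}
    (hk : ∀ i ∈ s, Integrable (k i)) (hg : Nice g) {B : ℝ}
    (hB : ∀ ξ, ∑ i ∈ s, ‖ft (k i) ξ‖ ^ 2 ≤ B) :
    ∑ i ∈ s, ∫ x, cv (k i) g x ^ 2 ≤ B * ∫ x, g x ^ 2 := by
  calc _ = ∑ i ∈ s, ∫ ξ, ‖ft (cv (k i) g) ξ‖ ^ 2 :=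
        Finset.sum_congr rfl fun i hi => (plancherel (cv_nice (hk i hi) hg)).2.symm
    _ = ∫ ξ, ∑ i ∈ s, ‖ft (cv (k i) g) ξ‖ ^ 2 :=
        (integral_finsetSum _ fun i hi => (plancherel (cv_nice (hk i hi) hg)).1).symm
    _ ≤ ∫ ξ, B * ‖ft g ξ‖ ^ 2 := by
        refine integral_mono (integrable_finsetSum _ fun i hi =>
          (plancherel (cv_nice (hk i hi) hg)).1) ((plancherel hg).1.const_mul _) fun ξ => ?_
        simp only
        calc ∑ i ∈ s, ‖ft (cv (k i) g) ξ‖ ^ 2 = (∑ i ∈ s, ‖ft (k i) ξ‖ ^ 2) * ‖ft g ξ‖ ^ 2 := by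
              rw [Finset.sum_mul]
              refine Finset.sum_congr rfl fun i hi => ?_
              rw [ft_cv (hk i hi) hg.int, norm_mul, mul_pow]
          _ ≤ _ := by gcongr; exact hB ξ
    _ = _ := by rw [integral_const_mul, (plancherel hg).2]

theorem integral_cv_sq_le {k g : Rd d → ℝ} (hk : Integrable k) (hg : Nice g) {B : ℝ}
    (hB : ∀ ξ, ‖ft k ξ‖ ≤ B) : ∫ x, cv k g x ^ 2 ≤ B ^ 2 * ∫ x, g x ^ 2 := by
  have := sum_integral_cv_sq_le (s := {()}) (k := fun _ => k) (fun _ _ => hk) hg (B := B ^ 2)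
    fun ξ => by rw [Finset.sum_singleton]; exact pow_le_pow_left₀ (norm_nonneg _) (hB ξ) 2
  simpa using this

end SquareFunctions

section KernelMultiplier

variable {d : ℕ} {Ω : Rd d → ℝ}

theorem norm_ft_KK_le (hd : 2 ≤ d) : ∃ C : ℝ, 0 < C ∧ ∀ {Ω : Rd d → ℝ}, Measurable Ω →
    Homogeneous0 d Ω → ∀ {M : ℝ}, 0 ≤ M → (∀ x, |Ω x| ≤ M) → ∀ (j : ℤ) (ξ : Rd d), ξ ≠ 0 →
    ‖ft (KK Ω j) ξ‖ ≤ C * M / √(2 ^ j * ‖ξ‖) := by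
  obtain ⟨C, hC, hdec⟩ := hhat_decay 1
  refine ⟨C * (2 * (d * 2 ^ d)), by positivity, ?_⟩
  intro Ω hΩ hom M hM0 hM j ξ hξ
  have hn : 0 < ‖ξ‖ := norm_pos_iff.2 hξ
  set e : Rd d := (‖ξ‖)⁻¹ • ξ with he
  have he1 : ‖e‖ = 1 := by rw [he, norm_smul, norm_inv, norm_norm, inv_mul_cancel₀ hn.ne']
  set ρ : ℝ := 2 ^ j * ‖ξ‖ with hρ
  have hρ0 : 0 < ρ := by positivity
  have hs0 : 0 < √ρ := Real.sqrt_pos.2 hρ0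
  have hss : √ρ * √ρ = ρ := Real.mul_self_sqrt hρ0.le
  set δ : ℝ := (√ρ)⁻¹ with hδ
  have hδ0 : 0 < δ := by positivity
  have hinner : ∀ θ : sphere (0 : Rd d) 1, 2 ^ j * inner ℝ (θ : Rd d) ξ =
      ρ * inner ℝ e (θ : Rd d) := fun θ => by
    rw [he, hρ, real_inner_smul_left, real_inner_comm]; field_simp
  set B : Set (sphere (0 : Rd d) 1) := {θ | |inner ℝ e (θ : Rd d)| ≤ δ} with hB
  have hBm : MeasurableSet B := measurableSet_le (by fun_prop) (by fun_prop)
  rw [ft_KK hd hΩ hom (sphere_integrable_of_bdd hΩ hM)]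
  have hpt : ∀ θ : sphere (0 : Rd d) 1, ‖(Ω θ : ℂ) * hhat (2 ^ j * inner ℝ (θ : Rd d) ξ)‖ ≤
      B.indicator (fun _ => M * C) θ + M * C * δ := by
    intro θ
    rw [norm_mul, Complex.norm_real, Real.norm_eq_abs, hinner]
    have h1 := hdec (ρ * inner ℝ e (θ : Rd d))
    rw [pow_one, abs_mul, abs_of_pos hρ0] at h1
    have h2 : |Ω θ| * ‖hhat (ρ * inner ℝ e (θ : Rd d))‖ ≤
        M * (C / (1 + ρ * |inner ℝ e (θ : Rd d)|)) :=
      mul_le_mul (hM θ) h1 (norm_nonneg _) hM0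
    refine h2.trans ?_
    by_cases hθ : θ ∈ B
    · rw [indicator_of_mem hθ]
      have : C / (1 + ρ * |inner ℝ e (θ : Rd d)|) ≤ C :=
        div_le_self hC.le (by have : 0 ≤ ρ * |inner ℝ e (θ : Rd d)| := by positivity
                              linarith)
      have h3 : 0 ≤ M * C * δ := by positivity
      nlinarith
    · rw [indicator_of_notMem hθ, zero_add, mul_assoc M]
      have hθ : δ < |inner ℝ e (θ : Rd d)| := not_le.1 hθ
      refine mul_le_mul_of_nonneg_left ?_ hM0
      rw [div_eq_mul_inv, hδ]
      gcongr
      have h4 : ρ * δ = √ρ := by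
        rw [hδ, ← div_eq_mul_inv, div_eq_iff hs0.ne', hss]
      have h5 : ρ * δ ≤ ρ * |inner ℝ e (θ : Rd d)| := by gcongr
      linarith
  have hI : Integrable (fun θ => B.indicator (fun _ => M * C) θ + M * C * δ) (sphereMeasure d) :=
    ((integrable_const _).indicator hBm).add (integrable_const _)
  refine (norm_integral_le_of_norm_le hI (.of_forall hpt)).trans ?_
  rw [integral_add ((integrable_const _).indicator hBm) (integrable_const _),
    integral_indicator hBm, setIntegral_const, integral_const, smul_eq_mul, smul_eq_mul]
  have b1 : (sphereMeasure d).real B ≤ d * 2 ^ d * δ :=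
    ENNReal.toReal_le_of_le_ofReal (by positivity) (band_measure hd he1 hδ0.le)
  have b2 : (sphereMeasure d).real univ ≤ d * 2 ^ d :=
    ENNReal.toReal_le_of_le_ofReal (by positivity) (sphere_measure_univ_le hd)
  calc _ ≤ (d * 2 ^ d * δ) * (M * C) + (d * 2 ^ d) * (M * C * δ) := by gcongr
    _ = _ := by rw [hδ]; ring

theorem norm_ft_low_le (hd : 2 ≤ d) : ∃ C : ℝ, 0 < C ∧ ∀ {Ω : Rd d → ℝ}, Normalized d Ω →
    ∀ (m : ℕ) (j : ℤ) (ξ : Rd d), ξ ≠ 0 →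
    ‖ft (KK (lowPart Ω (m / 80)) j) ξ‖ ≤ C * 2 ^ (m / 80) / √(2 ^ j * ‖ξ‖) := by
  obtain ⟨C, hC, h⟩ := norm_ft_KK_le hd
  exact ⟨C, hC, fun hΩ m j ξ hξ => h (lowPart_measurable hΩ.meas _) (lowPart_hom hΩ.hom _)
    (by positivity) (abs_lowPart_le _ _) j ξ hξ⟩

theorem integral_KK_eq_zero (hd : 2 ≤ d) (hΩ : Normalized d Ω)
    (h0 : ∫ θ : sphere (0 : Rd d) 1, Ω θ ∂(sphereMeasure d) = 0) (j : ℤ) :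
    ∫ x, KK Ω j x = 0 := by
  have h1 := ft_KK hd hΩ.meas hΩ.hom hΩ.int j 0
  simp only [inner_zero_right, mul_zero] at h1
  rw [integral_mul_const, integral_complex_ofReal, h0, Complex.ofReal_zero, zero_mul, ft_eq] at h1
  simp only [inner_zero_right, mul_zero, Complex.ofReal_zero, zero_mul, Complex.exp_zero,
    one_mul] at h1
  rw [integral_complex_ofReal] at h1
  exact_mod_cast h1

theorem sum_norm_ft_KK_le (hd : 2 ≤ d) : ∃ C : ℝ, 0 < C ∧ ∀ {Ω : Rd d → ℝ}, Normalized d Ω →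
    ∫ θ : sphere (0 : Rd d) 1, Ω θ ∂(sphereMeasure d) = 0 → ∀ (s : Finset ℤ) (ξ : Rd d),
    ∑ j ∈ s, ‖ft (KK Ω j) ξ‖ ≤ C := by
  obtain ⟨C, hC, hlow⟩ := norm_ft_low_le hd
  refine ⟨24 * Real.pi * 4 + (3 + C * 160), by positivity, ?_⟩
  intro Ω hΩ h0 s ξ
  have hsmall : ∀ j : ℤ, ‖ft (KK Ω j) ξ‖ ≤ 12 * Real.pi * (2 ^ j * ‖ξ‖) := by
    intro j
    have h1 := norm_ft_sub_integral_le (ρ := 2 * 2 ^ j) (hΩ.KK_int hd j)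
      (fun x hx => KK_eq_zero_of_ge hx.le) ξ
    rw [integral_KK_eq_zero hd hΩ h0 j, Complex.ofReal_zero, sub_zero] at h1
    refine h1.trans ?_
    have h2 := hΩ.integral_KK hd j
    calc _ ≤ 2 * Real.pi * (2 * 2 ^ j) * ‖ξ‖ * 3 := by gcongr
      _ = _ := by ring
  rcases eq_or_ne ξ 0 with rfl | hξ
  · have : ∀ j ∈ s, ‖ft (KK Ω j) (0 : Rd d)‖ ≤ 0 := fun j _ => by simpa using hsmall j
    exact (Finset.sum_nonpos this).trans (by positivity)
  obtain ⟨a, ha1, ha2⟩ := exists_mem_Ico_zpow (norm_pos_iff.2 hξ) (one_lt_two)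
  rw [← Finset.sum_filter_add_sum_filter_not s (fun j => j + a < 0)]
  refine add_le_add ?_ ?_
  · calc _ ≤ ∑ j ∈ s with j + a < 0, 24 * Real.pi * (1 / 2 : ℝ) ^ (j + a).natAbs := by
          refine Finset.sum_le_sum fun j hj => ?_
          have hj := (Finset.mem_filter.1 hj).2
          have e : (1 / 2 : ℝ) ^ (j + a).natAbs = 2 ^ (j + a) := by
            rw [one_div, inv_pow, ← zpow_natCast, ← zpow_neg]
            congr 1; omega
          rw [e, zpow_add₀ two_ne_zero]
          refine (hsmall j).trans ?_
          rw [zpow_add_one₀ two_ne_zero] at ha2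
          calc _ ≤ 12 * Real.pi * (2 ^ j * (2 ^ a * 2)) := by gcongr
            _ = _ := by ring
      _ ≤ _ := by
          rw [← Finset.mul_sum]
          gcongr
          exact sum_half_natAbs_le _ a
  · set T := s.filter (fun j => ¬ j + a < 0) with hT
    have hterm : ∀ j ∈ T, ‖ft (KK Ω j) ξ‖ ≤ (fun m : ℕ => 3 * tailL1 d Ω (m / 80) +
        C * (2 ^ (m / 80))⁻¹) (j + a).toNat := by
      intro j hj
      have hj := (Finset.mem_filter.1 hj).2
      set m := (j + a).toNat with hm
      set v := m / 80 with hv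
      have e1 : KK Ω j = fun x => KK (lowPart Ω v) j x + KK (highPart Ω v) j x := by
        ext x
        rw [← KK_add]; simp only [KK, lowPart_add_highPart]
      rw [e1, ft_add (hΩ.KK_int_low hd v j) (hΩ.KK_int_high hd v j)]
      simp only
      rw [add_comm (3 * tailL1 d Ω (m / 80))]
      refine (norm_add_le _ _).trans (add_le_add ?_ ((norm_ft_le _ _).trans
        (hΩ.integral_KK_high hd v j)))
      refine (hlow hΩ m j ξ hξ).trans ?_
      rw [← hv, mul_div_assoc]
      gcongr
      have h3 : (2 : ℝ) ^ (2 * v) ≤ √(2 ^ j * ‖ξ‖) := by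
        apply Real.le_sqrt_of_sq_le
        calc ((2 : ℝ) ^ (2 * v)) ^ 2 = 2 ^ (4 * v) := by rw [← pow_mul]; congr 1; ring
          _ ≤ 2 ^ m := pow_le_pow_right₀ one_le_two (by omega)
          _ = 2 ^ j * 2 ^ a := by
              rw [← zpow_natCast, ← zpow_add₀ two_ne_zero]; congr 1; omega
          _ ≤ _ := by gcongr
      rw [div_le_iff₀ (by positivity)]
      calc (2 : ℝ) ^ v = (2 ^ v)⁻¹ * 2 ^ (2 * v) := by
            rw [two_mul, pow_add]; field_simp
        _ ≤ _ := by gcongr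
    have hinj : Set.InjOn (fun j : ℤ => (j + a).toNat) T := by
      intro j hj j' hj' hjj
      have h1 := (Finset.mem_filter.1 hj).2
      have h2 := (Finset.mem_filter.1 hj').2
      simp only at hjj
      omega
    obtain ⟨S, hS⟩ := (T.image fun j => (j + a).toNat).exists_nat_subset_range
    refine (Finset.sum_le_sum hterm).trans ?_
    rw [← Finset.sum_image (f := fun m : ℕ => 3 * tailL1 d Ω (m / 80) + C * ((2 : ℝ) ^ (m / 80))⁻¹)
      hinj]
    refine (Finset.sum_le_sum_of_subset_of_nonneg hS fun m _ _ => ?_).trans ?_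
    · have := tailL1_nonneg (d := d) (Ω := Ω) (m / 80)
      positivity
    · rw [Finset.sum_add_distrib, ← Finset.mul_sum, ← Finset.mul_sum]
      have h1 := hΩ.tail S
      have h2 := sum_half_pow_div_le (p := 80) (by norm_num) S
      push_cast at h2
      have h3 := mul_le_mul_of_nonneg_left h2 hC.le
      linarith

end KernelMultiplier

section TentMaximal

variable {d : ℕ}

theorem volume_closedBall_le (x : Rd d) {r : ℝ} (hr : 0 ≤ r) :
    volume (closedBall x r) = ENNReal.ofReal (r ^ d) * volume (ball (0 : Rd d) 1) := by
  rw [Measure.addHaar_closedBall _ _ hr, finrank_Rd]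

/-- Weak type `(1,1)` bound for the maximal function of tent averages at dyadic scales. -/
theorem tent_maximal_weak (h : Rd d → ℝ) (hh : Integrable h) (h0 : ∀ x, 0 ≤ h x) (k0 K : ℤ) :
    volume {x | ∃ k, k0 ≤ k ∧ k ≤ K ∧ 1 < cv (tent (2 ^ k)) h x} ≤
      ENNReal.ofReal (5 ^ d * volume.real (ball (0 : Rd d) 1) * cTent d * ∫ x, h x) := by
  classical
  have hc := cTent_pos (d := d)
  set A : Set (Rd d) := {x | ∃ k, k0 ≤ k ∧ k ≤ K ∧ 1 < cv (tent (2 ^ k)) h x} with hA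
  have hex : ∀ x : Rd d, ∃ k : ℤ, x ∈ A → k0 ≤ k ∧ k ≤ K ∧ 1 < cv (tent (2 ^ k)) h x := by
    intro x
    by_cases hx : x ∈ A
    · obtain ⟨k, hk⟩ := hx
      exact ⟨k, fun _ => hk⟩
    · exact ⟨0, fun h => absurd h hx⟩
  choose κ hκ using hex
  have hr0 : ∀ x, (0 : ℝ) < 2 ^ κ x := fun x => by positivity
  have hball : ∀ x ∈ A, ((2 : ℝ) ^ κ x) ^ d ≤ cTent d * ∫ y in closedBall x (2 ^ κ x), h y := by
    intro x hx
    have h1 := (hκ x hx).2.2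
    have h2 : cv (tent (2 ^ κ x)) h x ≤
        ∫ y, (closedBall x (2 ^ κ x)).indicator (fun y => cTent d * (((2 : ℝ) ^ κ x) ^ d)⁻¹ * h y) y := by
      refine integral_mono_of_nonneg (.of_forall fun y => mul_nonneg (tent_nonneg (hr0 x) _) (h0 y))
        ((hh.const_mul _).indicator measurableSet_closedBall) (.of_forall fun y => ?_)
      by_cases hy : y ∈ closedBall x (2 ^ κ x)
      · simp only [indicator_of_mem hy]
        exact mul_le_mul_of_nonneg_right (tent_le (hr0 x) _) (h0 y)
      · simp only [indicator_of_notMem hy]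
        rw [mem_closedBall, dist_eq_norm, not_le, norm_sub_rev] at hy
        rw [tent_eq_zero (hr0 x) hy.le, zero_mul]
    rw [integral_indicator measurableSet_closedBall, integral_const_mul] at h2
    have h3 : (0 : ℝ) < ((2 : ℝ) ^ κ x) ^ d := by positivity
    have h4 := h1.trans_le h2
    rw [mul_comm (cTent d), mul_assoc, ← div_eq_inv_mul, one_lt_div h3] at h4
    exact h4.le
  obtain ⟨u, hu, hdis, hcov⟩ := Vitali.exists_disjoint_subfamily_covering_enlargement_closedBall
    A (fun x => x) (fun x => (2 : ℝ) ^ κ x) (2 ^ K)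
    (fun x hx => zpow_le_zpow_right₀ one_le_two (hκ x hx).2.1) 5 (by norm_num)
  have hcount : u.Countable := by
    refine hdis.countable_of_nonempty_interior fun x _ => ?_
    rw [interior_closedBall _ (hr0 x).ne']
    exact nonempty_ball.2 (hr0 x)
  have hsub : A ⊆ ⋃ b ∈ u, closedBall b (5 * 2 ^ κ b) := by
    intro x hx
    obtain ⟨b, hb, hxb⟩ := hcov x hx
    exact mem_biUnion hb (hxb (mem_closedBall_self (hr0 x).le))
  have hV : volume (ball (0 : Rd d) 1) = ENNReal.ofReal (volume.real (ball (0 : Rd d) 1)) :=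
    (ENNReal.ofReal_toReal measure_ball_lt_top.ne).symm
  set V := volume.real (ball (0 : Rd d) 1) with hVdef
  have hV0 : 0 ≤ V := measureReal_nonneg
  have hone : ∀ b ∈ u, volume (closedBall b (5 * 2 ^ κ b)) ≤
      ENNReal.ofReal (5 ^ d * V * cTent d) * ∫⁻ y in closedBall b (2 ^ κ b), ENNReal.ofReal (h y) := by
    intro b hb
    rw [volume_closedBall_le _ (by positivity), hV, ← ENNReal.ofReal_mul (by positivity),
      ← ofReal_integral_eq_lintegral_ofReal hh.integrableOn (.of_forall h0),
      ← ENNReal.ofReal_mul (by positivity)]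
    refine ENNReal.ofReal_le_ofReal ?_
    have := mul_le_mul_of_nonneg_left (hball b (hu hb)) (show 0 ≤ 5 ^ d * V by positivity)
    rw [mul_pow]
    linarith
  have : Countable u := hcount.to_subtype
  calc volume A ≤ ∑' b : u, volume (closedBall (b : Rd d) (5 * 2 ^ κ b)) :=
        (measure_mono hsub).trans (measure_biUnion_le _ hcount _)
    _ ≤ ∑' b : u, ENNReal.ofReal (5 ^ d * V * cTent d) *
        ∫⁻ y in closedBall (b : Rd d) (2 ^ κ b), ENNReal.ofReal (h y) :=
        ENNReal.tsum_le_tsum fun b => hone b b.2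
    _ = ENNReal.ofReal (5 ^ d * V * cTent d) *
        ∫⁻ y in ⋃ b : u, closedBall (b : Rd d) (2 ^ κ b), ENNReal.ofReal (h y) := by
        rw [ENNReal.tsum_mul_left, lintegral_iUnion (fun _ => measurableSet_closedBall)]
        intro a b hab
        exact hdis a.2 b.2 fun e => hab (Subtype.ext e)
    _ ≤ ENNReal.ofReal (5 ^ d * V * cTent d) * ∫⁻ y, ENNReal.ofReal (h y) := by
        gcongr; exact Measure.restrict_le_self
    _ = _ := by
        rw [← ofReal_integral_eq_lintegral_ofReal hh (.of_forall h0),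
          ← ENNReal.ofReal_mul (by positivity)]

theorem one_lt_cv_sq {k h : Rd d → ℝ} (hk : Integrable k) (k0 : ∀ x, 0 ≤ k x)
    (k1 : ∫ x, k x = 1) (hh : Nice h) {x : Rd d} (hx : 1 < |cv k h x|) :
    1 < cv k (fun y => h y ^ 2) x := by
  have h1 := hx.trans_le (abs_cv_le k h x)
  simp only [abs_of_nonneg (k0 _)] at h1
  have h2 : cv k (fun y => |h y|) x ≤ ∫ y, (1 / 2 * k (x - y) + 1 / 2 * (k (x - y) * h y ^ 2)) := by
    refine integral_mono (cv_integrand hk hh.abs x) (((hk.comp_sub_left x).const_mul _).add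
      ((cv_integrand hk hh.sq x).const_mul _)) fun y => ?_
    simp only
    have := k0 (x - y)
    nlinarith [mul_nonneg this (sq_nonneg (|h y| - 1)), sq_abs (h y)]
  rw [integral_add ((hk.comp_sub_left x).const_mul _) ((cv_integrand hk hh.sq x).const_mul _),
    integral_const_mul, integral_const_mul, integral_sub_left_eq_self, k1] at h2
  have : cv k (fun y => h y ^ 2) x = ∫ y, k (x - y) * h y ^ 2 := rfl
  linarith

theorem tent_maximal_weak_two (h : Rd d → ℝ) (hh : Nice h) (k0 K : ℤ) :
    volume {x | ∃ k, k0 ≤ k ∧ k ≤ K ∧ 1 < |cv (tent (2 ^ k)) h x|} ≤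
      ENNReal.ofReal (5 ^ d * volume.real (ball (0 : Rd d) 1) * cTent d * ∫ x, h x ^ 2) := by
  refine (measure_mono ?_).trans (tent_maximal_weak (fun x => h x ^ 2) hh.sq.int
    (fun x => sq_nonneg _) k0 K)
  rintro x ⟨k, h1, h2, h3⟩
  have h4 : (0 : ℝ) < 2 ^ k := by positivity
  exact ⟨k, h1, h2, one_lt_cv_sq (tent_integrable h4) (tent_nonneg h4) (integral_tent h4) hh h3⟩

end TentMaximal

section GoodPart

variable {d : ℕ} {Ω : Rd d → ℝ}

theorem sum_norm_ft_remainder_le (hd : 2 ≤ d) : ∃ C : ℝ, 0 < C ∧ ∀ {Ω : Rd d → ℝ},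
    Normalized d Ω → ∀ (m : ℕ) (s : Finset ℤ) (ξ : Rd d),
    ∑ k ∈ s, ‖ft (fun y => KK (lowPart Ω (m / 80)) (k + m) y -
      cv (tent (2 ^ k)) (KK (lowPart Ω (m / 80)) (k + m)) y) ξ‖ ^ 2 ≤
      C * (4 ^ (m / 80) * (2 ^ m)⁻¹) := by
  obtain ⟨C, hC, hlow⟩ := norm_ft_low_le hd
  refine ⟨4 * Real.pi ^ 2 * C ^ 2 * 8, by positivity, ?_⟩
  intro Ω hΩ m s ξ
  set v := m / 80 with hv
  have hft : ∀ k : ℤ, ft (fun y => KK (lowPart Ω v) (k + m) y -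
      cv (tent (2 ^ k)) (KK (lowPart Ω v) (k + m)) y) ξ =
      (1 - ft (tent (2 ^ k)) ξ) * ft (KK (lowPart Ω v) (k + m)) ξ := by
    intro k
    have ht : (0 : ℝ) < 2 ^ k := by positivity
    have hK := hΩ.KK_int_low hd v (k + m)
    rw [ft_sub hK (cv_integrable (tent_integrable ht) hK), ft_cv (tent_integrable ht) hK]
    ring
  simp_rw [hft, norm_mul, mul_pow]
  by_cases hξ : ξ = 0
  · have : ∀ k : ℤ, ‖1 - ft (tent (2 ^ k)) ξ‖ = 0 := fun k => by
      refine le_antisymm ?_ (norm_nonneg _)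
      have := norm_one_sub_ft_tent_le (d := d) (t := 2 ^ k) (by positivity) ξ
      rwa [hξ, norm_zero, mul_zero, ← hξ] at this
    simp_rw [this]
    simp only [ne_eq, OfNat.ofNat_ne_zero, not_false_eq_true, zero_pow, zero_mul,
      Finset.sum_const_zero]
    positivity
  have hn : 0 < ‖ξ‖ := norm_pos_iff.2 hξ
  have hterm : ∀ k ∈ s, ‖1 - ft (tent (2 ^ k)) ξ‖ ^ 2 * ‖ft (KK (lowPart Ω v) (k + m)) ξ‖ ^ 2 ≤
      4 * Real.pi ^ 2 * C ^ 2 * (4 ^ v * (2 ^ m)⁻¹) *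
        min ((2 : ℝ) ^ k * ‖ξ‖) (1 / ((2 : ℝ) ^ k * ‖ξ‖)) := by
    intro k _
    have ht : (0 : ℝ) < 2 ^ k := by positivity
    set z : ℝ := 2 ^ k * ‖ξ‖ with hz
    have hz0 : 0 < z := by positivity
    have h1 : ‖ft (KK (lowPart Ω v) (k + m)) ξ‖ ^ 2 ≤ C ^ 2 * (4 ^ v * (2 ^ m)⁻¹) * (1 / z) := by
      have h2 := pow_le_pow_left₀ (norm_nonneg _) (hlow hΩ m (k + m) ξ hξ) 2
      have h3 : (2 : ℝ) ^ (k + m : ℤ) * ‖ξ‖ = 2 ^ m * z := by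
        rw [zpow_add₀ two_ne_zero, zpow_natCast, hz]; ring
      rw [← hv, h3, div_pow, Real.sq_sqrt (by positivity), mul_pow, ← pow_mul, mul_comm v 2,
        pow_mul] at h2
      refine h2.trans (le_of_eq ?_)
      norm_num
      field_simp
    have h4 : ‖1 - ft (tent (d := d) (2 ^ k)) ξ‖ ^ 2 * (1 / z) ≤
        4 * Real.pi ^ 2 * min z (1 / z) := by
      rcases le_total z (1 / z) with h | h
      · rw [min_eq_left h]
        have h5 := pow_le_pow_left₀ (norm_nonneg _) (norm_one_sub_ft_tent_le (d := d) ht ξ) 2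
        calc _ ≤ (2 * Real.pi * 2 ^ k * ‖ξ‖) ^ 2 * (1 / z) := by gcongr
          _ = (2 * Real.pi * z) ^ 2 * (1 / z) := by rw [hz]; ring
          _ = _ := by field_simp; ring
      · rw [min_eq_right h]
        refine mul_le_mul_of_nonneg_right ?_ (by positivity)
        have h5 := pow_le_pow_left₀ (norm_nonneg _) (norm_one_sub_ft_tent_le_two (d := d) ht ξ) 2
        nlinarith [Real.pi_gt_three]
    calc _ ≤ ‖1 - ft (tent (d := d) (2 ^ k)) ξ‖ ^ 2 * (C ^ 2 * (4 ^ v * (2 ^ m)⁻¹) * (1 / z)) := by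
          gcongr
      _ = (C ^ 2 * (4 ^ v * (2 ^ m)⁻¹)) *
          (‖1 - ft (tent (d := d) (2 ^ k)) ξ‖ ^ 2 * (1 / z)) := by ring
      _ ≤ (C ^ 2 * (4 ^ v * (2 ^ m)⁻¹)) * (4 * Real.pi ^ 2 * min z (1 / z)) := by gcongr
      _ = _ := by ring
  calc _ ≤ _ := Finset.sum_le_sum hterm
    _ = 4 * Real.pi ^ 2 * C ^ 2 * (4 ^ v * (2 ^ m)⁻¹) *
        ∑ k ∈ s, min ((2 : ℝ) ^ k * ‖ξ‖) (1 / ((2 : ℝ) ^ k * ‖ξ‖)) := by rw [Finset.mul_sum]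
    _ ≤ 4 * Real.pi ^ 2 * C ^ 2 * (4 ^ v * (2 ^ m)⁻¹) * 8 := by
        gcongr; exact geo_sum s hn
    _ = _ := by ring

/-- The difference between `K_j * g` and its average at scale `2 ^ k`. -/
def avgDiff (k : ℤ) (κ g : Rd d → ℝ) (x : Rd d) : ℝ := cv κ g x - cv (tent (2 ^ k)) (cv κ g) x

theorem abs_avgDiff_le {κ g : Rd d → ℝ} (hκ : Integrable κ) (hg1 : ∀ x, |g x| ≤ 1) {A : ℝ}
    (hA : ∫ x, |κ x| ≤ A) (k : ℤ) (x : Rd d) : |avgDiff k κ g x| ≤ 2 * A := by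
  have ht : (0 : ℝ) < 2 ^ k := by positivity
  have h1 : ∀ x, |cv κ g x| ≤ A := fun x => by
    have := abs_cv_le_bound hκ hg1 x; linarith
  have h2 := abs_cv_le_bound (tent_integrable (d := d) ht) h1 x
  rw [integral_abs_tent ht, one_mul] at h2
  have := h1 x
  have := abs_sub (cv κ g x) (cv (tent (2 ^ k)) (cv κ g) x)
  unfold avgDiff; linarith

theorem avgDiff_eq_cv {κ g : Rd d → ℝ} (hκ : Integrable κ) (hg : Nice g) (k : ℤ) (x : Rd d) :
    avgDiff k κ g x = cv (fun y => κ y - cv (tent (2 ^ k)) κ y) g x := by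
  have ht : (0 : ℝ) < 2 ^ k := by positivity
  rw [cv_sub_left hκ (cv_integrable (tent_integrable ht) hκ) hg,
    cv_assoc (tent_integrable ht) hκ hg, avgDiff]

theorem avgDiff_low_add_high (hd : 2 ≤ d) (hΩ : Normalized d Ω) {g : Rd d → ℝ} (hg : Nice g)
    (v : ℕ) (k j : ℤ) (x : Rd d) :
    avgDiff k (KK Ω j) g x =
      avgDiff k (KK (lowPart Ω v) j) g x + avgDiff k (KK (highPart Ω v) j) g x := by
  have ht : (0 : ℝ) < 2 ^ k := by positivity
  have h1 : cv (KK Ω j) g = fun x => cv (KK (lowPart Ω v) j) g x + cv (KK (highPart Ω v) j) g x :=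
    funext fun x => hΩ.cv_low_add_high hd v j hg x
  unfold avgDiff
  rw [h1, cv_add_right (tent_integrable ht) (cv_nice (hΩ.KK_int_low hd v j) hg)
    (cv_nice (hΩ.KK_int_high hd v j) hg)]
  ring

theorem abs_sum_avg_low_scales_le (hd : 2 ≤ d) (hΩ : Normalized d Ω)
    (h0 : ∫ θ : sphere (0 : Rd d) 1, Ω θ ∂(sphereMeasure d) = 0) {g : Rd d → ℝ} (hg : Nice g)
    (hg1 : ∀ x, |g x| ≤ 1) (k0 k : ℤ) (x : Rd d) :
    |∑ j ∈ Finset.Ioc k0 k, cv (tent (2 ^ k)) (cv (KK Ω j) g) x| ≤ 24 * cShift d := by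
  have hcs := cShift_nonneg (d := d)
  have ht : (0 : ℝ) < 2 ^ k := by positivity
  have hone : ∀ j ∈ Finset.Ioc k0 k, |cv (tent (2 ^ k)) (cv (KK Ω j) g) x| ≤
      6 * cShift d * (1 / 2) ^ (j + -k).natAbs := by
    intro j hj
    have hK := hΩ.KK_int hd j
    rw [← cv_assoc (tent_integrable ht) hK hg]
    have h1 := abs_cv_le_bound (cv_integrable (tent_integrable ht) hK) hg1 x
    have h2 := integral_abs_cv_tent_le (c := 0) (ρ := 2 * 2 ^ j) (by positivity) ht hK
      (integral_KK_eq_zero hd hΩ h0 j)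
      (fun y hy => KK_eq_zero_of_ge (by rw [sub_zero] at hy; exact hy.le))
    have h3 : (2 * 2 ^ j / 2 ^ k : ℝ) = 2 * (1 / 2) ^ (j + -k).natAbs := by
      have hjk := (Finset.mem_Ioc.1 hj).2
      rw [mul_div_assoc, ← zpow_sub₀ two_ne_zero]
      congr 1
      rw [one_div, inv_pow, ← zpow_natCast, ← zpow_neg]
      congr 1
      omega
    rw [h3] at h2
    have h4 := hΩ.integral_KK hd j
    have h5 : cShift d * (2 * (1 / 2) ^ (j + -k).natAbs) * ∫ x, |KK Ω j x| ≤
      cShift d * (2 * (1 / 2) ^ (j + -k).natAbs) * 3 := by gcongr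
    linarith
  calc _ ≤ ∑ j ∈ Finset.Ioc k0 k, 6 * cShift d * (1 / 2 : ℝ) ^ (j + -k).natAbs :=
        (Finset.abs_sum_le_sum_abs _ _).trans (Finset.sum_le_sum hone)
    _ ≤ 6 * cShift d * 4 := by
        rw [← Finset.mul_sum]; gcongr; exact sum_half_natAbs_le _ _
    _ = _ := by ring

theorem sum_eq_avg_decomposition (hd : 2 ≤ d) (hΩ : Normalized d Ω) {g : Rd d → ℝ} (hg : Nice g)
    {k0 k K : ℤ} (h1 : k0 ≤ k) (h2 : k ≤ K) (x : Rd d) :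
    ∑ j ∈ Finset.Ioc k K, cv (KK Ω j) g x =
      cv (tent (2 ^ k)) (fun y => ∑ j ∈ Finset.Ioc k0 K, cv (KK Ω j) g y) x -
      ∑ j ∈ Finset.Ioc k0 k, cv (tent (2 ^ k)) (cv (KK Ω j) g) x +
      ∑ j ∈ Finset.Ioc k K, avgDiff k (KK Ω j) g x := by
  have ht : (0 : ℝ) < 2 ^ k := by positivity
  rw [cv_sum_right (tent_integrable ht) fun j _ => cv_nice (hΩ.KK_int hd j) hg]
  have hu : Finset.Ioc k0 K = Finset.Ioc k0 k ∪ Finset.Ioc k K :=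
    (Finset.Ioc_union_Ioc_eq_Ioc h1 h2).symm
  have hdj : Disjoint (Finset.Ioc k0 k) (Finset.Ioc k K) := by
    rw [Finset.disjoint_left]; intro a ha hb
    rw [Finset.mem_Ioc] at ha hb; omega
  rw [hu, Finset.sum_union hdj]
  simp only [avgDiff, Finset.sum_sub_distrib]
  ring

theorem good_part_weak (hd : 2 ≤ d) : ∃ C : ℝ, 0 < C ∧ ∀ {Ω : Rd d → ℝ}, Normalized d Ω →
    ∫ θ : sphere (0 : Rd d) 1, Ω θ ∂(sphereMeasure d) = 0 → ∀ {g : Rd d → ℝ}, Nice g →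
    (∀ x, |g x| ≤ 1) → ∀ k0 K : ℤ,
    volume {x | ∃ k, k0 ≤ k ∧ k ≤ K ∧ C < |∑ j ∈ Finset.Ioc k K, cv (KK Ω j) g x|} ≤
      ENNReal.ofReal (C * ∫ x, |g x|) := by
  obtain ⟨C1, hC1, hmult⟩ := sum_norm_ft_KK_le hd
  obtain ⟨C2, hC2, hrem⟩ := sum_norm_ft_remainder_le hd
  have hcs := cShift_nonneg (d := d)
  have hct := cTent_pos (d := d)
  set V := volume.real (ball (0 : Rd d) 1) with hV
  have hV0 : 0 ≤ V := measureReal_nonneg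
  refine ⟨1 + 24 * cShift d + 6 + 160 + (5 ^ d * V * cTent d * C1 ^ 2 + 160 * C2),
    by positivity, ?_⟩
  intro Ω hΩ h0 g hg hg1 k0 K
  set T : Rd d → ℝ := fun y => ∑ j ∈ Finset.Ioc k0 K, cv (KK Ω j) g y with hT
  have hTn : Nice T := Nice.sum fun j _ => cv_nice (hΩ.KK_int hd j) hg
  have hg2 : ∫ x, g x ^ 2 ≤ ∫ x, |g x| := by
    refine integral_mono hg.sq.int hg.int.abs fun x => ?_
    simp only
    have := hg1 x; have := abs_nonneg (g x)
    rw [← sq_abs]; nlinarith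
  have hg20 : 0 ≤ ∫ x, g x ^ 2 := integral_nonneg fun _ => sq_nonneg _
  have hT2 : ∫ x, T x ^ 2 ≤ C1 ^ 2 * ∫ x, g x ^ 2 := by
    have e : T = cv (fun y => ∑ j ∈ Finset.Ioc k0 K, KK Ω j y) g :=
      funext fun x => (cv_sum_left (fun j _ => hΩ.KK_int hd j) hg x).symm
    rw [e]
    refine integral_cv_sq_le (integrable_finsetSum _ fun j _ => hΩ.KK_int hd j) hg fun ξ => ?_
    rw [ft_sum fun j _ => hΩ.KK_int hd j]
    exact (norm_sum_le _ _).trans (hmult hΩ h0 _ ξ)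
  set M := (K - k0).toNat with hM
  set low : ℕ → ℤ → Rd d → ℝ := fun m k x =>
    avgDiff k (KK (lowPart Ω (m / 80)) (k + m)) g x with hlow
  set E1 : Set (Rd d) := {x | ∃ k, k0 ≤ k ∧ k ≤ K ∧ 1 < |cv (tent (2 ^ k)) T x|} with hE1
  set E2 : Set (Rd d) := ⋃ m ∈ Finset.range (M + 1), ⋃ k ∈ Finset.Icc k0 K,
    {x | ((2 : ℝ) ^ (m / 80))⁻¹ < |low m k x|} with hE2
  have hE1m : volume E1 ≤ ENNReal.ofReal (5 ^ d * V * cTent d * C1 ^ 2 * ∫ x, |g x|) := by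
    refine (tent_maximal_weak_two T hTn k0 K).trans (ENNReal.ofReal_le_ofReal ?_)
    rw [mul_assoc _ (C1 ^ 2)]
    gcongr
    exact hT2.trans (by gcongr)
  have hlown : ∀ m k, Nice (low m k) := fun m k => by
    have hK := hΩ.KK_int_low hd (m / 80) (k + m)
    exact (cv_nice hK hg).sub (cv_nice (tent_integrable (by positivity)) (cv_nice hK hg))
  have hlow2 : ∀ m, ∑ k ∈ Finset.Icc k0 K, ∫ x, low m k x ^ 2 ≤
      C2 * (4 ^ (m / 80) * (2 ^ m)⁻¹) * ∫ x, g x ^ 2 := by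
    intro m
    have e : ∀ k, low m k = cv (fun y => KK (lowPart Ω (m / 80)) (k + m) y -
      cv (tent (2 ^ k)) (KK (lowPart Ω (m / 80)) (k + m)) y) g := fun k =>
      funext fun x => avgDiff_eq_cv (hΩ.KK_int_low hd _ _) hg k x
    simp_rw [e]
    refine sum_integral_cv_sq_le (fun k _ => ?_) hg (hrem hΩ m _)
    have hK := hΩ.KK_int_low hd (m / 80) (k + m)
    exact hK.sub (cv_integrable (tent_integrable (by positivity)) hK)
  have hE2m : volume E2 ≤ ENNReal.ofReal (160 * C2 * ∫ x, |g x|) := by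
    have h1 : ∀ m ∈ Finset.range (M + 1), volume (⋃ k ∈ Finset.Icc k0 K,
        {x | ((2 : ℝ) ^ (m / 80))⁻¹ < |low m k x|}) ≤
        ENNReal.ofReal (C2 * (∫ x, |g x|) * ((2 : ℝ) ^ (m / 80))⁻¹) := by
      intro m _
      refine (measure_biUnion_finset_le _ _).trans ?_
      refine (Finset.sum_le_sum fun k _ => cheb_two (hlown m k).sq.int (by positivity)).trans ?_
      rw [← ENNReal.ofReal_sum_of_nonneg fun k _ => div_nonneg
        (integral_nonneg fun _ => sq_nonneg _) (sq_nonneg _)]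
      refine ENNReal.ofReal_le_ofReal ?_
      rw [← Finset.sum_div]
      set v := m / 80 with hv
      have h3 : ((4 : ℝ) ^ v * (2 ^ m)⁻¹) / ((2 ^ v)⁻¹) ^ 2 ≤ (2 ^ v)⁻¹ := by
        have h32 : (32 : ℝ) ^ v ≤ 2 ^ m := by
          rw [show (32 : ℝ) = 2 ^ 5 by norm_num, ← pow_mul]
          exact pow_le_pow_right₀ one_le_two (by omega)
        have e32 : (32 : ℝ) ^ v = 4 ^ v * 2 ^ v * 2 ^ v * 2 ^ v := by
          rw [← mul_pow, ← mul_pow, ← mul_pow]; norm_num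
        rw [e32] at h32
        rw [inv_pow, div_inv_eq_mul, ← div_eq_mul_inv, div_mul_eq_mul_div, div_le_iff₀ (by positivity),
          ← div_eq_inv_mul, le_div_iff₀ (by positivity)]
        linarith
      calc _ ≤ C2 * (4 ^ v * (2 ^ m)⁻¹) * (∫ x, g x ^ 2) / ((2 ^ v)⁻¹) ^ 2 := by
            gcongr; exact hlow2 m
        _ = C2 * (∫ x, g x ^ 2) * ((4 ^ v * (2 ^ m)⁻¹) / ((2 ^ v)⁻¹) ^ 2) := by ring
        _ ≤ C2 * (∫ x, |g x|) * (2 ^ v)⁻¹ := by gcongr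
    refine (measure_biUnion_finset_le _ _).trans ((Finset.sum_le_sum h1).trans ?_)
    rw [← ENNReal.ofReal_sum_of_nonneg fun k _ => by positivity, ← Finset.mul_sum]
    refine ENNReal.ofReal_le_ofReal ?_
    have := sum_half_pow_div_le (p := 80) (by norm_num) (M + 1)
    push_cast at this
    have h5 : C2 * (∫ x, |g x|) * ∑ m ∈ Finset.range (M + 1), ((2 : ℝ) ^ (m / 80))⁻¹ ≤
      C2 * (∫ x, |g x|) * (2 * 80) := by gcongr
    linarith
  have hsub : {x | ∃ k, k0 ≤ k ∧ k ≤ K ∧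
      1 + 24 * cShift d + 6 + 160 + (5 ^ d * V * cTent d * C1 ^ 2 + 160 * C2) <
      |∑ j ∈ Finset.Ioc k K, cv (KK Ω j) g x|} ⊆ E1 ∪ E2 := by
    rintro x ⟨k, hk0, hkK, hx⟩
    by_contra hxE
    rw [mem_union, not_or] at hxE
    obtain ⟨hx1, hx2⟩ := hxE
    have b1 : |cv (tent (2 ^ k)) T x| ≤ 1 := by
      by_contra hc
      exact hx1 ⟨k, hk0, hkK, not_le.1 hc⟩
    have b2 := abs_sum_avg_low_scales_le hd hΩ h0 hg hg1 k0 k x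
    have b3 : ∀ m ∈ Finset.range (M + 1), |low m k x| ≤ ((2 : ℝ) ^ (m / 80))⁻¹ := by
      intro m hm
      by_contra hc
      refine hx2 (mem_biUnion hm (mem_biUnion (Finset.mem_coe.2 (Finset.mem_Icc.2 ⟨hk0, hkK⟩)) ?_))
      exact not_le.1 hc
    have b4 : ∀ m ∈ Finset.range (M + 1), |avgDiff k (KK Ω (k + m)) g x| ≤
        ((2 : ℝ) ^ (m / 80))⁻¹ + 6 * tailL1 d Ω (m / 80) := by
      intro m hm
      rw [avgDiff_low_add_high hd hΩ hg (m / 80)]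
      have := abs_avgDiff_le (hΩ.KK_int_high hd (m / 80) (k + m)) hg1
        (hΩ.integral_KK_high hd (m / 80) (k + m)) k x
      refine (abs_add_le _ _).trans (add_le_add (b3 m hm) (by linarith))
    have b5 : |∑ j ∈ Finset.Ioc k K, avgDiff k (KK Ω j) g x| ≤ 160 + 6 := by
      classical
      have hs : Finset.Ioc k K ⊆ (Finset.range (M + 1)).image fun m : ℕ => k + (m : ℤ) := by
        intro j hj
        rw [Finset.mem_Ioc] at hj
        rw [Finset.mem_image]
        exact ⟨(j - k).toNat, Finset.mem_range.2 (by omega), by omega⟩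
      refine (Finset.abs_sum_le_sum_abs _ _).trans ((Finset.sum_le_sum_of_subset_of_nonneg hs
        fun _ _ _ => abs_nonneg _).trans ?_)
      rw [Finset.sum_image fun a _ b _ h => by simpa using h]
      refine (Finset.sum_le_sum b4).trans ?_
      rw [Finset.sum_add_distrib, ← Finset.mul_sum]
      have t1 := sum_half_pow_div_le (p := 80) (by norm_num) (M + 1)
      have t2 := hΩ.tail (M + 1)
      push_cast at t1
      linarith
    rw [sum_eq_avg_decomposition hd hΩ hg hk0 hkK] at hx
    have c1 := abs_add_le (cv (tent (2 ^ k)) T x - ∑ j ∈ Finset.Ioc k0 k,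
      cv (tent (2 ^ k)) (cv (KK Ω j) g) x) (∑ j ∈ Finset.Ioc k K, avgDiff k (KK Ω j) g x)
    have c2 := abs_sub (cv (tent (2 ^ k)) T x) (∑ j ∈ Finset.Ioc k0 k,
      cv (tent (2 ^ k)) (cv (KK Ω j) g) x)
    have c3 : 0 ≤ 5 ^ d * V * cTent d * C1 ^ 2 + 160 * C2 := by positivity
    linarith
  refine (measure_mono hsub).trans ((measure_union_le _ _).trans ((add_le_add hE1m hE2m).trans ?_))
  rw [← ENNReal.ofReal_add (by positivity) (by positivity)]
  refine ENNReal.ofReal_le_ofReal ?_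
  have : 0 ≤ (1 + 24 * cShift d + 6 + 160) * ∫ x, |g x| := by positivity
  linarith

end GoodPart

section CalderonZygmund

variable {d : ℕ} {f : Rd d → ℝ}

theorem volume_real_dcube (n : ℤ) (z : Fin d → ℤ) :
    volume.real (dcube n z) = ((2 : ℝ) ^ n) ^ d := by
  rw [Measure.real, volume_dcube, ENNReal.toReal_ofReal (by positivity)]

theorem dcube_nonempty (n : ℤ) (z : Fin d → ℤ) : (dcube n z).Nonempty := by
  refine nonempty_of_measure_ne_zero (μ := volume) ?_
  rw [volume_dcube]
  exact (ENNReal.ofReal_pos.2 (by positivity)).ne'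

theorem dcube_disjoint (n : ℤ) {z w : Fin d → ℤ} (h : z ≠ w) :
    Disjoint (dcube (d := d) n z) (dcube n w) :=
  disjoint_left.2 fun _ hx hx' => h (Eq.trans (Eq.symm hx) hx')

/-- A dyadic cube on which the average of `|f|` exceeds one. -/
def heavy (f : Rd d → ℝ) (n : ℤ) (z : Fin d → ℤ) : Prop :=
  ((2 : ℝ) ^ n) ^ d < ∫ x in dcube n z, |f x|

/-- A maximal heavy dyadic cube. -/
def maximalHeavy (f : Rd d → ℝ) (p : ℤ × (Fin d → ℤ)) : Prop :=
  heavy f p.1 p.2 ∧ ∀ m, p.1 < m → ∀ x ∈ dcube p.1 p.2, ¬ heavy f m (idx m x)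

theorem heavy_finite (hf : Integrable f) (n : ℤ) : {z | heavy f n z}.Finite := by
  have h := hasSum_integral_iUnion (μ := volume) (f := fun x => |f x|)
    (s := fun z : Fin d → ℤ => dcube n z)
    (fun z => dcube_measurable n z) (fun z w hzw => dcube_disjoint n hzw) hf.abs.integrableOn
  have h1 := h.summable.tendsto_cofinite_zero.eventually_lt_const
    (show (0 : ℝ) < ((2 : ℝ) ^ n) ^ d by positivity)
  refine Finite.subset (Filter.eventually_cofinite.1 h1) fun z hz => ?_
  exact not_lt.2 (le_of_lt hz)

theorem setIntegral_abs_le (hf : Integrable f) (s : Set (Rd d)) :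
    ∫ x in s, |f x| ≤ ∫ x, |f x| :=
  setIntegral_le_integral hf.abs (.of_forall fun _ => abs_nonneg _)

theorem maximalHeavy_disjoint {p q : ℤ × (Fin d → ℤ)} (hp : maximalHeavy f p) (hq : maximalHeavy f q)
    (h : p ≠ q) : Disjoint (dcube (d := d) p.1 p.2) (dcube q.1 q.2) := by
  have key : ∀ {p q : ℤ × (Fin d → ℤ)}, maximalHeavy f p → maximalHeavy f q → p.1 < q.1 →
      ∀ x, x ∈ dcube (d := d) p.1 p.2 → x ∈ dcube q.1 q.2 → False := by
    intro p q hp hq hlt x hx hx'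
    have := hp.2 q.1 hlt x hx
    rw [show idx q.1 x = q.2 from hx'] at this
    exact this hq.1
  refine disjoint_left.2 fun x hx hx' => ?_
  rcases lt_trichotomy p.1 q.1 with hlt | heq | hlt
  · exact key hp hq hlt x hx hx'
  · refine h (Prod.ext heq ?_)
    rw [← show idx p.1 x = p.2 from hx, ← show idx q.1 x = q.2 from hx', heq]
  · exact key hq hp hlt x hx' hx

theorem maximalHeavy_le (hf : Integrable f) {p : ℤ × (Fin d → ℤ)} (hp : maximalHeavy f p) :
    ∫ x in dcube p.1 p.2, |f x| ≤ 2 ^ d * ((2 : ℝ) ^ p.1) ^ d := by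
  obtain ⟨x, hx⟩ := dcube_nonempty p.1 p.2
  have h1 := hp.2 (p.1 + 1) (by omega) x hx
  rw [heavy, not_lt] at h1
  rw [← mul_pow, mul_comm (2 : ℝ), ← zpow_add_one₀ two_ne_zero]
  refine le_trans (setIntegral_mono_set hf.abs.integrableOn (.of_forall fun _ => abs_nonneg _)
    (HasSubset.Subset.eventuallyLE fun y hy => ?_)) h1
  exact idx_eq_of_le (by omega) (Eq.trans hy (Eq.symm hx))

theorem abs_le_two_of_not_heavy (hf : Integrable f) {n : ℤ} {x : Rd d}
    (hu : ∀ y, idx n y = idx n x → |f x - f y| ≤ 1) (h : ¬ heavy f n (idx n x)) : |f x| ≤ 2 := by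
  rw [heavy, not_lt] at h
  have h1 : ∫ _ in dcube n (idx n x), (|f x| - 1) ≤ ∫ y in dcube n (idx n x), |f y| := by
    refine setIntegral_mono_on (integrableOn_const (by rw [volume_dcube]; exact ENNReal.ofReal_ne_top))
      hf.abs.integrableOn (dcube_measurable _ _) fun y hy => ?_
    have := hu y hy
    have := abs_sub_abs_le_abs_sub (f x) (f y)
    linarith
  rw [setIntegral_const, volume_real_dcube, smul_eq_mul] at h1
  have h2 : (0 : ℝ) < ((2 : ℝ) ^ n) ^ d := by positivity
  have h3 := h1.trans h
  rw [mul_le_iff_le_one_right h2] at h3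
  linarith

/-- Calderón–Zygmund decomposition at height one of a uniformly continuous function. -/
theorem calderon_zygmund (hd : 2 ≤ d) (hf : Nice f) {δ : ℝ} (hδ : 0 < δ)
    (hu : ∀ x y, ‖x - y‖ ≤ δ → |f x - f y| ≤ 1) :
    ∃ (I : Finset (ℤ × (Fin d → ℤ))) (c : ℤ × (Fin d → ℤ) → Rd d)
      (b : ℤ × (Fin d → ℤ) → Rd d → ℝ) (g : Rd d → ℝ),
      Fam I Prod.fst c (fun p => dcube p.1 p.2) b ∧ Nice g ∧ (∀ x, |g x| ≤ 2 ^ (d + 1)) ∧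
      ∫ x, |g x| ≤ ∫ x, |f x| ∧ famV d Prod.fst I ≤ ∫ x, |f x| ∧
      ∀ x, f x = g x + 2 ^ (d + 1) * ∑ i ∈ I, b i x := by
  classical
  obtain ⟨n0, hn0, -⟩ := exists_mem_Ico_zpow (show 0 < δ / d by positivity) one_lt_two
  have hu0 : ∀ x y : Rd d, idx n0 y = idx n0 x → |f x - f y| ≤ 1 := fun x y h =>
    hu x y ((norm_sub_le_of_idx_eq h.symm).trans (by
      rw [le_div_iff₀ (by positivity)] at hn0; linarith))
  obtain ⟨N, hN⟩ := pow_unbounded_of_one_lt (∫ x, |f x|) one_lt_two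
  have hlev : ∀ n z, heavy f n z → n < N := by
    intro n z h
    by_contra hc
    have h1 : ((2 : ℝ) ^ n) ^ d < 2 ^ N := h.trans_le ((setIntegral_abs_le hf.int _).trans hN.le)
    have h2 : (2 : ℝ) ^ N ≤ 2 ^ n := by
      rw [← zpow_natCast]; exact zpow_le_zpow_right₀ one_le_two (by omega)
    have h3 : (2 : ℝ) ^ n ≤ (2 ^ n) ^ d :=
      le_self_pow₀ ((one_le_pow₀ one_le_two).trans h2) (by omega)
    linarith
  have hfin : {p : ℤ × (Fin d → ℤ) | n0 ≤ p.1 ∧ maximalHeavy f p}.Finite := by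
    refine Finite.subset (Finite.biUnion (finite_Ico n0 (N : ℤ)) fun n _ =>
      ((heavy_finite hf.int n).image (Prod.mk n))) ?_
    rintro ⟨n, z⟩ ⟨h1, h2⟩
    exact mem_biUnion (⟨h1, hlev n z h2.1⟩ : n ∈ Ico n0 (N : ℤ)) ⟨z, h2.1, rfl⟩
  set I := hfin.toFinset with hI
  have hIs : ∀ p ∈ I, maximalHeavy f p := fun p hp => (hfin.mem_toFinset.1 hp).2
  choose c hc using fun p : ℤ × (Fin d → ℤ) => dcube_nonempty (d := d) p.1 p.2
  set a : ℤ × (Fin d → ℤ) → ℝ := fun p =>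
    (((2 : ℝ) ^ p.1) ^ d)⁻¹ * ∫ x in dcube p.1 p.2, f x with ha
  set a' : ℤ × (Fin d → ℤ) → ℝ := fun p =>
    (((2 : ℝ) ^ p.1) ^ d)⁻¹ * ∫ x in dcube p.1 p.2, |f x| with ha'
  have hpos : ∀ p : ℤ × (Fin d → ℤ), 0 < ((2 : ℝ) ^ p.1) ^ d := fun p => by positivity
  have haa' : ∀ p, |a p| ≤ a' p := fun p => by
    simp only [ha, ha', abs_mul, abs_of_pos (inv_pos.2 (hpos p))]
    gcongr
    exact abs_integral_le_integral_abs
  have ha'2 : ∀ p ∈ I, a' p ≤ 2 ^ d := fun p hp => by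
    simp only [ha']
    rw [inv_mul_le_iff₀ (hpos p), mul_comm]
    exact maximalHeavy_le hf.int (hIs p hp)
  set b : ℤ × (Fin d → ℤ) → Rd d → ℝ := fun p =>
    (dcube p.1 p.2).indicator fun x => (2 ^ (d + 1))⁻¹ * (f x - a p) with hb
  have hconst : ∀ (p : ℤ × (Fin d → ℤ)) (r : ℝ), IntegrableOn (fun _ => r) (dcube (d := d) p.1 p.2) :=
    fun p r => integrableOn_const (by rw [volume_dcube]; exact ENNReal.ofReal_ne_top)
  have hbint : ∀ p, Integrable (b p) := fun p =>
    IntegrableOn.integrable_indicator (Integrable.const_mul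
      (hf.int.integrableOn.sub (hconst p (a p))) _) (dcube_measurable _ _)
  have hbn : ∀ p, Nice (b p) := by
    intro p
    obtain ⟨M, hM⟩ := hf.bdd
    refine ⟨hbint p, (2 ^ (d + 1))⁻¹ * (M + |a p|), fun x => ?_⟩
    have h1 : |(2 ^ (d + 1))⁻¹ * (f x - a p)| ≤ (2 ^ (d + 1))⁻¹ * (M + |a p|) := by
      rw [abs_mul, abs_of_pos (by positivity)]
      gcongr
      exact (abs_sub _ _).trans (by gcongr; exact hM x)
    by_cases hx : x ∈ dcube p.1 p.2
    · simp only [hb, indicator_of_mem hx]; exact h1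
    · simp only [hb, indicator_of_notMem hx, abs_zero]
      exact (abs_nonneg _).trans h1
  have hdisj : ∀ p ∈ I, ∀ q ∈ I, p ≠ q → Disjoint (dcube (d := d) p.1 p.2) (dcube q.1 q.2) :=
    fun p hp q hq h => maximalHeavy_disjoint (hIs p hp) (hIs q hq) h
  have hfam : Fam I Prod.fst c (fun p => dcube p.1 p.2) b := by
    refine ⟨fun p _ => hbn p, fun p _ => ?_, fun p hp => ?_, fun p _ x hx => indicator_of_notMem hx _,
      fun p _ => dcube_measurable _ _, fun p _ => volume_dcube _ _, fun p _ x hx => ?_, hdisj⟩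
    · simp only [hb]
      rw [integral_indicator (dcube_measurable _ _), integral_const_mul,
        integral_sub hf.int.integrableOn (hconst p _), setIntegral_const, volume_real_dcube,
        smul_eq_mul]
      simp only [ha]
      rw [mul_inv_cancel_left₀ (hpos p).ne', sub_self, mul_zero]
    · have h1 : ∀ x, |b p x| ≤
          (dcube p.1 p.2).indicator (fun x => (2 ^ (d + 1))⁻¹ * (|f x| + a' p)) x := by
        intro x
        by_cases hx : x ∈ dcube p.1 p.2
        · simp only [hb, indicator_of_mem hx]
          rw [abs_mul, abs_of_pos (by positivity)]
          gcongr
          exact (abs_sub _ _).trans (by gcongr; exact haa' p)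
        · simp [hb, indicator_of_notMem hx]
      have h2 := integral_mono (hbint p).abs (IntegrableOn.integrable_indicator
        (Integrable.const_mul (hf.int.abs.integrableOn.add (hconst p (a' p))) _)
        (dcube_measurable _ _)) h1
      rw [integral_indicator (dcube_measurable _ _), integral_const_mul] at h2
      simp only [Pi.add_apply] at h2
      rw [integral_add hf.int.abs.integrableOn (hconst p _), setIntegral_const, volume_real_dcube,
        smul_eq_mul] at h2
      refine h2.trans ?_
      simp only [ha']
      rw [mul_inv_cancel_left₀ (hpos p).ne', ← two_mul, pow_succ, inv_mul_le_iff₀ (by positivity)]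
      have := maximalHeavy_le hf.int (hIs p hp)
      nlinarith
    · exact norm_sub_le_of_idx_eq (Eq.trans hx (Eq.symm (hc p)))
  have hsum_mem : ∀ (F : ℤ × (Fin d → ℤ) → Rd d → ℝ) (p) (_ : p ∈ I) (x) (_ : x ∈ dcube p.1 p.2),
      ∑ i ∈ I, (dcube i.1 i.2).indicator (F i) x = F p x := by
    intro F p hp x hx
    rw [Finset.sum_eq_single p, indicator_of_mem hx]
    · intro q hq hqp
      exact indicator_of_notMem (disjoint_left.1 (hdisj p hp q hq hqp.symm) hx) _
    · exact fun h => absurd hp h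
  have hsum_not : ∀ (F : ℤ × (Fin d → ℤ) → Rd d → ℝ) (x) (_ : ∀ p ∈ I, x ∉ dcube p.1 p.2),
      ∑ i ∈ I, (dcube i.1 i.2).indicator (F i) x = 0 := fun F x hx =>
    Finset.sum_eq_zero fun p hp => indicator_of_notMem (hx p hp) _
  have hoff : ∀ x, (∀ p ∈ I, x ∉ dcube p.1 p.2) → |f x| ≤ 2 := by
    intro x hx
    by_contra hc2
    have hh : heavy f n0 (idx n0 x) := by
      by_contra h; exact hc2 (abs_le_two_of_not_heavy hf.int (hu0 x) h)
    obtain ⟨n, hn, hmax⟩ := Int.exists_greatest_of_bdd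
      (P := fun n => n0 ≤ n ∧ heavy f n (idx n x)) ⟨N, fun n hn => (hlev _ _ hn.2).le⟩
      ⟨n0, le_rfl, hh⟩
    refine hx (n, idx n x) (hfin.mem_toFinset.2 ⟨hn.1, hn.2, fun m hm y hy hmy => ?_⟩) rfl
    have hm : n < m := hm
    rw [idx_eq_of_le hm.le hy] at hmy
    have := hmax m ⟨by omega, hmy⟩
    omega
  set g : Rd d → ℝ := fun x => f x - 2 ^ (d + 1) * ∑ i ∈ I, b i x with hg
  have hg_mem : ∀ p ∈ I, ∀ x ∈ dcube p.1 p.2, g x = a p := by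
    intro p hp x hx
    simp only [hg, hb]
    rw [hsum_mem _ p hp x hx, mul_inv_cancel_left₀ (by positivity)]
    ring
  have hg_not : ∀ x, (∀ p ∈ I, x ∉ dcube p.1 p.2) → g x = f x := by
    intro x hx
    simp only [hg, hb]
    rw [hsum_not _ x hx, mul_zero, sub_zero]
  have hgn : Nice g := hf.sub ((Nice.sum fun p _ => hbn p).const_mul _)
  refine ⟨I, c, b, g, hfam, hgn, fun x => ?_, ?_, ?_, fun x => by simp only [hg]; ring⟩
  · by_cases hx : ∃ p ∈ I, x ∈ dcube p.1 p.2
    · obtain ⟨p, hp, hx⟩ := hx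
      rw [hg_mem p hp x hx]
      exact (haa' p).trans ((ha'2 p hp).trans (pow_le_pow_right₀ one_le_two (by omega)))
    · push Not at hx
      rw [hg_not x hx]
      exact (hoff x hx).trans (le_self_pow₀ one_le_two (by omega))
  · have hD : ∀ p, Integrable ((dcube (d := d) p.1 p.2).indicator fun x => a' p - |f x|) := fun p =>
      ((hconst p (a' p)).sub hf.int.abs.integrableOn).integrable_indicator (dcube_measurable _ _)
    have h1 : ∀ x, |g x| ≤ |f x| + ∑ i ∈ I, (dcube i.1 i.2).indicator (fun x => a' i - |f x|) x := by
      intro x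
      by_cases hx : ∃ p ∈ I, x ∈ dcube p.1 p.2
      · obtain ⟨p, hp, hx⟩ := hx
        rw [hg_mem p hp x hx, hsum_mem _ p hp x hx]
        have := haa' p
        linarith
      · push Not at hx
        rw [hg_not x hx, hsum_not _ x hx, add_zero]
    refine (integral_mono hgn.int.abs (hf.int.abs.add (integrable_finsetSum _ fun p _ => hD p))
      h1).trans (le_of_eq ?_)
    simp only [Pi.add_apply]
    rw [integral_add hf.int.abs (integrable_finsetSum _ fun p _ => hD p),
      integral_finsetSum _ fun p _ => hD p, Finset.sum_eq_zero, add_zero]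
    intro p _
    rw [integral_indicator (dcube_measurable _ _), integral_sub (hconst p _)
      hf.int.abs.integrableOn, setIntegral_const, volume_real_dcube, smul_eq_mul]
    simp only [ha']
    rw [mul_inv_cancel_left₀ (hpos p).ne', sub_self]
  · have hD : ∀ p : ℤ × (Fin d → ℤ), Integrable ((dcube p.1 p.2).indicator fun x => |f x|) :=
      fun p => hf.int.abs.integrableOn.integrable_indicator (dcube_measurable _ _)
    calc famV d Prod.fst I ≤ ∑ p ∈ I, ∫ x in dcube p.1 p.2, |f x| :=
          Finset.sum_le_sum fun p hp => (hIs p hp).1.le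
      _ = ∫ x, ∑ p ∈ I, (dcube p.1 p.2).indicator (fun x => |f x|) x := by
          rw [integral_finsetSum _ fun p _ => hD p]
          exact Finset.sum_congr rfl fun p _ => (integral_indicator (dcube_measurable _ _)).symm
      _ ≤ ∫ x, |f x| := by
          refine integral_mono (integrable_finsetSum _ fun p _ => hD p) hf.int.abs fun x => ?_
          simp only
          by_cases hx : ∃ p ∈ I, x ∈ dcube p.1 p.2
          · obtain ⟨p, hp, hx⟩ := hx
            rw [hsum_mem _ p hp x hx]
          · push Not at hx
            rw [hsum_not _ x hx]
            exact abs_nonneg _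

end CalderonZygmund

section DyadicMaximal

variable {d : ℕ} {Ω : Rd d → ℝ}

theorem volume_iUnion_closedBall_le {ι : Type*} {I : Finset ι} (n : ι → ℤ) (c : ι → Rd d) :
    volume (⋃ i ∈ I, closedBall (c i) ((d + 2) * 2 ^ n i)) ≤
      ENNReal.ofReal ((d + 2) ^ d * volume.real (ball (0 : Rd d) 1) * famV d n I) := by
  have hV : volume (ball (0 : Rd d) 1) = ENNReal.ofReal (volume.real (ball (0 : Rd d) 1)) :=
    (ENNReal.ofReal_toReal measure_ball_lt_top.ne).symm
  refine (measure_biUnion_finset_le _ _).trans (le_of_eq ?_)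
  rw [famV, Finset.mul_sum, ENNReal.ofReal_sum_of_nonneg fun i _ => by positivity]
  refine Finset.sum_congr rfl fun i _ => ?_
  rw [volume_closedBall_le _ (by positivity), hV, ← ENNReal.ofReal_mul (by positivity)]
  congr 1
  rw [mul_pow]; ring

/-- A function splits into a bounded part and a part on which the truncated sums of rough
kernels are bounded off a small set. -/
theorem exists_good_bad (hd : 2 ≤ d) : ∃ C : ℝ, 0 < C ∧ ∀ {f : Rd d → ℝ}, Nice f → ∀ {δ : ℝ},
    0 < δ → (∀ x y, ‖x - y‖ ≤ δ → |f x - f y| ≤ 1) → ∃ g β : Rd d → ℝ, Nice g ∧ Nice β ∧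
    (∀ x, |g x| ≤ 1) ∧ ∫ x, |g x| ≤ ∫ x, |f x| ∧ (∀ x, f x = 2 ^ (d + 1) * (g x + β x)) ∧
    ∀ {Ω : Rd d → ℝ}, Normalized d Ω → ∀ K : ℤ, ∃ E : Set (Rd d),
      volume E ≤ ENNReal.ofReal (C * ∫ x, |f x|) ∧
      ∀ x ∉ E, ∀ k, |∑ j ∈ Finset.Ioc k K, cv (KK Ω j) β x| ≤ C := by
  obtain ⟨C, hC, hbad⟩ := bad_part_weak hd
  set V := volume.real (ball (0 : Rd d) 1) with hV
  have hV0 : 0 ≤ V := measureReal_nonneg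
  refine ⟨C + (d + 2) ^ d * V, by positivity, ?_⟩
  intro f hf δ hδ hu
  obtain ⟨I, c, b, g, hfam, hg, hgb, hgi, hvol, hfg⟩ := calderon_zygmund hd hf hδ hu
  have hG : (1 : ℝ) ≤ 2 ^ (d + 1) := one_le_pow₀ one_le_two
  have hG' : ((2 : ℝ) ^ (d + 1))⁻¹ ≤ 1 := inv_le_one_of_one_le₀ hG
  refine ⟨fun x => (2 ^ (d + 1))⁻¹ * g x, fun x => ∑ i ∈ I, b i x, hg.const_mul _,
    Nice.sum hfam.nice, fun x => ?_, ?_, fun x => ?_, ?_⟩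
  · rw [abs_mul, abs_of_pos (by positivity), inv_mul_le_iff₀ (by positivity), mul_one]
    exact hgb x
  · refine le_trans (integral_mono (hg.const_mul _).int.abs hg.int.abs fun x => ?_) hgi
    simp only
    rw [abs_mul, abs_of_pos (by positivity)]
    exact mul_le_of_le_one_left (abs_nonneg _) hG'
  · rw [mul_add, mul_inv_cancel_left₀ (by positivity)]
    exact hfg x
  · intro Ω hΩ K
    refine ⟨_ ∪ _, (measure_union_le _ _).trans (add_le_add (hbad hΩ hfam K)
      (volume_iUnion_closedBall_le (I := I) Prod.fst c)) |>.trans ?_, fun x hx k => ?_⟩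
    · have := famV_nonneg (d := d) (n := Prod.fst) (I := I)
      rw [← ENNReal.ofReal_add (by positivity) (by positivity), ← add_mul]
      exact ENNReal.ofReal_le_ofReal (by gcongr)
    · rw [mem_union, not_or] at hx
      by_contra hc
      refine hx.1 ⟨fun i hi => ?_, k, ?_⟩
      · by_contra hi2
        refine hx.2 (mem_biUnion hi ?_)
        rw [mem_closedBall, dist_eq_norm]
        exact not_lt.1 hi2
      · have : 0 ≤ (d + 2) ^ d * V := by positivity
        exact lt_of_le_of_lt (by linarith) (not_le.1 hc)

theorem dyadic_maximal_weak (hd : 2 ≤ d) : ∃ C : ℝ, 0 < C ∧ ∀ {Ω : Rd d → ℝ}, Normalized d Ω →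
    ∫ θ : sphere (0 : Rd d) 1, Ω θ ∂(sphereMeasure d) = 0 → ∀ {f : Rd d → ℝ}, Nice f →
    ∀ {δ : ℝ}, 0 < δ → (∀ x y, ‖x - y‖ ≤ δ → |f x - f y| ≤ 1) → ∀ k0 K : ℤ,
    ∃ E : Set (Rd d), volume E ≤ ENNReal.ofReal (C * ∫ x, |f x|) ∧ ∀ x ∉ E,
      (∀ k, k0 ≤ k → k ≤ K → |∑ j ∈ Finset.Ioc k K, cv (KK Ω j) f x| ≤ C) ∧
      ∀ j, j ≤ K → cv (KK (fun y => |Ω y|) j) (fun y => |f y|) x ≤ C := by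
  obtain ⟨C1, hC1, hgood⟩ := good_part_weak hd
  obtain ⟨C2, hC2, hbad⟩ := exists_good_bad hd
  refine ⟨2 ^ (d + 1) * (C1 + C2 + 3 + C2) + (C1 + C2 + C2), by positivity, ?_⟩
  intro Ω hΩ h0 f hf δ hδ hu k0 K
  obtain ⟨g, β, hg, hβ, hg1, hgi, hfg, hE⟩ := hbad hf hδ hu
  obtain ⟨E1, hE1, hE1b⟩ := hE hΩ K
  obtain ⟨g', β', hg', hβ', hg1', -, hfg', hE'⟩ := hbad hf.abs hδ
    fun x y h => (abs_abs_sub_abs_le_abs_sub _ _).trans (hu x y h)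
  obtain ⟨E2, hE2, hE2b⟩ := hE' hΩ.abs K
  simp only [abs_abs] at hE2
  have hgw := hgood hΩ h0 hg hg1 k0 K
  set E3 : Set (Rd d) := {x | ∃ k, k0 ≤ k ∧ k ≤ K ∧ C1 < |∑ j ∈ Finset.Ioc k K, cv (KK Ω j) g x|}
    with hE3
  have hlin : ∀ {Ω : Rd d → ℝ}, Normalized d Ω → ∀ {f g β : Rd d → ℝ}, Nice g → Nice β →
      (∀ x, f x = 2 ^ (d + 1) * (g x + β x)) → ∀ j x,
      cv (KK Ω j) f x = 2 ^ (d + 1) * (cv (KK Ω j) g x + cv (KK Ω j) β x) := by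
    intro Ω hΩ f g β hg hβ h j x
    rw [← cv_add_right (hΩ.KK_int hd j) hg hβ, show f = fun x => 2 ^ (d + 1) * (g x + β x) from
      funext h, cv_comm, cv_const_mul_left, cv_comm]
  have hG : (0 : ℝ) < 2 ^ (d + 1) := by positivity
  refine ⟨E3 ∪ (E1 ∪ E2), ?_, fun x hx => ?_⟩
  · refine (measure_union_le _ _).trans ((add_le_add hgw ((measure_union_le _ _).trans
      (add_le_add hE1 hE2))).trans ?_)
    rw [← ENNReal.ofReal_add (by positivity) (by positivity),
      ← ENNReal.ofReal_add (by positivity) (by positivity)]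
    refine ENNReal.ofReal_le_ofReal ?_
    have h1 : C1 * ∫ x, |g x| ≤ C1 * ∫ x, |f x| := by gcongr
    have h2 : 0 ≤ 2 ^ (d + 1) * (C1 + C2 + 3 + C2) * ∫ x, |f x| := by positivity
    linarith
  · rw [mem_union, mem_union, not_or, not_or] at hx
    obtain ⟨hx3, hx1, hx2⟩ := hx
    constructor
    · intro k hk0 hkK
      have h1 : |∑ j ∈ Finset.Ioc k K, cv (KK Ω j) g x| ≤ C1 := by
        by_contra hc
        exact hx3 ⟨k, hk0, hkK, not_le.1 hc⟩
      have h2 := hE1b x hx1 k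
      rw [Finset.sum_congr rfl fun j _ => hlin hΩ hg hβ hfg j x, ← Finset.mul_sum,
        Finset.sum_add_distrib, abs_mul, abs_of_pos hG]
      have h3 := abs_add_le (∑ j ∈ Finset.Ioc k K, cv (KK Ω j) g x)
        (∑ j ∈ Finset.Ioc k K, cv (KK Ω j) β x)
      have : (2 : ℝ) ^ (d + 1) * |∑ j ∈ Finset.Ioc k K, cv (KK Ω j) g x +
        ∑ j ∈ Finset.Ioc k K, cv (KK Ω j) β x| ≤ 2 ^ (d + 1) * (C1 + C2 + 3 + C2) :=
        mul_le_mul_of_nonneg_left (by linarith) hG.le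
      linarith
    · intro j hj
      have h1 := abs_cv_le_bound (hΩ.abs.KK_int hd j) hg1' x
      have h2 := hΩ.abs.integral_KK hd j
      have h3 := hE2b x hx2 j
      have h4 := hE2b x hx2 (j - 1)
      have h5 : Finset.Ioc (j - 1) K = insert j (Finset.Ioc j K) := by
        ext i; simp only [Finset.mem_Ioc, Finset.mem_insert]; omega
      rw [h5, Finset.sum_insert (by simp)] at h4
      rw [hlin hΩ.abs hg' hβ' hfg' j x]
      have h6 : cv (KK (fun y => |Ω y|) j) g' x + cv (KK (fun y => |Ω y|) j) β' x ≤
          C1 + C2 + 3 + C2 := by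
        have a1 := le_abs_self (cv (KK (fun y => |Ω y|) j) g' x)
        have a2 := (abs_le.1 h3).1
        have a3 := (abs_le.1 h4).2
        linarith
      have := mul_le_mul_of_nonneg_left h6 hG.le
      linarith

end DyadicMaximal

section Truncation

variable {d : ℕ}

theorem abs_indicator_sub_eta_le {k : ℤ} {ε : ℝ} (h1 : 2 ^ k ≤ ε) (h2 : ε < 2 ^ (k + 1)) (r : ℝ) :
    |(if r ≤ ε then 1 else 0) - eta (r / 2 ^ k)| ≤ bet (r / 2 ^ k) + bet (r / 2 ^ (k + 1)) := by
  have hk : (0 : ℝ) < 2 ^ k := by positivity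
  have hk1 : (2 : ℝ) ^ (k + 1) = 2 ^ k * 2 := zpow_add_one₀ (by norm_num) k
  have hn := add_nonneg (bet_nonneg (r / 2 ^ k)) (bet_nonneg (r / 2 ^ (k + 1)))
  rcases le_or_gt r (2 ^ k) with h | h
  · rw [if_pos (h.trans h1), eta_of_le ((div_le_one hk).2 h), sub_self, abs_zero]
    exact hn
  rcases le_or_gt (2 ^ (k + 1)) r with h' | h'
  · rw [if_neg (by linarith), eta_of_ge ((le_div_iff₀ hk).2 (by linarith)), sub_self, abs_zero]
    exact hn
  have e1 : 2 * (r / 2 ^ (k + 1)) = r / 2 ^ k := by rw [hk1]; field_simp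
  have h1' : bet (r / 2 ^ k) + bet (r / 2 ^ (k + 1)) = 1 := by
    rw [bet, bet, e1, eta_of_ge (r := 2 * (r / 2 ^ k)) (by
      rw [mul_comm, ← div_le_iff₀ two_pos, div_self two_ne_zero, le_div_iff₀ hk]; linarith),
      eta_of_le (r := r / 2 ^ (k + 1)) ((div_le_one (by positivity)).2 h'.le)]
    ring
  rw [h1', abs_le]
  have a := eta_nonneg (r / 2 ^ k)
  have b := eta_le_one (r / 2 ^ k)
  split_ifs <;> constructor <;> linarith

/-- The singular kernel truncated to the annulus `ε < |x| ≤ R`. -/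
def truncKernel (Ω : Rd d → ℝ) (ε R : ℝ) (x : Rd d) : ℝ :=
  if ε < ‖x‖ ∧ ‖x‖ ≤ R then Ω x * (‖x‖ ^ d)⁻¹ else 0

theorem truncKernel_measurable {Ω : Rd d → ℝ} (hΩ : Measurable Ω) (ε R : ℝ) :
    Measurable (truncKernel Ω ε R) :=
  Measurable.ite ((measurableSet_lt measurable_const measurable_norm).inter
    (measurableSet_le measurable_norm measurable_const))
    (hΩ.mul (measurable_norm.pow_const d).inv) measurable_const

theorem abs_truncKernel_sub_le (Ω : Rd d → ℝ) {ε R : ℝ} {k K : ℤ} (hkK : k ≤ K)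
    (h1 : 2 ^ k ≤ ε) (h2 : ε < 2 ^ (k + 1)) (h3 : 2 ^ K ≤ R) (h4 : R < 2 ^ (K + 1))
    (hεR : ε ≤ R) (x : Rd d) :
    |truncKernel Ω ε R x - ∑ j ∈ Finset.Ioc k K, KK Ω j x| ≤
      (KK (fun y => |Ω y|) k x + KK (fun y => |Ω y|) (k + 1) x) +
      (KK (fun y => |Ω y|) K x + KK (fun y => |Ω y|) (K + 1) x) := by
  set r := ‖x‖
  have e : truncKernel Ω ε R x - ∑ j ∈ Finset.Ioc k K, KK Ω j x =
      Ω x * (r ^ d)⁻¹ * (((if r ≤ R then 1 else 0) - eta (r / 2 ^ K)) -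
        ((if r ≤ ε then 1 else 0) - eta (r / 2 ^ k))) := by
    have : ∑ j ∈ Finset.Ioc k K, KK Ω j x = Ω x * (r ^ d)⁻¹ * (eta (r / 2 ^ K) - eta (r / 2 ^ k)) := by
      rw [← sum_bet r hkK, Finset.mul_sum]; rfl
    rw [this, truncKernel, show ‖x‖ = r from rfl]
    rcases le_or_gt r ε with h | h
    · rw [if_neg fun h' => absurd h'.1 (not_lt.2 h), if_pos (h.trans hεR), if_pos h]; ring
    · rcases le_or_gt r R with h' | h'
      · rw [if_pos ⟨h, h'⟩, if_pos h', if_neg (not_le.2 h)]; ring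
      · rw [if_neg fun h'' => absurd h''.2 (not_le.2 h'), if_neg (not_le.2 h'),
          if_neg (not_le.2 h)]; ring
  have hn : 0 ≤ |Ω x| * (r ^ d)⁻¹ := by positivity
  rw [e, abs_mul, abs_mul, abs_of_nonneg (a := (r ^ d)⁻¹) (by positivity)]
  have := (abs_sub ((if r ≤ R then 1 else 0) - eta (r / 2 ^ K))
    ((if r ≤ ε then 1 else 0) - eta (r / 2 ^ k))).trans (add_le_add
    (abs_indicator_sub_eta_le h3 h4 r) (abs_indicator_sub_eta_le h1 h2 r))
  refine (mul_le_mul_of_nonneg_left this hn).trans (le_of_eq ?_)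
  simp only [KK]
  ring

theorem truncKernel_of_le (Ω : Rd d → ℝ) {ε R : ℝ} (h : R ≤ ε) : truncKernel Ω ε R = fun _ => 0 := by
  ext x
  rw [truncKernel, if_neg]
  exact fun h' => absurd (h'.1.trans_le (h'.2.trans h)) (lt_irrefl _)

theorem Normalized.truncKernel_int (hd : 2 ≤ d) {Ω : Rd d → ℝ} (h : Normalized d Ω) {ε : ℝ}
    (hε : 0 < ε) (R : ℝ) : Integrable (truncKernel Ω ε R) := by
  rcases le_or_gt R ε with hR | hR
  · rw [truncKernel_of_le Ω hR]; exact integrable_zero _ _ _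
  obtain ⟨k, h1, h2⟩ := exists_mem_Ico_zpow hε one_lt_two
  obtain ⟨K, h3, h4⟩ := exists_mem_Ico_zpow (hε.trans hR) one_lt_two
  have hkK : k ≤ K := by
    have : (2 : ℝ) ^ k < 2 ^ (K + 1) := (h1.trans hR.le).trans_lt h4
    have := (zpow_lt_zpow_iff_right₀ one_lt_two).1 this
    omega
  have hS : Integrable (fun x => ∑ j ∈ Finset.Ioc k K, KK Ω j x) :=
    integrable_finsetSum _ fun j _ => h.KK_int hd j
  have hB : Integrable (fun x => (KK (fun y => |Ω y|) k x + KK (fun y => |Ω y|) (k + 1) x) +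
      (KK (fun y => |Ω y|) K x + KK (fun y => |Ω y|) (K + 1) x)) :=
    ((h.abs.KK_int hd k).add (h.abs.KK_int hd _)).add ((h.abs.KK_int hd _).add (h.abs.KK_int hd _))
  have hD : Integrable (fun x => truncKernel Ω ε R x - ∑ j ∈ Finset.Ioc k K, KK Ω j x) :=
    hB.mono' ((truncKernel_measurable h.meas ε R).aestronglyMeasurable.sub hS.aestronglyMeasurable)
      (.of_forall fun x => abs_truncKernel_sub_le Ω hkK h1 h2 h3 h4 hR.le x)
  refine (hD.add hS).congr (.of_forall fun x => ?_)
  simp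

theorem abs_cv_truncKernel_le (hd : 2 ≤ d) {Ω : Rd d → ℝ} (h : Normalized d Ω) {f : Rd d → ℝ}
    (hf : Nice f) {k0 K0 : ℤ} {ε R C : ℝ} (hε : 2 ^ k0 ≤ ε) (hR : R ≤ 2 ^ K0) (hC : 0 ≤ C) {x : Rd d}
    (hx1 : ∀ k, k0 ≤ k → k ≤ K0 + 1 → |∑ j ∈ Finset.Ioc k (K0 + 1), cv (KK Ω j) f x| ≤ C)
    (hx2 : ∀ j, j ≤ K0 + 1 → cv (KK (fun y => |Ω y|) j) (fun y => |f y|) x ≤ C) :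
    |cv (truncKernel Ω ε R) f x| ≤ 6 * C := by
  have hε0 : 0 < ε := lt_of_lt_of_le (by positivity) hε
  rcases le_or_gt R ε with hεR | hεR
  · rw [truncKernel_of_le Ω hεR]; simpa [cv] using hC
  obtain ⟨k, h1, h2⟩ := exists_mem_Ico_zpow hε0 one_lt_two
  obtain ⟨K, h3, h4⟩ := exists_mem_Ico_zpow (hε0.trans hεR) one_lt_two
  have hkK : k ≤ K := by
    have : (2 : ℝ) ^ k < 2 ^ (K + 1) := (h1.trans hεR.le).trans_lt h4
    have := (zpow_lt_zpow_iff_right₀ one_lt_two).1 this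
    omega
  have hk0 : k0 ≤ k := by
    have : (2 : ℝ) ^ k0 < 2 ^ (k + 1) := hε.trans_lt h2
    have := (zpow_lt_zpow_iff_right₀ one_lt_two).1 this
    omega
  have hK0 : K ≤ K0 := (zpow_le_zpow_iff_right₀ one_lt_two).1 (h3.trans hR)
  have hS : Integrable (fun x => ∑ j ∈ Finset.Ioc k K, KK Ω j x) :=
    integrable_finsetSum _ fun j _ => h.KK_int hd j
  have hT := h.truncKernel_int hd hε0 R
  have hi := fun j => h.abs.KK_int hd j
  have hsplit : cv (truncKernel Ω ε R) f x =
      cv (fun y => truncKernel Ω ε R y - ∑ j ∈ Finset.Ioc k K, KK Ω j y) f x +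
      ∑ j ∈ Finset.Ioc k K, cv (KK Ω j) f x := by
    rw [cv_sub_left hT hS hf, cv_sum_left (fun j _ => h.KK_int hd j) hf]; ring
  have hsum : ∑ j ∈ Finset.Ioc k K, cv (KK Ω j) f x =
      ∑ j ∈ Finset.Ioc k (K0 + 1), cv (KK Ω j) f x -
        ∑ j ∈ Finset.Ioc K (K0 + 1), cv (KK Ω j) f x := by
    rw [eq_sub_iff_add_eq, ← Finset.sum_union (Finset.Ioc_disjoint_Ioc_of_le le_rfl),
      Finset.Ioc_union_Ioc_eq_Ioc hkK (by omega)]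
  have hdiff : |cv (fun y => truncKernel Ω ε R y - ∑ j ∈ Finset.Ioc k K, KK Ω j y) f x| ≤ 4 * C := by
    refine (abs_cv_le _ _ _).trans ((cv_mono
      (((hi k).add (hi (k + 1))).add ((hi K).add (hi (K + 1)))) hf.abs (fun _ => abs_nonneg _)
      (fun _ => abs_nonneg _) (abs_truncKernel_sub_le Ω hkK h1 h2 h3 h4 hεR.le) (fun _ => le_rfl)
      x).trans ?_)
    have e := cv_add_left ((hi k).add (hi (k + 1))) ((hi K).add (hi (K + 1))) hf.abs x
    have e1 := cv_add_left (hi k) (hi (k + 1)) hf.abs x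
    have e2 := cv_add_left (hi K) (hi (K + 1)) hf.abs x
    have a1 := hx2 k (by omega)
    have a2 := hx2 (k + 1) (by omega)
    have a3 := hx2 K (by omega)
    have a4 := hx2 (K + 1) (by omega)
    refine e.le.trans ?_
    refine (add_le_add e1.le e2.le).trans ?_
    linarith
  have b1 := abs_le.1 (hx1 k hk0 (by omega))
  have b2 := abs_le.1 (hx1 K (by omega) (by omega))
  have b3 := abs_le.1 hdiff
  rw [hsplit, hsum, abs_le]
  constructor <;> linarith

theorem trunc_weak_continuous (hd : 2 ≤ d) : ∃ C : ℝ, 0 < C ∧ ∀ {Ω : Rd d → ℝ}, Normalized d Ω →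
    (∫ θ : sphere (0 : Rd d) 1, Ω θ ∂sphereMeasure d = 0) → ∀ {f : Rd d → ℝ}, Continuous f →
    HasCompactSupport f → ∀ P : Finset (ℝ × ℝ), (∀ p ∈ P, 0 < p.1) → ∀ {lam : ℝ}, 0 < lam →
    volume {x | ∃ p ∈ P, lam < |cv (truncKernel Ω p.1 p.2) f x|} ≤
      ENNReal.ofReal (C / lam * ∫ x, |f x|) := by
  obtain ⟨C, hC, H⟩ := dyadic_maximal_weak hd
  refine ⟨C * (6 * C), by positivity, fun {Ω} hΩ h0 {f} hfc hfs P hP {lam} hlam => ?_⟩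
  set g : Rd d → ℝ := fun x => 6 * C / lam * f x with hg
  have hc : 0 < 6 * C / lam := by positivity
  have hgc : Continuous g := by fun_prop
  have hgs : HasCompactSupport g := hfs.mul_left
  have hgn : Nice g := by
    obtain ⟨M, hM⟩ := hgs.exists_bound_of_continuous hgc
    exact ⟨hgc.integrable_of_hasCompactSupport hgs, M, hM⟩
  obtain ⟨δ, hδ, hδg⟩ := Metric.uniformContinuous_iff.1 (hgs.uniformContinuous_of_continuous hgc) 1
    one_pos
  obtain ⟨k0, hk0⟩ : ∃ k0 : ℤ, ∀ p ∈ P, (2 : ℝ) ^ k0 ≤ p.1 := by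
    classical
    clear_value g
    induction P using Finset.induction_on with
    | empty => exact ⟨0, by simp⟩
    | insert p P hp ih =>
      obtain ⟨k, hk⟩ := ih fun q hq => hP q (Finset.mem_insert_of_mem hq)
      obtain ⟨m, hm, -⟩ := exists_mem_Ico_zpow (hP p (Finset.mem_insert_self _ _)) one_lt_two
      refine ⟨min k m, fun q hq => ?_⟩
      rcases Finset.mem_insert.1 hq with rfl | hq
      · exact (zpow_le_zpow_right₀ one_le_two (min_le_right _ _)).trans hm
      · exact (zpow_le_zpow_right₀ one_le_two (min_le_left _ _)).trans (hk q hq)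
  obtain ⟨K0, hK0⟩ : ∃ K0 : ℤ, ∀ p ∈ P, p.2 ≤ (2 : ℝ) ^ K0 := by
    classical
    clear_value g
    clear hk0
    induction P using Finset.induction_on with
    | empty => exact ⟨0, by simp⟩
    | insert p P hp ih =>
      obtain ⟨k, hk⟩ := ih fun q hq => hP q (Finset.mem_insert_of_mem hq)
      obtain ⟨m, -, hm⟩ := exists_mem_Ico_zpow (lt_of_lt_of_le one_pos (le_max_left 1 p.2))
        one_lt_two
      refine ⟨max k (m + 1), fun q hq => ?_⟩
      rcases Finset.mem_insert.1 hq with rfl | hq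
      · exact ((le_max_right _ _).trans hm.le).trans
          (zpow_le_zpow_right₀ one_le_two (le_max_right _ _))
      · exact (hk q hq).trans (zpow_le_zpow_right₀ one_le_two (le_max_left _ _))
  obtain ⟨E, hE, hE'⟩ := H hΩ h0 hgn (half_pos hδ) (fun x y hxy => by
    have := hδg (a := x) (b := y) (by rw [dist_eq_norm]; linarith)
    exact this.le) k0 (K0 + 1)
  refine (measure_mono fun x hx => ?_).trans (hE.trans (le_of_eq ?_))
  · by_contra hxE
    obtain ⟨p, hp, hlt⟩ := hx
    have hb := abs_cv_truncKernel_le hd hΩ hgn (hk0 p hp) (hK0 p hp) hC.le (hE' x hxE).1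
      (hE' x hxE).2
    have e : cv (truncKernel Ω p.1 p.2) g x = 6 * C / lam * cv (truncKernel Ω p.1 p.2) f x := by
      simp only [cv, hg, ← integral_const_mul]
      congr 1; ext y; ring
    rw [e, abs_mul, abs_of_pos hc, div_mul_eq_mul_div, div_le_iff₀ hlam] at hb
    exact absurd (le_of_mul_le_mul_left hb (by positivity)) (not_le.2 hlt)
  · congr 1
    have : ∀ x, |g x| = 6 * C / lam * |f x| := fun x => by rw [hg]; simp only; rw [abs_mul, abs_of_pos hc]
    simp only [this, integral_const_mul]
    ring

/-- The finite maximal truncation satisfies a weak type `(1,1)` bound for integrable functions. -/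
theorem trunc_weak (hd : 2 ≤ d) : ∃ C : ℝ, 0 < C ∧ ∀ {Ω : Rd d → ℝ}, Normalized d Ω →
    (∫ θ : sphere (0 : Rd d) 1, Ω θ ∂sphereMeasure d = 0) → ∀ {f : Rd d → ℝ}, Integrable f →
    ∀ P : Finset (ℝ × ℝ), (∀ p ∈ P, 0 < p.1) → ∀ {lam : ℝ}, 0 < lam →
    volume {x | ∃ p ∈ P, lam < |cv (truncKernel Ω p.1 p.2) f x|} ≤
      ENNReal.ofReal (C / lam * ∫ x, |f x|) := by
  obtain ⟨C, hC, H⟩ := trunc_weak_continuous hd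
  refine ⟨2 * C, by positivity, fun {Ω} hΩ h0 {f} hf P hP {lam} hlam => ?_⟩
  have hl2 : 0 < lam / 2 := by positivity
  set A := ∑ p ∈ P, ∫ x, |truncKernel Ω p.1 p.2 x| with hA
  have hA0 : 0 ≤ A := Finset.sum_nonneg fun p _ => integral_nonneg fun _ => abs_nonneg _
  have key : ∀ τ : ℝ, 0 < τ → volume {x | ∃ p ∈ P, lam < |cv (truncKernel Ω p.1 p.2) f x|} ≤
      ENNReal.ofReal (2 * C / lam * (∫ x, |f x|) + (2 * C / lam + A / (lam / 2)) * τ) := by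
    intro τ hτ
    obtain ⟨h, hhs, hh, hhc, hhi⟩ := hf.exists_hasCompactSupport_integral_sub_le hτ
    have hsub : Integrable (fun x => f x - h x) := hf.sub hhi
    have hex : ∀ᵐ x, ∀ p ∈ P, cv (truncKernel Ω p.1 p.2) f x =
        cv (truncKernel Ω p.1 p.2) h x + cv (truncKernel Ω p.1 p.2) (fun y => f y - h y) x := by
      rw [Filter.eventually_all_finset]
      intro p hp
      have hT := hΩ.truncKernel_int hd (hP p hp) p.2
      have ex : ∀ {g : Rd d → ℝ}, Integrable g →
          ∀ᵐ x, Integrable fun y => truncKernel Ω p.1 p.2 (x - y) * g y := by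
        intro g hg
        filter_upwards [hg.ae_convolution_exists (ContinuousLinearMap.mul ℝ ℝ) hT] with x hx
        refine hx.congr (.of_forall fun y => ?_)
        simp [mul_comm]
      filter_upwards [ex hhi, ex hsub] with x h1 h2
      simp only [cv]
      rw [← integral_add h1 h2]
      congr 1; ext y; ring
    have hsubset : {x | ∃ p ∈ P, lam < |cv (truncKernel Ω p.1 p.2) f x|} ≤ᵐ[volume]
        ({x | ∃ p ∈ P, lam / 2 < |cv (truncKernel Ω p.1 p.2) h x|} ∪
          ⋃ p ∈ P, {x | lam / 2 < |cv (truncKernel Ω p.1 p.2) (fun y => f y - h y) x|} :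
          Set (Rd d)) := by
      filter_upwards [hex] with x hx
      rintro ⟨p, hp, hlt⟩
      rw [hx p hp] at hlt
      have := hlt.trans_le (abs_add_le _ _)
      by_cases hc : lam / 2 < |cv (truncKernel Ω p.1 p.2) h x|
      · exact Or.inl ⟨p, hp, hc⟩
      · refine Or.inr (mem_biUnion hp ?_)
        show lam / 2 < _
        linarith
    have hsn : ∀ x, ‖f x - h x‖ = |f x - h x| := fun x => rfl
    simp only [hsn] at hh
    refine (measure_mono_ae hsubset).trans ((measure_union_le _ _).trans ?_)
    refine (add_le_add (H hΩ h0 hhc hhs P hP hl2) (measure_biUnion_finset_le _ _)).trans ?_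
    have hb : ∀ p ∈ P, volume {x | lam / 2 < |cv (truncKernel Ω p.1 p.2) (fun y => f y - h y) x|} ≤
        ENNReal.ofReal ((∫ x, |truncKernel Ω p.1 p.2 x|) * (τ / (lam / 2))) := by
      intro p hp
      have hT := hΩ.truncKernel_int hd (hP p hp) p.2
      refine (cheb_one (cv_integrable hT hsub) hl2).trans (ENNReal.ofReal_le_ofReal ?_)
      rw [← mul_div_assoc]
      gcongr
      refine (integral_abs_cv_le hT hsub).trans ?_
      exact mul_le_mul_of_nonneg_left hh (integral_nonneg fun _ => abs_nonneg _)
    refine (add_le_add le_rfl (Finset.sum_le_sum hb)).trans ?_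
    rw [← ENNReal.ofReal_sum_of_nonneg fun p _ => mul_nonneg (integral_nonneg fun _ => abs_nonneg _)
      (by positivity), ← Finset.sum_mul, ← hA, ← ENNReal.ofReal_add (mul_nonneg (by positivity)
      (integral_nonneg fun _ => abs_nonneg _)) (by positivity)]
    refine ENNReal.ofReal_le_ofReal ?_
    have hhf : ∫ x, |h x| ≤ (∫ x, |f x|) + τ := by
      calc _ ≤ ∫ x, (|f x| + |f x - h x|) := by
            refine integral_mono hhi.abs (hf.abs.add hsub.abs) fun x => ?_
            simp only
            have := abs_sub_abs_le_abs_sub (h x) (f x)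
            rw [abs_sub_comm] at this
            linarith
        _ = (∫ x, |f x|) + ∫ x, |f x - h x| := integral_add hf.abs hsub.abs
        _ ≤ _ := by linarith
    have := mul_le_mul_of_nonneg_left hhf (show 0 ≤ C / (lam / 2) by positivity)
    have e : C / (lam / 2) = 2 * C / lam := by field_simp
    rw [e] at this ⊢
    calc _ ≤ 2 * C / lam * ((∫ x, |f x|) + τ) + A * (τ / (lam / 2)) := by linarith
      _ = _ := by ring
  have hcont : Filter.Tendsto (fun τ : ℝ => ENNReal.ofReal (2 * C / lam * (∫ x, |f x|) +
      (2 * C / lam + A / (lam / 2)) * τ)) (nhdsWithin 0 (Ioi 0))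
      (nhds (ENNReal.ofReal (2 * C / lam * (∫ x, |f x|) +
      (2 * C / lam + A / (lam / 2)) * 0))) := by
    refine (Continuous.tendsto ?_ 0).mono_left nhdsWithin_le_nhds
    exact ENNReal.continuous_ofReal.comp (by fun_prop)
  rw [mul_zero, add_zero] at hcont
  exact ge_of_tendsto hcont (eventually_nhdsWithin_of_forall fun τ hτ => key τ hτ)

end Truncation

section MaximalTruncation

open Filter Topology

variable {d : ℕ}

theorem exists_truncKernel_of_lt {Ω f : Rd d → ℝ} {x : Rd d} {ε lam : ℝ} (hε : 0 < ε)
    (hlam : 0 < lam)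
    (h : lam < |∫ y in {y : Rd d | ε < ‖x - y‖}, Ω (x - y) * ‖x - y‖ ^ (-(d : ℤ)) * f y|) :
    ∃ p : {q : ℚ // 0 < q} × ℕ, lam < |cv (truncKernel Ω (p.1.1 : ℝ) p.2) f x| := by
  set S : Set (Rd d) := {y | ε < ‖x - y‖} with hS
  set F : Rd d → ℝ := fun y => Ω (x - y) * ‖x - y‖ ^ (-(d : ℤ)) * f y with hF
  have hnorm : Measurable fun y : Rd d => ‖x - y‖ := (measurable_const.sub measurable_id).norm
  have hSm : MeasurableSet S := measurableSet_lt measurable_const hnorm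
  have h_int : IntegrableOn F S := by
    by_contra hn
    rw [integral_undef hn, abs_zero] at h
    linarith
  have hq : ∀ n : ℕ, ∃ q : ℚ, ε < q ∧ (q : ℝ) < ε + 1 / ((n : ℝ) + 1) := fun n =>
    exists_rat_btwn (lt_add_of_pos_right _ (by positivity))
  choose q hq1 hq2 using hq
  have hq0 : ∀ n, 0 < q n := fun n => by exact_mod_cast hε.trans (hq1 n)
  have hcv : ∀ n : ℕ, cv (truncKernel Ω (q n : ℝ) n) f x =
      ∫ y, {y : Rd d | (q n : ℝ) < ‖x - y‖ ∧ ‖x - y‖ ≤ n}.indicator (S.indicator F) y := by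
    intro n
    rw [cv]
    congr 1; ext y
    rw [truncKernel]
    by_cases hy : (q n : ℝ) < ‖x - y‖ ∧ ‖x - y‖ ≤ n
    · rw [if_pos hy, indicator_of_mem (show y ∈ {y : Rd d | (q n : ℝ) < ‖x - y‖ ∧ ‖x - y‖ ≤ n} from hy),
        indicator_of_mem (show y ∈ S from (hq1 n).trans hy.1), hF]
      simp only [zpow_neg, zpow_natCast]
    · rw [if_neg hy, indicator_of_notMem (show y ∉ {y : Rd d | (q n : ℝ) < ‖x - y‖ ∧ ‖x - y‖ ≤ n} from hy),
        zero_mul]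
  have hlim : Tendsto (fun n : ℕ => cv (truncKernel Ω (q n : ℝ) n) f x) atTop
      (𝓝 (∫ y in S, F y)) := by
    simp_rw [hcv]
    rw [← integral_indicator hSm]
    have hSi : Integrable (S.indicator F) := (integrable_indicator_iff hSm).2 h_int
    refine tendsto_integral_of_dominated_convergence (fun y => |S.indicator F y|) (fun n => ?_)
      hSi.abs (fun n => .of_forall fun y => ?_) (.of_forall fun y => ?_)
    · exact hSi.aestronglyMeasurable.indicator ((measurableSet_lt measurable_const hnorm).inter
        (measurableSet_le hnorm measurable_const))
    · rw [Real.norm_eq_abs]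
      by_cases hy : y ∈ {y : Rd d | (q n : ℝ) < ‖x - y‖ ∧ ‖x - y‖ ≤ n}
      · rw [indicator_of_mem hy]
      · rw [indicator_of_notMem hy, abs_zero]; exact abs_nonneg _
    · by_cases hy : y ∈ S
      · refine tendsto_const_nhds.congr' ?_
        have h1 : ∀ᶠ n : ℕ in atTop, 1 / ((n : ℝ) + 1) < ‖x - y‖ - ε :=
          (tendsto_order.1 tendsto_one_div_add_atTop_nhds_zero_nat).2 _ (sub_pos.2 hy)
        filter_upwards [h1, eventually_ge_atTop ⌈‖x - y‖⌉₊] with n hn hn'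
        rw [indicator_of_mem (a := y)
          (s := {y : Rd d | (q n : ℝ) < ‖x - y‖ ∧ ‖x - y‖ ≤ n})]
        exact ⟨by linarith [hq2 n], Nat.ceil_le.1 hn'⟩
      · refine tendsto_const_nhds.congr fun n => ?_
        rw [indicator_of_notMem hy]
        refine (indicator_apply_eq_zero.2 fun _ => indicator_of_notMem hy _).symm
  obtain ⟨n, hn⟩ := ((tendsto_order.1 hlim.abs).1 lam h).exists
  exact ⟨(⟨q n, hq0 n⟩, n), hn⟩

theorem TOmegaStar_weak_of_normalized (hd : 2 ≤ d) : ∃ C : ℝ, 0 < C ∧ ∀ {Ω : Rd d → ℝ},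
    Normalized d Ω → (∫ θ : sphere (0 : Rd d) 1, Ω θ ∂sphereMeasure d = 0) →
    ∀ {f : Rd d → ℝ}, Integrable f → ∀ {lam : ℝ}, 0 < lam →
    volume {x | ENNReal.ofReal lam < TOmegaStar d Ω f x} ≤
      ENNReal.ofReal (C / lam * ∫ x, |f x|) := by
  classical
  obtain ⟨C, hC, H⟩ := trunc_weak hd
  refine ⟨C, hC, fun {Ω} hΩ h0 {f} hf {lam} hlam => ?_⟩
  set s : Finset ({q : ℚ // 0 < q} × ℕ) → Set (Rd d) := fun P =>
    {x | ∃ p ∈ P, lam < |cv (truncKernel Ω (p.1.1 : ℝ) p.2) f x|} with hs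
  have hsub : {x | ENNReal.ofReal lam < TOmegaStar d Ω f x} ⊆ ⋃ P, s P := by
    intro x hx
    have hx : ENNReal.ofReal lam < TOmegaStar d Ω f x := hx
    rw [TOmegaStar] at hx
    simp only [lt_iSup_iff] at hx
    obtain ⟨ε, hε, h⟩ := hx
    obtain ⟨p, hp⟩ := exists_truncKernel_of_lt hε hlam ((ENNReal.ofReal_lt_ofReal_iff_of_nonneg hlam.le).1 h)
    exact mem_iUnion.2 ⟨{p}, p, Finset.mem_singleton_self p, hp⟩
  have hmono : Monotone s := fun P Q hPQ x ⟨p, hp, hx⟩ => ⟨p, hPQ hp, hx⟩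
  refine (measure_mono hsub).trans ?_
  rw [hmono.directed_le.measure_iUnion]
  refine iSup_le fun P => ?_
  refine (measure_mono ?_).trans (H hΩ h0 hf (P.image fun p => ((p.1.1 : ℝ), (p.2 : ℝ))) ?_ hlam)
  · rintro x ⟨p, hp, hx⟩
    exact ⟨_, Finset.mem_image_of_mem _ hp, hx⟩
  · intro p hp
    obtain ⟨p', -, rfl⟩ := Finset.mem_image.1 hp
    exact Rat.cast_pos.2 p'.1.2

end MaximalTruncation

section Normalization

variable {d : ℕ}

theorem ae_eq_of_ae_eq_sphere (hd : 2 ≤ d) {Ω Ω' : Rd d → ℝ} (hom : Homogeneous0 d Ω)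
    (hom' : Homogeneous0 d Ω') (h : ∀ᵐ θ : sphere (0 : Rd d) 1 ∂sphereMeasure d, Ω θ = Ω' θ) :
    Ω =ᵐ[volume] Ω' := by
  have := nontrivial_Rd hd
  obtain ⟨Z, hZ, hZm, hZ0⟩ := exists_measurable_superset_of_null (ae_iff.1 h)
  have hZ' : MeasurableSet ((↑) '' Z : Set (Rd d)) :=
    (MeasurableEmbedding.subtype_coe isClosed_sphere.measurableSet).measurableSet_image' hZm
  set A : Set (Rd d) := {x | ‖x‖⁻¹ • x ∈ ((↑) '' Z : Set (Rd d))} with hA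
  have hmeas : Measurable fun x : Rd d => ‖x‖⁻¹ • x := measurable_norm.inv.smul measurable_id
  have hAm : MeasurableSet A := hmeas hZ'
  have hA0 : volume A = 0 := by
    rw [← lintegral_indicator_one hAm, polar_lintegral hd (measurable_one.indicator hAm)]
    have hZae : ∀ᵐ θ ∂sphereMeasure d, θ ∉ Z := measure_eq_zero_iff_ae_notMem.1 hZ0
    rw [lintegral_congr_ae (g := fun _ => 0), lintegral_zero]
    filter_upwards [hZae] with θ hθ
    rw [setLIntegral_congr_fun (g := fun _ => 0) measurableSet_Ioi, lintegral_zero]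
    intro r hr
    have hr : 0 < r := hr
    simp only
    rw [indicator_of_notMem, mul_zero]
    rintro ⟨θ', hθ', e⟩
    rw [norm_smul_sphere θ hr, smul_smul, inv_mul_cancel₀ hr.ne', one_smul] at e
    exact hθ (Subtype.ext e ▸ hθ')
  refine measure_mono_null (fun x hx => ?_) (measure_union_null hA0 (measure_singleton (0 : Rd d)))
  by_cases hx0 : x = 0
  · exact Or.inr hx0
  left
  have hn : 0 < ‖x‖⁻¹ := inv_pos.2 (norm_pos_iff.2 hx0)
  have hs : ‖x‖⁻¹ • x ∈ sphere (0 : Rd d) 1 := by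
    rw [mem_sphere_zero_iff_norm, norm_smul, norm_inv, norm_norm,
      inv_mul_cancel₀ (norm_ne_zero_iff.2 hx0)]
  refine ⟨⟨_, hs⟩, hZ ?_, rfl⟩
  show ¬ Ω (‖x‖⁻¹ • x) = Ω' (‖x‖⁻¹ • x)
  rw [hom x hx0 _ hn, hom' x hx0 _ hn]
  exact hx

theorem exists_measurable_version {Ω : Rd d → ℝ}
    (hi : Integrable (fun θ : sphere (0 : Rd d) 1 => Ω θ) (sphereMeasure d)) :
    ∃ Ω' : Rd d → ℝ, Measurable Ω' ∧ Homogeneous0 d Ω' ∧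
      ∀ᵐ θ : sphere (0 : Rd d) 1 ∂sphereMeasure d, Ω θ = Ω' θ := by
  obtain ⟨g, hg, hgω⟩ := (MeasurableEmbedding.subtype_coe
    (isClosed_sphere (x := (0 : Rd d)) (ε := 1)).measurableSet).exists_measurable_extend
    hi.1.stronglyMeasurable_mk.measurable fun _ => ⟨0⟩
  refine ⟨fun x => g (‖x‖⁻¹ • x), hg.comp (measurable_norm.inv.smul measurable_id), ?_, ?_⟩
  · intro x _ r hr
    have : ‖r • x‖⁻¹ • r • x = ‖x‖⁻¹ • x := by
      rw [norm_smul, Real.norm_of_nonneg hr.le, smul_smul, mul_inv]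
      congr 1
      field_simp
    simp only [this]
  · filter_upwards [hi.1.ae_eq_mk] with θ hθ
    rw [hθ, ← congrFun hgω θ]
    simp

theorem TOmegaStar_congr {Ω Ω' : Rd d → ℝ} (h : Ω =ᵐ[volume] Ω') (f : Rd d → ℝ) :
    TOmegaStar d Ω f = TOmegaStar d Ω' f := by
  ext x
  have hx : ∀ᵐ y, Ω (x - y) = Ω' (x - y) :=
    (quasiMeasurePreserving_sub_left volume x).ae h
  unfold TOmegaStar
  congr 1; ext ε; congr 1; ext _; congr 2
  refine integral_congr_ae (ae_restrict_of_ae ?_)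
  filter_upwards [hx] with y hy
  rw [hy]

theorem TOmegaStar_const_mul {c : ℝ} (hc : 0 ≤ c) (Ω f : Rd d → ℝ) (x : Rd d) :
    TOmegaStar d (fun y => c * Ω y) f x = ENNReal.ofReal c * TOmegaStar d Ω f x := by
  unfold TOmegaStar
  simp only [ENNReal.mul_iSup, mul_assoc, integral_const_mul, abs_mul, abs_of_nonneg hc,
    ENNReal.ofReal_mul hc]

theorem TOmegaStar_zero (f : Rd d → ℝ) (x : Rd d) : TOmegaStar d (fun _ => 0) f x = 0 := by
  simp [TOmegaStar]

theorem sphInt_congr {g g' : Rd d → ℝ}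
    (h : ∀ᵐ θ : sphere (0 : Rd d) 1 ∂sphereMeasure d, g θ = g' θ) : sphInt d g = sphInt d g' :=
  integral_congr_ae h

theorem sum_highPart_le {Ω : Rd d → ℝ} {x : Rd d} {u : ℝ} (hu : |Ω x| ≤ u) (S : ℕ) :
    ∑ s ∈ Finset.range S, |highPart Ω (s / 80) x| ≤ |Ω x| * (160 * (1 + max (Real.log u) 0)) := by
  set L := max (Real.log u) 0
  have hL : 0 ≤ L := le_max_right _ _
  have hcard : (((Finset.range S).filter fun s => ¬ |Ω x| ≤ 2 ^ (s / 80)).card : ℝ) ≤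
      160 * (1 + L) := by
    have hsub : ((Finset.range S).filter fun s => ¬ |Ω x| ≤ 2 ^ (s / 80)) ⊆
        Finset.range ⌊80 * (2 * L + 1)⌋₊ := by
      intro s hs
      have h2 := (Finset.mem_filter.1 hs).2
      rw [not_le] at h2
      have h3 := Real.log_lt_log (by positivity) (h2.trans_le hu)
      rw [Real.log_pow] at h3
      have h4 : Real.log u ≤ L := le_max_left _ _
      have h5 := Real.log_two_gt_d9
      have h6 : ((s / 80 : ℕ) : ℝ) ≤ 2 * L := by
        have : (0 : ℝ) ≤ ((s / 80 : ℕ) : ℝ) := Nat.cast_nonneg _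
        nlinarith
      have h7 : ((s + 1 : ℕ) : ℝ) ≤ 80 * ((s / 80 : ℕ) + 1 : ℝ) := by
        exact_mod_cast (show s + 1 ≤ 80 * (s / 80 + 1) by omega)
      rw [Finset.mem_range]
      exact Nat.le_floor (h7.trans (by linarith))
    have h8 := Finset.card_le_card hsub
    rw [Finset.card_range] at h8
    have h9 : (⌊80 * (2 * L + 1)⌋₊ : ℝ) ≤ 80 * (2 * L + 1) := Nat.floor_le (by positivity)
    have h10 : (((Finset.range S).filter fun s => ¬ |Ω x| ≤ 2 ^ (s / 80)).card : ℝ) ≤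
      (⌊80 * (2 * L + 1)⌋₊ : ℝ) := by exact_mod_cast h8
    linarith
  have : ∀ s, |highPart Ω (s / 80) x| = if ¬ |Ω x| ≤ 2 ^ (s / 80) then |Ω x| else 0 := by
    intro s; unfold highPart; split_ifs <;> simp_all
  simp_rw [this]
  rw [← Finset.sum_filter, Finset.sum_const, nsmul_eq_mul, mul_comm]
  exact mul_le_mul_of_nonneg_left hcard (abs_nonneg _)

theorem integrable_mul_log {Ω : Rd d → ℝ}
    (hi : Integrable (fun θ : sphere (0 : Rd d) 1 => Ω θ) (sphereMeasure d))
    (hl : Integrable (fun θ : sphere (0 : Rd d) 1 => |Ω θ| * Real.log (2 + |Ω θ|))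
      (sphereMeasure d)) {a : ℝ} (ha : 0 < a) :
    Integrable (fun θ : sphere (0 : Rd d) 1 => |Ω θ| * (1 + max (Real.log (|Ω θ| / a)) 0))
      (sphereMeasure d) := by
  have hb : Integrable (fun θ : sphere (0 : Rd d) 1 => |Ω θ| * (1 + |Real.log a|) +
      |Ω θ| * Real.log (2 + |Ω θ|)) (sphereMeasure d) := (hi.abs.mul_const _).add hl
  refine hb.mono' ?_ (.of_forall fun θ => ?_)
  · have hm := hi.1.norm.aemeasurable
    exact (hm.mul (aemeasurable_const.add
      ((Real.measurable_log.comp_aemeasurable (hm.div_const a)).max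
        aemeasurable_const))).aestronglyMeasurable
  · have h0 := abs_nonneg (Ω θ)
    have hlog : 0 ≤ Real.log (2 + |Ω θ|) := Real.log_nonneg (by linarith)
    rw [Real.norm_of_nonneg (mul_nonneg h0 (by positivity)), ← mul_add]
    refine mul_le_mul_of_nonneg_left ?_ h0
    rw [add_assoc]
    refine add_le_add_right (max_le ?_ (by positivity)) 1
    rcases h0.eq_or_lt with h | h
    · rw [← h, zero_div, Real.log_zero]; rw [← h] at hlog; positivity
    · rw [Real.log_div h.ne' ha.ne']
      have h1 := neg_abs_le (Real.log a)
      have h2 := Real.log_le_log h (show |Ω θ| ≤ 2 + |Ω θ| by linarith)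
      linarith

theorem normalized_div {Ω : Rd d → ℝ} (hm : Measurable Ω) (hom : Homogeneous0 d Ω)
    (hi : Integrable (fun θ : sphere (0 : Rd d) 1 => Ω θ) (sphereMeasure d))
    (hl : Integrable (fun θ : sphere (0 : Rd d) 1 => |Ω θ| * Real.log (2 + |Ω θ|))
      (sphereMeasure d)) (ha : 0 < omegaL1 d Ω) {D : ℝ}
    (hD : D = sphInt d fun x => |Ω x| * (1 + max (Real.log (|Ω x| / omegaL1 d Ω)) 0)) :
    0 < D ∧ Normalized d fun x => (160 * D)⁻¹ * Ω x := by
  set a := omegaL1 d Ω with haD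
  have h_int := integrable_mul_log hi hl ha
  have haD' : a ≤ D := by
    rw [hD, haD]
    refine integral_mono hi.abs h_int fun θ => ?_
    have h0 := abs_nonneg (Ω θ)
    have : (0 : ℝ) ≤ max (Real.log (|Ω θ| / a)) 0 := le_max_right _ _
    simp only
    nlinarith
  have hD0 : 0 < D := ha.trans_le haD'
  refine ⟨hD0, ⟨hm.const_mul _, fun x hx r hr => by simp only [hom x hx r hr], hi.const_mul _, ?_,
    fun S => ?_⟩⟩
  · have e : sphInt d (fun x => |(160 * D)⁻¹ * Ω x|) = (160 * D)⁻¹ * a := by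
      simp only [sphInt, abs_mul, abs_of_pos (inv_pos.2 (show 0 < 160 * D by positivity)),
        integral_const_mul]
      rfl
    rw [e, inv_mul_le_iff₀ (by positivity)]
    linarith
  · have hΩ' : Integrable (fun θ : sphere (0 : Rd d) 1 => (160 * D)⁻¹ * Ω θ) (sphereMeasure d) :=
      hi.const_mul _
    have hhi : ∀ v, Integrable (fun θ : sphere (0 : Rd d) 1 =>
        |highPart (fun x => (160 * D)⁻¹ * Ω x) v θ|) (sphereMeasure d) := fun v =>
      (hΩ'.mono ((highPart_measurable (hm.const_mul _) v).comp
        measurable_subtype_coe).aestronglyMeasurable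
        (.of_forall fun θ => abs_highPart_le_self (fun x => (160 * D)⁻¹ * Ω x) v θ)).abs
    calc _ = ∫ θ : sphere (0 : Rd d) 1, ∑ s ∈ Finset.range S,
          |highPart (fun x => (160 * D)⁻¹ * Ω x) (s / 80) θ| ∂sphereMeasure d :=
          (integral_finsetSum _ fun s _ => hhi _).symm
      _ ≤ ∫ θ : sphere (0 : Rd d) 1, D⁻¹ * (|Ω θ| * (1 + max (Real.log (|Ω θ| / a)) 0))
          ∂sphereMeasure d := by
          refine integral_mono (integrable_finsetSum _ fun s _ => hhi _) (h_int.const_mul _)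
            fun θ => ?_
          have hpos : 0 < (160 * D)⁻¹ := by positivity
          refine (sum_highPart_le (Ω := fun x => (160 * D)⁻¹ * Ω x) (x := θ) (u := |Ω θ| / a)
            ?_ S).trans (le_of_eq ?_)
          · rw [abs_mul, abs_of_pos hpos, mul_comm, div_eq_mul_inv]
            gcongr
            linarith
          · rw [abs_mul, abs_of_pos hpos, mul_inv]
            ring
      _ = D⁻¹ * D := by rw [integral_const_mul, hD]; rfl
      _ = 1 := inv_mul_cancel₀ hD0.ne'
      _ ≤ 1 := le_rfl

end Normalization

theorem weak_type_one_one_TOmegaStar :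
    ∀ d : ℕ, 2 ≤ d →
    ∃ C : ℝ, 0 < C ∧
      ∀ Ω : Rd d → ℝ,
        Homogeneous0 d Ω →
        Integrable (fun θ : sphere (0 : Rd d) 1 => Ω (θ : Rd d)) (sphereMeasure d) →
        (∫ θ : sphere (0 : Rd d) 1, Ω (θ : Rd d) ∂(sphereMeasure d)) = 0 →
        Integrable
          (fun θ : sphere (0 : Rd d) 1 => |Ω (θ : Rd d)| * Real.log (2 + |Ω (θ : Rd d)|))
          (sphereMeasure d) →
        ∀ f : Rd d → ℝ, Integrable f →
        ∀ lam : ℝ, 0 < lam →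
          ENNReal.ofReal lam * volume {x : Rd d | ENNReal.ofReal lam < TOmegaStar d Ω f x} ≤
            ENNReal.ofReal (C * constCOmega d Ω * ∫ x : Rd d, |f x|) := by
  intro d hd
  obtain ⟨C, hC, H⟩ := TOmegaStar_weak_of_normalized hd
  refine ⟨160 * C, by positivity, fun Ω hom hi h0 hl f hf lam hlam => ?_⟩
  obtain ⟨Ω', hm', hom', hae⟩ := exists_measurable_version hi
  have hi' : Integrable (fun θ : sphere (0 : Rd d) 1 => Ω' θ) (sphereMeasure d) := hi.congr hae
  have hl' : Integrable (fun θ : sphere (0 : Rd d) 1 => |Ω' θ| * Real.log (2 + |Ω' θ|))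
      (sphereMeasure d) := hl.congr (hae.mono fun θ h => by simp only [h])
  have h0' : ∫ θ : sphere (0 : Rd d) 1, Ω' θ ∂sphereMeasure d = 0 := by
    rw [← h0]; exact (integral_congr_ae hae).symm
  have ha : omegaL1 d Ω = omegaL1 d Ω' := sphInt_congr (hae.mono fun θ h => by simp only [h])
  have hc : constCOmega d Ω = constCOmega d Ω' := by
    rw [constCOmega, constCOmega, ha]
    congr 1
    · exact sphInt_congr (hae.mono fun θ h => by simp only [h])
    · exact sphInt_congr (hae.mono fun θ h => by simp only [h])
  rw [hc, TOmegaStar_congr (ae_eq_of_ae_eq_sphere hd hom hom' hae) f]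
  have ha0 : 0 ≤ omegaL1 d Ω' := integral_nonneg fun _ => abs_nonneg _
  rcases ha0.eq_or_lt with hz | hpos
  · have hz' : ∀ᵐ θ : sphere (0 : Rd d) 1 ∂sphereMeasure d, Ω' θ = 0 := by
      have := (integral_eq_zero_iff_of_nonneg (fun θ : sphere (0 : Rd d) 1 => abs_nonneg (Ω' θ))
        hi'.abs).1 hz.symm
      exact this.mono fun θ h => abs_eq_zero.1 h
    rw [TOmegaStar_congr (ae_eq_of_ae_eq_sphere (Ω' := fun _ => 0) hd hom' (fun _ _ _ _ => rfl) hz') f]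
    simp [TOmegaStar_zero]
  set D := sphInt d fun x => |Ω' x| * (1 + max (Real.log (|Ω' x| / omegaL1 d Ω')) 0) with hD
  obtain ⟨hD0, hN⟩ := normalized_div hm' hom' hi' hl' hpos hD
  have hmean : ∫ θ : sphere (0 : Rd d) 1, (160 * D)⁻¹ * Ω' θ ∂sphereMeasure d = 0 := by
    rw [integral_const_mul, h0', mul_zero]
  have hD1 : 0 < (160 * D)⁻¹ := by positivity
  have hb := H hN hmean hf (lam := (160 * D)⁻¹ * lam) (by positivity)
  have hset : {x | ENNReal.ofReal ((160 * D)⁻¹ * lam) < TOmegaStar d (fun y => (160 * D)⁻¹ * Ω' y) f x} =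
      {x | ENNReal.ofReal lam < TOmegaStar d Ω' f x} := by
    ext x
    simp only [mem_ofPred_eq]
    rw [TOmegaStar_const_mul hD1.le, ENNReal.ofReal_mul hD1.le,
      ENNReal.mul_lt_mul_iff_right (by simpa using hD0) ENNReal.ofReal_ne_top]
  rw [hset] at hb
  have hlog : 0 ≤ omegaLlogL d Ω' := integral_nonneg fun θ => mul_nonneg (abs_nonneg _)
    (Real.log_nonneg (by linarith [abs_nonneg (Ω' θ)]))
  refine (mul_le_mul_right hb _).trans ?_
  rw [← ENNReal.ofReal_mul hlam.le]
  refine ENNReal.ofReal_le_ofReal ?_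
  have hf0 : 0 ≤ ∫ x, |f x| := integral_nonneg fun _ => abs_nonneg _
  calc lam * (C / ((160 * D)⁻¹ * lam) * ∫ x, |f x|) = 160 * C * D * ∫ x, |f x| := by
        field_simp
    _ ≤ 160 * C * constCOmega d Ω' * ∫ x, |f x| := by
        refine mul_le_mul_of_nonneg_right (mul_le_mul_of_nonneg_left ?_ (by positivity)) hf0
        rw [constCOmega, ← hD]
        linarith
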